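/- Let G and H be finite metacyclic groups. If ℚG and ℚH are isomorphic as ℚ-algebras, then m^G = m^H, n^G = n^H and r^G = r^H. -/

import Mathlib

open scoped Classical

noncomputable section

namespace ArXiv230800432

/-- The `σ`-part of a natural number: product of `p ^ vₚ(n)` over primes `p ∈ σ` dividing `n`. -/
def natPart (n : ℕ) (σ : Set ℕ) : ℕ :=
  ∏ p ∈ n.primeFactors, if p ∈ σ then p ^ (n.factorization p) else 1

/-- A metacyclic factorization `G = A·B` with `A` cyclic normal and `B` cyclic. -/
structure MetacyclicFact (G : Type*) [Group G] where
  A : Subgroup G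
  B : Subgroup G
  normalA : A.Normal
  cyclicA : IsCyclic A
  cyclicB : IsCyclic B
  mul_cover : ∀ g : G, ∃ x ∈ A, ∃ y ∈ B, g = x * y

/-- A group is metacyclic if it admits a metacyclic factorization. -/
def IsMetacyclic (G : Type*) [Group G] : Prop :=
  Nonempty (MetacyclicFact G)

variable {G : Type*} [Group G]

/-- `π_G`: primes `p` dividing `|G|` such that `G` has a normal Hall `p'`-subgroup. -/
def piSet (G : Type*) [Group G] : Set ℕ :=
  {p | p.Prime ∧ p ∣ Nat.card G ∧
    ∃ N : Subgroup G, N.Normal ∧ Nat.card N = ordCompl[p] (Nat.card G)}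

/-- `π'_G = π(G) \ π_G`. -/
def piSet' (G : Type*) [Group G] : Set ℕ :=
  {p | p.Prime ∧ p ∣ Nat.card G} \ piSet G

/-- The image mod `d` of `T_G(A)`: classes `[t]_d` such that some `g ∈ G` acts on `A` by
conjugation as `x ↦ x ^ t`.  For `d = |A|` this is exactly `T_G(A)`. -/
def TGmod (A : Subgroup G) (d : ℕ) : Subgroup (ZMod d)ˣ :=
  Subgroup.closure
    {u : (ZMod d)ˣ | ∃ g : G, ∃ t : ℕ, ((t : ZMod d) = (u : ZMod d)) ∧
      ∀ x ∈ A, g⁻¹ * x * g = x ^ t}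

/-- `T_G(A)` as subgroup of `(ℤ/|A|ℤ)ˣ`. -/
def TG (A : Subgroup G) : Subgroup (ZMod (Nat.card A))ˣ :=
  TGmod A (Nat.card A)

/-- The image of `T` under `Res_q : (ℤ/dℤ)ˣ → (ℤ/qℤ)ˣ` is trivial. -/
def resTriv (d q : ℕ) (T : Subgroup (ZMod d)ˣ) : Prop :=
  ∀ u ∈ T, ∀ t : ℕ, ((t : ZMod d) = (u : ZMod d)) → (t : ZMod q) = 1

/-- The image of `T` under `Res_q` is contained in `⟨-1⟩`. -/
def resInPMOne (d q : ℕ) (T : Subgroup (ZMod d)ˣ) : Prop :=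
  ∀ u ∈ T, ∀ t : ℕ, ((t : ZMod d) = (u : ZMod d)) →
    ((t : ZMod q) = 1 ∨ (t : ZMod q) = -1)

/-- The image of `T` under `Res_q` as a set of units mod `q`. -/
def resSet (d q : ℕ) (T : Subgroup (ZMod d)ˣ) : Set (ZMod q)ˣ :=
  {v | ∃ u ∈ T, ∃ t : ℕ, ((t : ZMod d) = (u : ZMod d)) ∧ ((t : ZMod q) = (v : ZMod q))}

/-- The set of natural numbers representing elements of `T ≤ (ℤ/dℤ)ˣ`. -/
def liftSet {d : ℕ} (T : Subgroup (ZMod d)ˣ) : Set ℕ :=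
  {t | ∃ u ∈ T, (t : ZMod d) = (u : ZMod d)}

/-- `r^G(A)`: the greatest divisor `r` of `|A|` such that `Res_{r_{2'}}(T_G(A)) = 1` and
`Res_{r_2}(T_G(A)) ⊆ ⟨-1⟩`. -/
def rOfA (A : Subgroup G) : ℕ :=
  sSup {r : ℕ | r ∣ Nat.card A ∧ resTriv (Nat.card A) (ordCompl[2] r) (TG A) ∧
    resInPMOne (Nat.card A) (ordProj[2] r) (TG A)}

/-- `ε^G(A)`: `-1` if `Res_{r_2}(T_G(A)) ≠ 1`, and `1` otherwise. -/
def epsOfA (A : Subgroup G) : ℤ :=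
  if resTriv (Nat.card A) (ordProj[2] (rOfA A)) (TG A) then 1 else -1

/-- `k^G(A)`: order of the image of `T_G(A)` in `(ℤ/m_ν ℤ)ˣ`, `ν` the primes dividing `|A|`
but not `r^G(A)`. -/
def kOfA (A : Subgroup G) : ℕ :=
  (resSet (Nat.card A) (natPart (Nat.card A) {p | ¬ p ∣ rOfA A}) (TG A)).ncard

/-- The triple `(|A|, r^G(A), [G:B])` attached to a metacyclic factorization. -/
def factTriple (f : MetacyclicFact G) : ℕ × ℕ × ℕ :=
  (Nat.card f.A, rOfA f.A, f.B.index)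

/-- Lexicographic order on triples. -/
def lex3 (x y : ℕ × ℕ × ℕ) : Prop :=
  x.1 < y.1 ∨ (x.1 = y.1 ∧ (x.2.1 < y.2.1 ∨ (x.2.1 = y.2.1 ∧ x.2.2 ≤ y.2.2)))

/-- A metacyclic factorization is minimal when its triple is lexicographically minimal. -/
def IsMinimalFact (f : MetacyclicFact G) : Prop :=
  ∀ f' : MetacyclicFact G, lex3 (factTriple f) (factTriple f')

def mOf (f : MetacyclicFact G) : ℕ := Nat.card f.A
def nOf (f : MetacyclicFact G) : ℕ := f.A.index
def sOf (f : MetacyclicFact G) : ℕ := f.B.index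
def rOf (f : MetacyclicFact G) : ℕ := rOfA f.A
def epsOf (f : MetacyclicFact G) : ℤ := epsOfA f.A
def kOf (f : MetacyclicFact G) : ℕ := kOfA f.A

/-- The `σ`-part of an element of a finite group. -/
def elemPart (σ : Set ℕ) (g : G) : G :=
  g ^ ((orderOf g / natPart (orderOf g) σ) *
    (((orderOf g / natPart (orderOf g) σ : ℕ) : ZMod (natPart (orderOf g) σ))⁻¹.val))

/-- The (unique, for `N` cyclic) Hall `σ`-subgroup of a subgroup `N`. -/
def hallOf (N : Subgroup G) (σ : Set ℕ) : Subgroup G :=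
  Subgroup.closure {x : G | x ∈ N ∧ orderOf x ∣ natPart (Nat.card N) σ}

/-- `R^G = T_G(G'_{π'})`, realized as a subgroup of `(ℤ/dℤ)ˣ`. -/
def ROf (G : Type*) [Group G] (d : ℕ) : Subgroup (ZMod d)ˣ :=
  TGmod (hallOf (commutator G) (piSet' G)) d

set_option linter.unusedSectionVars false

section

/-- The period of `α` under `x ↦ x ^ t`. -/
def per {K : Type*} [Monoid K] (t : ℕ) (α : K) : ℕ := Function.minimalPeriod (fun x : K => x ^ t) α

lemma iterate_pow_apply {K : Type*} [Monoid K] (t : ℕ) (α : K) (k : ℕ) :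
    (fun x : K => x ^ t)^[k] α = α ^ t ^ k := by
  induction k with
  | zero => simp
  | succ k ih => rw [Function.iterate_succ_apply', ih, pow_succ, pow_mul]

lemma per_dvd_iff {K : Type*} [Monoid K] {t : ℕ} {α : K} {k : ℕ} :
    per t α ∣ k ↔ α ^ t ^ k = α := by
  rw [per, ← Function.isPeriodicPt_iff_minimalPeriod_dvd, Function.IsPeriodicPt,
    Function.IsFixedPt, iterate_pow_apply]

lemma pow_pow_per {K : Type*} [Monoid K] (t : ℕ) (α : K) : α ^ t ^ per t α = α :=
  per_dvd_iff.1 dvd_rfl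

/-- Numerical constraints satisfied by the parameters of a metacyclic presentation
`⟨a, b | a ^ m = 1, b ^ n = a ^ s, b⁻¹ a b = a ^ t⟩` of a group of order `m * n`. -/
structure Par (m n s t : ℕ) : Prop where
  m_pos : 0 < m
  n_pos : 0 < n
  s_mul : s * t ≡ s [MOD m]
  t_pow : t ^ n ≡ 1 [MOD m]
  cop : t.Coprime (m * n)

/-- A metacyclic presentation of `G` on the generators `a` and `b`. -/
structure Pres {G : Type*} [Group G] (a b : G) (m n s t : ℕ) : Prop extends Par m n s t where
  ord : orderOf a = m
  conj : a * b = b * a ^ t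
  pow_n : b ^ n = a ^ s
  card : Nat.card G = m * n
  dvd_of_mem : ∀ k i : ℕ, b ^ k = a ^ i → n ∣ k
  normal_form : ∀ g : G, ∃ j i : ℕ, g = b ^ j * a ^ i

lemma pow_eq_of_modEq {K : Type*} [Monoid K] {x : K} {m i j : ℕ} (hx : x ^ m = 1)
    (h : i ≡ j [MOD m]) : x ^ i = x ^ j := by
  rw [pow_eq_pow_mod i hx, pow_eq_pow_mod j hx, h]

lemma pow_mul_pow_comm_of_rel {M : Type*} [Monoid M] {A B : M} {t : ℕ} (h : A * B = B * A ^ t)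
    (i j : ℕ) : A ^ i * B ^ j = B ^ j * A ^ (i * t ^ j) := by
  have h1 : ∀ i, A ^ i * B = B * A ^ (i * t) := by
    intro i
    induction i with
    | zero => simp
    | succ i ih => rw [pow_succ, mul_assoc, h, ← mul_assoc, ih, mul_assoc, ← pow_add]; ring_nf
  induction j with
  | zero => simp
  | succ j ih => rw [pow_succ, ← mul_assoc, ih, mul_assoc, h1, ← mul_assoc, pow_succ, mul_assoc i]

section Orbit
variable {K : Type*} [Monoid K] {m n s t : ℕ}

lemma Par.per_dvd (h : Par m n s t) {α : K} (hα : α ^ m = 1) : per t α ∣ n := by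
  rw [per_dvd_iff, pow_eq_of_modEq hα h.t_pow, pow_one]

lemma Par.per_pos (h : Par m n s t) {α : K} (hα : α ^ m = 1) : 0 < per t α :=
  Nat.pos_of_dvd_of_pos (h.per_dvd hα) h.n_pos

lemma Par.pow_eq_iff (h : Par m n s t) {α : K} (hα : α ^ m = 1) {i j : ℕ} :
    α ^ t ^ i = α ^ t ^ j ↔ i ≡ j [MOD per t α] := by
  have hp := Function.minimalPeriod_pos_iff_mem_periodicPts.1 (h.per_pos hα)
  rw [← iterate_pow_apply, ← iterate_pow_apply]
  constructor
  · intro e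
    have := Function.iterate_eq_iterate_iff_of_lt_minimalPeriod
      (f := fun x : K => x ^ t) (x := α) (Nat.mod_lt i (h.per_pos hα))
      (Nat.mod_lt j (h.per_pos hα))
    exact this.1 (by
      rw [Function.iterate_mod_minimalPeriod_eq, Function.iterate_mod_minimalPeriod_eq, e])
  · intro e
    rw [← Function.iterate_mod_minimalPeriod_eq (n := i),
      ← Function.iterate_mod_minimalPeriod_eq (n := j)]
    rw [show i % Function.minimalPeriod (fun x : K => x ^ t) α
      = j % Function.minimalPeriod (fun x : K => x ^ t) α from e]

lemma Par.per_pow (h : Par m n s t) {α : K} (hα : α ^ m = 1) (i : ℕ) :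
    per t (α ^ t ^ i) = per t α := by
  apply Nat.dvd_right_iff_eq.mp
  intro k
  have h1 : (α ^ t ^ i) ^ m = 1 := by rw [← pow_mul, mul_comm, pow_mul, hα, one_pow]
  rw [per_dvd_iff, ← pow_mul, ← pow_add, h.pow_eq_iff hα, ← Nat.modEq_zero_iff_dvd]
  constructor
  · intro e; exact Nat.ModEq.add_left_cancel' i (by simpa using e)
  · intro e; simpa using Nat.ModEq.add_left i e

end Orbit

end

section

/-- `v` is an eigenvector of `A` (eigenvalue `α`) and of `B ^ per t α` (eigenvalue `β`), where
`A * B = B * A ^ t` and `A, B` act irreducibly. -/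
structure Sys {K V : Type*} [Field K] [AddCommGroup V] [Module K V] (m n s t : ℕ)
    (A B : Module.End K V) (α β : K) (v : V) : Prop where
  par : Par m n s t
  rel : A * B = B * A ^ t
  irr : ∀ W : Submodule K V, (∀ w ∈ W, A w ∈ W) → (∀ w ∈ W, B w ∈ W) → W = ⊥ ∨ W = ⊤
  ne : v ≠ 0
  eigA : A v = α • v
  eigB : (B ^ per t α) v = β • v
  powα : α ^ m = 1
  neβ : β ≠ 0

namespace Sys
variable {K V : Type*} [Field K] [AddCommGroup V] [Module K V] {m n s t : ℕ}
    {A B : Module.End K V} {α β : K} {v : V}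

lemma pow_eigen {A : Module.End K V} (h : A v = α • v) (k : ℕ) : (A ^ k) v = α ^ k • v := by
  induction k with
  | zero => simp
  | succ k ih => rw [pow_succ', Module.End.mul_apply, ih, map_smul, h, smul_smul, pow_succ]

lemma apply_pow (h : Sys m n s t A B α β v) (i : ℕ) :
    A ((B ^ i) v) = α ^ t ^ i • (B ^ i) v := by
  have := pow_mul_pow_comm_of_rel h.rel 1 i
  rw [pow_one, one_mul] at this
  rw [← Module.End.mul_apply, this, Module.End.mul_apply, pow_eigen h.eigA, map_smul]

lemma per_pos (h : Sys m n s t A B α β v) : 0 < per t α := h.par.per_pos h.powα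

lemma pow_ne (h : Sys m n s t A B α β v) (i : ℕ) : (B ^ i) v ≠ 0 := by
  intro e
  have h1 : (B ^ (per t α * i)) v = β ^ i • v := by
    rw [pow_mul]; exact pow_eigen h.eigB i
  have h2 : per t α * i = (per t α - 1) * i + i := by
    have := h.per_pos
    obtain ⟨k, hk⟩ : ∃ k, per t α = k + 1 := ⟨per t α - 1, by omega⟩
    rw [hk]; simp; ring
  rw [h2, pow_add, Module.End.mul_apply, e, map_zero] at h1
  exact smul_ne_zero (pow_ne_zero _ h.neβ) h.ne h1.symm

lemma span_eq (h : Sys m n s t A B α β v) :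
    ⊤ ≤ Submodule.span K (Set.range fun i : Fin (per t α) => (B ^ (i : ℕ)) v) := by
  have hpos := h.per_pos
  set W := Submodule.span K (Set.range fun i : Fin (per t α) => (B ^ (i : ℕ)) v) with hW
  have hmem : ∀ i : Fin (per t α), (B ^ (i : ℕ)) v ∈ W := fun i => Submodule.subset_span ⟨i, rfl⟩
  have key : ∀ T : Module.End K V, (∀ i : Fin (per t α), T ((B ^ (i : ℕ)) v) ∈ W) →
      ∀ w ∈ W, T w ∈ W := by
    intro T hT w hw
    have : W ≤ W.comap T := by
      rw [hW, Submodule.span_le]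
      rintro _ ⟨i, rfl⟩
      exact hT i
    exact this hw
  have hA : ∀ i : Fin (per t α), A ((B ^ (i : ℕ)) v) ∈ W := fun i => by
    rw [h.apply_pow]; exact W.smul_mem _ (hmem i)
  have hB : ∀ i : Fin (per t α), B ((B ^ (i : ℕ)) v) ∈ W := fun i => by
    rw [← Module.End.mul_apply, ← pow_succ']
    by_cases hi : (i : ℕ) + 1 < per t α
    · exact hmem ⟨i + 1, hi⟩
    · have : (i : ℕ) + 1 = per t α := by omega
      rw [this, h.eigB]
      exact W.smul_mem _ (by simpa using hmem ⟨0, hpos⟩)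
  rcases h.irr W (key A hA) (key B hB) with e | e
  · exact absurd ((Submodule.mem_bot K).1 (e ▸ hmem ⟨0, hpos⟩)) (h.pow_ne _)
  · exact e.ge

lemma linInd (h : Sys m n s t A B α β v) :
    LinearIndependent K (fun i : Fin (per t α) => (B ^ (i : ℕ)) v) := by
  apply Module.End.eigenvectors_linearIndependent' A (fun i : Fin (per t α) => α ^ t ^ (i : ℕ))
  · intro i j e
    have := (h.par.pow_eq_iff h.powα).1 e
    rw [Nat.ModEq, Nat.mod_eq_of_lt i.2, Nat.mod_eq_of_lt j.2] at this
    exact Fin.ext this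
  · intro i
    exact ⟨Module.End.mem_eigenspace_iff.2 (h.apply_pow _), h.pow_ne _⟩

/-- The basis `v, B v, B² v, …`. -/
def basis (h : Sys m n s t A B α β v) : Module.Basis (Fin (per t α)) K V :=
  Module.Basis.mk h.linInd h.span_eq

lemma basis_apply (h : Sys m n s t A B α β v) (i) : h.basis i = (B ^ (i : ℕ)) v := by
  simp [basis]

lemma pow_per_apply (h : Sys m n s t A B α β v) (w : V) : (B ^ per t α) w = β • w := by
  have : B ^ per t α = β • (1 : Module.End K V) := by
    apply h.basis.ext
    intro i
    rw [h.basis_apply, ← Module.End.mul_apply, ← pow_add, add_comm, pow_add, Module.End.mul_apply,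
      h.eigB, map_smul]
    simp
  rw [this]; simp

lemma eigenvalue (h : Sys m n s t A B α β v) {α' : K} {w : V} (hw : w ≠ 0)
    (e : A w = α' • w) : ∃ i, α' = α ^ t ^ i := by
  by_contra! hc
  apply hw
  apply h.basis.repr.injective
  have hA : ∀ w, ∀ i, h.basis.repr (A w) i = α ^ t ^ (i : ℕ) * h.basis.repr w i := by
    intro w i
    have : (h.basis.coord i).comp A = (α ^ t ^ (i : ℕ)) • h.basis.coord i := by
      apply h.basis.ext
      intro j
      rw [LinearMap.comp_apply, h.basis_apply, h.apply_pow, ← h.basis_apply, map_smul]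
      by_cases hij : j = i
      · subst hij; simp
      · simp [hij]
    exact LinearMap.congr_fun this w
  ext i
  have := hA w i
  rw [e, map_smul, Finsupp.smul_apply, smul_eq_mul] at this
  rcases mul_eq_mul_right_iff.1 this with h' | h'
  · exact absurd h' (hc i)
  · simpa using h'

lemma exists_equiv {V' : Type*} [AddCommGroup V'] [Module K V'] {A' B' : Module.End K V'} {v' : V'}
    (h : Sys m n s t A B α β v) (h' : Sys m n s t A' B' α β v') :
    ∃ P : V ≃ₗ[K] V', (∀ w, P (A w) = A' (P w)) ∧ ∀ w, P (B w) = B' (P w) := by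
  let P := h.basis.equiv h'.basis (Equiv.refl _)
  have hP : ∀ i : ℕ, i < per t α → P ((B ^ i) v) = (B' ^ i) v' := by
    intro i hi
    have := h.basis.equiv_apply ⟨i, hi⟩ h'.basis (Equiv.refl _)
    rwa [h.basis_apply, Equiv.refl_apply, h'.basis_apply] at this
  refine ⟨P, fun w => ?_, fun w => ?_⟩
  · have : P.toLinearMap.comp A = A'.comp P.toLinearMap := by
      apply h.basis.ext
      intro i
      simp only [LinearMap.comp_apply, LinearEquiv.coe_coe]
      rw [h.basis_apply, h.apply_pow, map_smul, hP i i.2, h'.apply_pow]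
    exact LinearMap.congr_fun this w
  · have : P.toLinearMap.comp B = B'.comp P.toLinearMap := by
      apply h.basis.ext
      intro i
      simp only [LinearMap.comp_apply, LinearEquiv.coe_coe]
      rw [h.basis_apply, hP i i.2, ← Module.End.mul_apply, ← Module.End.mul_apply,
        ← pow_succ', ← pow_succ']
      by_cases hi : (i : ℕ) + 1 < per t α
      · exact hP _ hi
      · have e : (i : ℕ) + 1 = per t α := by omega
        rw [e, h.eigB, h'.eigB, map_smul]
        have h0 := hP 0 h.per_pos
        simp only [pow_zero, Module.End.one_apply] at h0
        rw [h0]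
    exact LinearMap.congr_fun this w

lemma finrank_eq (h : Sys m n s t A B α β v) : Module.finrank K V = per t α := by
  rw [Module.finrank_eq_card_basis h.basis, Fintype.card_fin]

end Sys

end

section

/-- A matrix representation of the rational group algebra, over `K`. -/
abbrev QRep (K : Type*) [Field K] (G : Type*) [Group G] (k : ℕ) : Type _ :=
  MonoidAlgebra ℚ G →+* Matrix (Fin (k + 1)) (Fin (k + 1)) K

namespace QRep

section Defs
variable {K : Type*} [Field K] {G : Type*} [Group G] {k : ℕ}

/-- The action on column vectors. -/
def act (ρ : QRep K G k) : MonoidAlgebra ℚ G →+* Module.End K (Fin (k + 1) → K) :=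
  (Matrix.toLinAlgEquiv' (R := K) (n := Fin (k + 1))).toRingEquiv.toRingHom.comp ρ

lemma act_apply (ρ : QRep K G k) (x : MonoidAlgebra ℚ G) (v : Fin (k + 1) → K) :
    ρ.act x v = (ρ x).mulVec v := rfl

/-- The image of a group element. -/
abbrev el (ρ : QRep K G k) (g : G) : Module.End K (Fin (k + 1) → K) :=
  ρ.act (MonoidAlgebra.of ℚ G g)

lemma el_mul (ρ : QRep K G k) (g h : G) : ρ.el (g * h) = ρ.el g * ρ.el h := by
  simp only [el, map_mul]

lemma el_pow (ρ : QRep K G k) (g : G) (i : ℕ) : ρ.el (g ^ i) = ρ.el g ^ i := by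
  simp only [el, map_pow]

lemma el_one (ρ : QRep K G k) : ρ.el 1 = 1 := by
  simp only [el, map_one]

/-- Irreducibility. -/
def IsIrr (ρ : QRep K G k) : Prop :=
  ∀ W : Submodule K (Fin (k + 1) → K), (∀ x, ∀ w ∈ W, ρ.act x w ∈ W) → W = ⊥ ∨ W = ⊤

/-- `x` is a pair of eigenvalues of `a` and `b ^ per t x.1` on a common eigenvector. -/
def IsType (ρ : QRep K G k) (a b : G) (t : ℕ) (x : K × K) : Prop :=
  ∃ v, v ≠ 0 ∧ ρ.el a v = x.1 • v ∧ (ρ.el b ^ per t x.1) v = x.2 • v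

end Defs

/-- Pairs occurring as types. -/
def _root_.ArXiv230800432.XMem {K : Type*} [Monoid K] (m n s t : ℕ) (x : K × K) : Prop :=
  x.1 ^ m = 1 ∧ x.2 ^ (n / per t x.1) = x.1 ^ s

variable {K : Type*} [Field K] [CharZero K] {G : Type*} [Group G] {k : ℕ} {a b : G} {m n s t : ℕ}

lemma act_smul (ρ : QRep K G k) (q : ℚ) (x : MonoidAlgebra ℚ G) (w) :
    ρ.act (q • x) w = (q : K) • ρ.act x w := by
  have h1 : q • x = algebraMap ℚ _ q * x := by rw [Algebra.smul_def]
  have h2 : ρ (algebraMap ℚ (MonoidAlgebra ℚ G) q) =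
      algebraMap ℚ (Matrix (Fin (k + 1)) (Fin (k + 1)) K) q := RingHom.map_rat_algebraMap ρ q
  rw [h1, act_apply, map_mul, h2, ← Algebra.smul_def, act_apply, Matrix.smul_mulVec]
  ext i
  simp [Algebra.smul_def]

lemma invariant_of (hG : Pres a b m n s t) (ρ : QRep K G k) (W : Submodule K (Fin (k + 1) → K))
    (hA : ∀ w ∈ W, ρ.el a w ∈ W) (hB : ∀ w ∈ W, ρ.el b w ∈ W) (x) : ∀ w ∈ W, ρ.act x w ∈ W := by
  have hpow : ∀ T : Module.End K (Fin (k + 1) → K), (∀ w ∈ W, T w ∈ W) →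
      ∀ i : ℕ, ∀ w ∈ W, (T ^ i) w ∈ W := by
    intro T hT i
    induction i with
    | zero => intro w hw; simpa using hw
    | succ i ih => intro w hw; rw [pow_succ', Module.End.mul_apply]; exact hT _ (ih w hw)
  induction x using MonoidAlgebra.induction_on with
  | of g =>
    intro w hw
    obtain ⟨j, i, rfl⟩ := hG.normal_form g
    change ρ.el _ w ∈ W
    rw [el_mul, el_pow, el_pow]
    exact hpow _ hB _ _ (hpow _ hA _ _ hw)
  | add x y hx hy =>
    intro w hw
    rw [map_add]
    exact W.add_mem (hx w hw) (hy w hw)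
  | smul q x hx => intro w hw; rw [act_smul]; exact W.smul_mem _ (hx w hw)

lemma el_rel (hG : Pres a b m n s t) (ρ : QRep K G k) :
    ρ.el a * ρ.el b = ρ.el b * ρ.el a ^ t := by
  rw [← el_mul, hG.conj, el_mul, el_pow]

lemma IsType.mem [Finite G] (hG : Pres a b m n s t) {ρ : QRep K G k} {x : K × K}
    (h : ρ.IsType a b t x) : XMem m n s t x := by
  obtain ⟨v, hv, hA, hB⟩ := h
  have h1 : x.1 ^ m = 1 := by
    have : ρ.el a ^ m = 1 := by
      rw [← el_pow, ← hG.ord, pow_orderOf_eq_one, el_one]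
    have h2 := Sys.pow_eigen hA m
    rw [this, Module.End.one_apply] at h2
    by_contra hc
    have h3 : (x.1 ^ m - 1) • v = 0 := by rw [sub_smul, ← h2, one_smul, sub_self]
    exact (smul_ne_zero (sub_ne_zero.2 hc) hv) h3
  refine ⟨h1, ?_⟩
  have h2 := Sys.pow_eigen hB (n / per t x.1)
  rw [← pow_mul, Nat.mul_div_cancel' (hG.toPar.per_dvd h1), ← el_pow, hG.pow_n, el_pow,
    Sys.pow_eigen hA] at h2
  by_contra hc
  have h3 : (x.2 ^ (n / per t x.1) - x.1 ^ s) • v = 0 := by rw [sub_smul, ← h2, sub_self]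
  exact (smul_ne_zero (sub_ne_zero.2 hc) hv) h3

lemma _root_.ArXiv230800432.XMem.per_pos {x : K × K} (hG : Par m n s t) (h : XMem m n s t x) :
    0 < per t x.1 := hG.per_pos h.1

lemma _root_.ArXiv230800432.XMem.div_pos {x : K × K} (hG : Par m n s t) (h : XMem m n s t x) :
    0 < n / per t x.1 := Nat.div_pos (Nat.le_of_dvd hG.n_pos (hG.per_dvd h.1)) (h.per_pos hG)

lemma _root_.ArXiv230800432.XMem.ne_fst {x : K × K} (hG : Par m n s t) (h : XMem m n s t x) :
    x.1 ≠ 0 := by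
  intro e
  have := h.1
  rw [e, zero_pow hG.m_pos.ne'] at this
  exact zero_ne_one this

lemma _root_.ArXiv230800432.XMem.ne_snd {x : K × K} (hG : Par m n s t) (h : XMem m n s t x) :
    x.2 ≠ 0 := by
  intro e
  have := h.2
  rw [e, zero_pow (h.div_pos hG).ne'] at this
  exact pow_ne_zero _ (h.ne_fst hG) this.symm

lemma IsType.sys [Finite G] (hG : Pres a b m n s t) {ρ : QRep K G k} (hρ : ρ.IsIrr) {x : K × K}
    (h : ρ.IsType a b t x) : ∃ v, Sys m n s t (ρ.el a) (ρ.el b) x.1 x.2 v := by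
  have hx := h.mem hG
  obtain ⟨v, hv, hA, hB⟩ := h
  exact ⟨v, hG.toPar, el_rel hG ρ, fun W hWA hWB => hρ W (invariant_of hG ρ W hWA hWB), hv, hA, hB,
    hx.1, hx.ne_snd hG.toPar⟩

/-- Two pairs in the same orbit of `(α, β) ↦ (α ^ t, β)`. -/
def _root_.ArXiv230800432.Orb {K : Type*} [Monoid K] (t : ℕ) (x y : K × K) : Prop :=
  ∃ i : ℕ, y = (x.1 ^ t ^ i, x.2)

lemma IsType.orb [Finite G] (hG : Pres a b m n s t) {ρ : QRep K G k} (hρ : ρ.IsIrr) {x y : K × K}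
    (hx : ρ.IsType a b t x) (hy : ρ.IsType a b t y) : Orb t x y := by
  obtain ⟨v, hv⟩ := hx.sys hG hρ
  obtain ⟨w, hw, hA, hB⟩ := hy
  obtain ⟨i, hi⟩ := hv.eigenvalue hw hA
  refine ⟨i, Prod.ext hi ?_⟩
  rw [hi, hG.toPar.per_pow hv.powα, hv.pow_per_apply] at hB
  exact (smul_left_injective K hw hB).symm

lemma IsType.of_orb [Finite G] (hG : Pres a b m n s t) {ρ : QRep K G k} (hρ : ρ.IsIrr)
    {x y : K × K} (hx : ρ.IsType a b t x) (hy : Orb t x y) : ρ.IsType a b t y := by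
  obtain ⟨v, hv⟩ := hx.sys hG hρ
  obtain ⟨i, rfl⟩ := hy
  exact ⟨_, hv.pow_ne i, hv.apply_pow i, by
    rw [hG.toPar.per_pow hv.powα, hv.pow_per_apply]⟩

lemma IsType.per_eq [Finite G] (hG : Pres a b m n s t) {ρ : QRep K G k} (hρ : ρ.IsIrr) {x : K × K}
    (hx : ρ.IsType a b t x) : per t x.1 = k + 1 := by
  obtain ⟨v, hv⟩ := hx.sys hG hρ
  rw [← hv.finrank_eq]; simp

/-- Equivalence of representations. -/
def Eqv {l : ℕ} (ρ : QRep K G k) (ρ' : QRep K G l) : Prop :=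
  ∃ P : (Fin (k + 1) → K) ≃ₗ[K] (Fin (l + 1) → K), ∀ x w, P (ρ.act x w) = ρ'.act x (P w)

lemma IsType.of_eqv {l : ℕ} {ρ : QRep K G k} {ρ' : QRep K G l} (h : ρ.Eqv ρ')
    {x : K × K} (hx : ρ.IsType a b t x) : ρ'.IsType a b t x := by
  obtain ⟨P, hP⟩ := h
  obtain ⟨v, hv, hA, hB⟩ := hx
  refine ⟨P v, by simpa using hv, ?_, ?_⟩
  · rw [← hP, hA, map_smul]
  · rw [← map_pow, ← hP, map_pow, hB, map_smul]

lemma eqv_of_isType [Finite G] {l : ℕ} (hG : Pres a b m n s t) {ρ : QRep K G k} {ρ' : QRep K G l}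
    (hρ : ρ.IsIrr) (hρ' : ρ'.IsIrr) {x : K × K} (hx : ρ.IsType a b t x)
    (hx' : ρ'.IsType a b t x) : ρ.Eqv ρ' := by
  obtain ⟨v, hv⟩ := hx.sys hG hρ
  obtain ⟨v', hv'⟩ := hx'.sys hG hρ'
  obtain ⟨P, hPA, hPB⟩ := hv.exists_equiv hv'
  have hpow : ∀ (S : Module.End K (Fin (k + 1) → K)) (T : Module.End K (Fin (l + 1) → K)),
      (∀ w, P (S w) = T (P w)) → ∀ (i : ℕ) w, P ((S ^ i) w) = (T ^ i) (P w) := by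
    intro S T h i
    induction i with
    | zero => intro w; simp
    | succ i ih => intro w; rw [pow_succ', Module.End.mul_apply, h, ih, pow_succ' T]; rfl
  refine ⟨P, fun x => ?_⟩
  induction x using MonoidAlgebra.induction_on with
  | of g =>
    intro w
    obtain ⟨j, i, rfl⟩ := hG.normal_form g
    change P (ρ.el _ w) = ρ'.el _ _
    rw [el_mul, el_pow, el_pow, el_mul, el_pow, el_pow, Module.End.mul_apply,
      hpow _ _ hPB, hpow _ _ hPA]; rfl
  | add x y hx hy =>
    intro w
    rw [map_add, map_add, LinearMap.add_apply, LinearMap.add_apply, map_add, hx, hy]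
  | smul q x hx => intro w; rw [act_smul, act_smul, map_smul, hx]

lemma exists_isType [IsAlgClosed K] [Finite G] (hG : Pres a b m n s t) (ρ : QRep K G k) :
    ∃ x, ρ.IsType a b t x := by
  obtain ⟨α, hα⟩ := Module.End.exists_eigenvalue (ρ.el a)
  set E := Module.End.eigenspace (ρ.el a) α
  have hm : α ^ m = 1 := by
    obtain ⟨v, hv⟩ := hα.exists_hasEigenvector
    have : ρ.el a ^ m = 1 := by
      rw [← el_pow, ← hG.ord, pow_orderOf_eq_one, el_one]
    have h2 := Sys.pow_eigen (hv.apply_eq_smul) m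
    rw [this, Module.End.one_apply] at h2
    by_contra hc
    have h3 : (α ^ m - 1) • v = 0 := by rw [sub_smul, ← h2, one_smul, sub_self]
    exact (smul_ne_zero (sub_ne_zero.2 hc) hv.2) h3
  have hE : ∀ w ∈ E, (ρ.el b ^ per t α) w ∈ E := by
    intro w hw
    rw [Module.End.mem_eigenspace_iff] at hw ⊢
    have := pow_mul_pow_comm_of_rel (el_rel hG ρ) 1 (per t α)
    rw [pow_one, one_mul] at this
    rw [← Module.End.mul_apply, this, Module.End.mul_apply, Sys.pow_eigen hw, map_smul,
      pow_pow_per]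
  have : Nontrivial E := (Submodule.nontrivial_iff_ne_bot).2 hα
  obtain ⟨β, hβ⟩ := Module.End.exists_eigenvalue (LinearMap.restrict (ρ.el b ^ per t α) hE)
  obtain ⟨v, hv⟩ := hβ.exists_hasEigenvector
  refine ⟨(α, β), v, by simpa using hv.2, Module.End.mem_eigenspace_iff.1 v.2, ?_⟩
  exact congrArg Subtype.val hv.apply_eq_smul

end QRep

end

section

set_option linter.unusedSectionVars false

lemma Pres.exists_hom {G : Type*} [Group G] {a b : G} {m n s t : ℕ} (hG : Pres a b m n s t)
    {M : Type*} [Monoid M] {A B : M} (hA : A ^ m = 1) (hB : B ^ n = A ^ s)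
    (hAB : A * B = B * A ^ t) : ∃ f : G →* M, f a = A ∧ f b = B := by
  have key : ∀ j i j' i' : ℕ, j' ≤ j → b ^ j * a ^ i = b ^ j' * a ^ i' →
      B ^ j * A ^ i = B ^ j' * A ^ i' := by
    intro j i j' i' hj e
    obtain ⟨d, rfl⟩ := Nat.exists_eq_add_of_le hj
    rw [pow_add, mul_assoc, mul_right_inj] at e
    obtain ⟨q, rfl⟩ : n ∣ d := by
      have h1 : b ^ d = a ^ (i' + (m * i - i)) := by
        have h2 : a ^ i * a ^ (m * i - i) = 1 := by
          rw [← pow_add, Nat.add_sub_cancel' (Nat.le_mul_of_pos_left _ hG.m_pos), pow_mul, ← hG.ord,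
            pow_orderOf_eq_one, one_pow]
        rw [pow_add, ← e, mul_assoc, h2, mul_one]
      exact hG.dvd_of_mem _ _ h1
    rw [pow_mul, hG.pow_n, ← pow_mul, ← pow_add, pow_eq_pow_iff_modEq, hG.ord] at e
    rw [pow_add, mul_assoc, pow_mul, hB, ← pow_mul, ← pow_add, pow_eq_of_modEq hA e]
  have key' : ∀ j i j' i' : ℕ, b ^ j * a ^ i = b ^ j' * a ^ i' →
      B ^ j * A ^ i = B ^ j' * A ^ i' := by
    intro j i j' i' e
    rcases le_total j' j with h | h
    · exact key _ _ _ _ h e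
    · exact (key _ _ _ _ h e.symm).symm
  choose J I hJI using hG.normal_form
  refine ⟨⟨⟨fun g => B ^ J g * A ^ I g, ?_⟩, ?_⟩, ?_, ?_⟩
  · have := key' (J 1) (I 1) 0 0 (by rw [← hJI]; simp)
    simpa using this
  · intro g h
    have := key' (J (g * h)) (I (g * h)) (J g + J h) (I g * t ^ J h + I h) (by
      rw [← hJI, pow_add, pow_add, mul_assoc, ← mul_assoc _ _ (a ^ I h),
        ← pow_mul_pow_comm_of_rel hG.conj, mul_assoc (a ^ I g), ← hJI, ← mul_assoc, ← hJI])
    change B ^ J (g * h) * A ^ I (g * h) = B ^ J g * A ^ I g * (B ^ J h * A ^ I h)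
    rw [this, pow_add, pow_add, mul_assoc, ← mul_assoc _ _ (A ^ I h),
        ← pow_mul_pow_comm_of_rel hAB, mul_assoc (A ^ I g), ← mul_assoc]
  · have := key' (J a) (I a) 0 1 (by rw [← hJI]; simp)
    simpa using this
  · have := key' (J b) (I b) 1 0 (by rw [← hJI]; simp)
    simpa using this

open scoped Fin.NatCast Fin.CommRing

section Monomial
variable {K : Type*} [Field K] {k : ℕ}

/-- Diagonal operator. -/
def diagOp (c : Fin (k + 1) → K) : Module.End K (Fin (k + 1) → K) where
  toFun w := fun i => c i * w i
  map_add' v w := by ext i; simp [mul_add]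
  map_smul' r w := by ext i; simp; ring

/-- Scaled cyclic shift. -/
def shiftOp (k : ℕ) (β : K) : Module.End K (Fin (k + 1) → K) where
  toFun w := fun i => β * w (i - 1)
  map_add' v w := by ext i; simp [mul_add]
  map_smul' r w := by ext i; simp; ring

lemma diagOp_apply (c w : Fin (k + 1) → K) (i) : diagOp c w i = c i * w i := rfl

lemma shiftOp_apply (β : K) (w : Fin (k + 1) → K) (i) : shiftOp k β w i = β * w (i - 1) := rfl

lemma diagOp_pow_apply (c w : Fin (k + 1) → K) (j : ℕ) (i) :
    (diagOp c ^ j) w i = c i ^ j * w i := by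
  induction j with
  | zero => simp
  | succ j ih => rw [pow_succ', Module.End.mul_apply, diagOp_apply, ih]; ring

lemma shiftOp_pow_apply (β : K) (w : Fin (k + 1) → K) (j : ℕ) (i) :
    (shiftOp k β ^ j) w i = β ^ j * w (i - (j : Fin (k + 1))) := by
  induction j generalizing i with
  | zero => simp
  | succ j ih =>
    rw [pow_succ', Module.End.mul_apply, shiftOp_apply, ih, Nat.cast_succ,
      sub_sub, add_comm (1 : Fin (k + 1))]; ring

lemma aeval_diagOp_apply (c w : Fin (k + 1) → K) (p : Polynomial K) (i) :
    (Polynomial.aeval (diagOp c) p) w i = p.eval (c i) * w i := by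
  induction p using Polynomial.induction_on' with
  | add p q hp hq => simp [hp, hq, add_mul]
  | monomial j r =>
    rw [Polynomial.aeval_monomial, Polynomial.eval_monomial, Module.End.mul_apply,
      Module.algebraMap_end_apply, Pi.smul_apply, diagOp_pow_apply, smul_eq_mul, mul_assoc]

lemma monomial_irr {c : Fin (k + 1) → K} (hc : Function.Injective c) {β : K} (hβ : β ≠ 0)
    (W : Submodule K (Fin (k + 1) → K)) (hA : ∀ w ∈ W, diagOp c w ∈ W)
    (hB : ∀ w ∈ W, shiftOp k β w ∈ W) : W = ⊥ ∨ W = ⊤ := by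
  by_cases hW : W = ⊥
  · exact Or.inl hW
  right
  obtain ⟨w, hw, hw0⟩ := (Submodule.ne_bot_iff W).1 hW
  obtain ⟨i, hi⟩ := Function.ne_iff.1 hw0
  have hpow : ∀ T : Module.End K (Fin (k + 1) → K), (∀ w ∈ W, T w ∈ W) →
      ∀ j : ℕ, ∀ w ∈ W, (T ^ j) w ∈ W := by
    intro T hT j
    induction j with
    | zero => intro w hw; simpa using hw
    | succ i ih => intro w hw; rw [pow_succ', Module.End.mul_apply]; exact hT _ (ih w hw)
  have hpoly : ∀ p : Polynomial K, Polynomial.aeval (diagOp c) p w ∈ W := by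
    intro p
    induction p using Polynomial.induction_on' with
    | add p q hp hq => rw [map_add]; exact W.add_mem hp hq
    | monomial j r =>
      rw [Polynomial.aeval_monomial, Module.End.mul_apply, Module.algebraMap_end_apply]
      exact W.smul_mem _ (hpow _ hA _ _ hw)
  have hsing : Pi.single i (1 : K) ∈ W := by
    have := W.smul_mem (w i)⁻¹ (hpoly (Lagrange.basis Finset.univ c i))
    convert this using 1
    ext j
    rw [Pi.smul_apply, aeval_diagOp_apply]
    by_cases hj : j = i
    · subst hj
      rw [Lagrange.eval_basis_self hc.injOn (Finset.mem_univ _)]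
      have : w j ≠ 0 := hi
      simp [this]
    · rw [Lagrange.eval_basis_of_ne (Ne.symm hj) (Finset.mem_univ _)]
      simp [hj]
  have hall : ∀ j, Pi.single j (1 : K) ∈ W := by
    intro j
    have := W.smul_mem ((β ^ (j - i).val)⁻¹) (hpow _ hB (j - i).val _ hsing)
    convert this using 1
    ext l
    rw [Pi.smul_apply, shiftOp_pow_apply, Fin.cast_val_eq_self, smul_eq_mul, ← mul_assoc,
      inv_mul_cancel₀ (pow_ne_zero _ hβ), one_mul, Pi.single_apply, Pi.single_apply]
    have : l = j ↔ l - (j - i) = i := by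
      rw [sub_eq_iff_eq_add, add_sub_cancel]
    simp only [this]
  rw [eq_top_iff]
  intro u _
  rw [pi_eq_sum_univ' u]
  exact W.sum_mem fun j _ => W.smul_mem _ (by
    convert hall j using 1)

end Monomial

namespace QRep
variable {K : Type*} [Field K] [CharZero K] [IsAlgClosed K] {G : Type*} [Group G] {a b : G}
  {m n s t : ℕ}

lemma exists_of_mem (hG : Pres a b m n s t) {x : K × K} (hx : XMem m n s t x) :
    ∃ (k : ℕ) (ρ : QRep K G k), ρ.IsIrr ∧ ρ.IsType a b t x := by
  obtain ⟨k, hk⟩ : ∃ k, per t x.1 = k + 1 := ⟨per t x.1 - 1, by have := hx.per_pos hG.toPar; omega⟩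
  obtain ⟨β, hβ⟩ := IsAlgClosed.exists_pow_nat_eq x.2 (Nat.succ_pos k)
  have hβ0 : β ≠ 0 := by
    rintro rfl
    exact hx.ne_snd hG.toPar (by rw [← hβ]; simp)
  set c : Fin (k + 1) → K := fun i => x.1 ^ t ^ (i : ℕ) with hc
  have hcinj : Function.Injective c := by
    intro i j e
    have := (hG.toPar.pow_eq_iff hx.1).1 e
    rw [Nat.ModEq, hk, Nat.mod_eq_of_lt i.2, Nat.mod_eq_of_lt j.2] at this
    exact Fin.ext this
  have hAm : diagOp c ^ m = 1 := by
    ext1 i; ext j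
    simp only [LinearMap.comp_apply, diagOp_pow_apply, hc]
    rw [← pow_mul, mul_comm (t ^ _), pow_mul, hx.1, one_pow, one_mul]; rfl
  have hBn : shiftOp k β ^ n = diagOp c ^ s := by
    have h0 : ((n : ℕ) : Fin (k + 1)) = 0 := by
      rw [Fin.natCast_eq_zero, ← hk]; exact hG.toPar.per_dvd hx.1
    have h1 : β ^ n = x.1 ^ s := by
      rw [← hx.2, ← hβ, ← pow_mul, hk]
      have hd : k + 1 ∣ n := hk ▸ hG.toPar.per_dvd hx.1
      exact congrArg _ (Nat.mul_div_cancel' hd).symm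
    have h2 : ∀ i : ℕ, s * t ^ i ≡ s [MOD m] := by
      intro i
      induction i with
      | zero => simpa using Nat.ModEq.refl s
      | succ i ih =>
        rw [pow_succ, ← mul_assoc]
        exact (ih.mul_right t).trans hG.s_mul
    ext1 i; ext j
    simp only [LinearMap.comp_apply, diagOp_pow_apply, shiftOp_pow_apply, h0, sub_zero, h1, hc]
    rw [← pow_mul, mul_comm (t ^ _), pow_eq_of_modEq hx.1 (h2 j)]
  have hAB : diagOp c * shiftOp k β = shiftOp k β * diagOp c ^ t := by
    have hc1 : ∀ i, c i = c (i - 1) ^ t := by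
      intro i
      rw [hc]
      simp only
      rw [← pow_mul, ← pow_succ, hG.toPar.pow_eq_iff hx.1, hk]
      have : i = (i - 1) + 1 := by simp
      conv_lhs => rw [this, Fin.val_add]
      rcases Nat.eq_zero_or_pos k with rfl | hk0
      · simp [Nat.ModEq]
      · rw [Fin.val_one', Nat.mod_eq_of_lt (by omega : 1 < k + 1)]
        exact Nat.mod_modEq _ _
    ext1 i; ext j
    simp only [LinearMap.comp_apply, Module.End.mul_apply, diagOp_pow_apply, shiftOp_apply,
      diagOp_apply]
    rw [hc1 j]; ring
  obtain ⟨f, hfa, hfb⟩ := hG.exists_hom hAm hBn hAB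
  let F : MonoidAlgebra ℚ G →ₐ[ℚ] Module.End K (Fin (k + 1) → K) := MonoidAlgebra.lift ℚ _ G f
  let ρ : QRep K G k :=
    (Matrix.toLinAlgEquiv' (R := K) (n := Fin (k + 1))).symm.toRingEquiv.toRingHom.comp F.toRingHom
  have hact : ∀ x, ρ.act x = F x := fun x =>
    (Matrix.toLinAlgEquiv' (R := K) (n := Fin (k + 1))).apply_symm_apply (F x)
  have hela : ρ.el a = diagOp c := by rw [el, hact, MonoidAlgebra.lift_of, hfa]
  have helb : ρ.el b = shiftOp k β := by rw [el, hact, MonoidAlgebra.lift_of, hfb]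
  refine ⟨k, ρ, ?_, ?_⟩
  · intro W hW
    apply monomial_irr hcinj hβ0 W
    · intro w hw; rw [← hela]; exact hW _ w hw
    · intro w hw; rw [← helb]; exact hW _ w hw
  · refine ⟨Pi.single 0 1, by simp, ?_, ?_⟩
    · rw [hela]
      ext j
      rw [diagOp_apply, Pi.smul_apply, smul_eq_mul]
      by_cases hj : j = 0
      · subst hj; simp [hc]
      · simp [hj]
    · rw [helb, hk]
      ext j
      rw [shiftOp_pow_apply, hβ, Pi.smul_apply, smul_eq_mul]
      congr 2
      have : ((k + 1 : ℕ) : Fin (k + 1)) = 0 := by rw [Fin.natCast_eq_zero]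
      rw [this, sub_zero]

end QRep

end

section

set_option linter.unusedSectionVars false

section Orb
variable {K : Type*} [Field K] {m n s t : ℕ} {x y : K × K}

lemma Orb.refl (t : ℕ) (x : K × K) : Orb t x x := ⟨0, by simp⟩

lemma Orb.per_eq (h : Par m n s t) (hx : XMem m n s t x) (ho : Orb t x y) :
    per t y.1 = per t x.1 := by
  obtain ⟨i, rfl⟩ := ho
  exact h.per_pow hx.1 i

lemma XMem.pow_snd (h : Par m n s t) (hx : XMem m n s t x) : x.2 ^ (m * n) = 1 := by
  have h1 : m * n = (n / per t x.1) * (per t x.1 * m) := by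
    rw [← mul_assoc, Nat.div_mul_cancel (h.per_dvd hx.1), mul_comm]
  rw [h1, pow_mul, hx.2, ← pow_mul, show s * (per t x.1 * m) = m * (s * per t x.1) by ring,
    pow_mul, hx.1, one_pow]

lemma XMem.pow_fst (hx : XMem m n s t x) : x.1 ^ (m * n) = 1 := by
  rw [pow_mul, hx.1, one_pow]

/-- The finite set of all pairs that occur as types. -/
def XS (K : Type*) [Field K] (m n s t : ℕ) : Finset (K × K) :=
  (Polynomial.nthRootsFinset (m * n) (1 : K) ×ˢ Polynomial.nthRootsFinset (m * n) (1 : K)).filter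
    (XMem m n s t)

lemma mem_XS (h : Par m n s t) : x ∈ XS K m n s t ↔ XMem m n s t x := by
  have hN : 0 < m * n := Nat.mul_pos h.m_pos h.n_pos
  simp only [XS, Finset.mem_filter, Finset.mem_product, Polynomial.mem_nthRootsFinset hN]
  exact ⟨fun e => e.2, fun e => ⟨⟨e.pow_fst, e.pow_snd h⟩, e⟩⟩

/-- The class of `x` is invariant under `z ↦ z ^ u`. -/
def Fix (t u : ℕ) (x : K × K) : Prop := Orb t x (x.1 ^ u, x.2 ^ u)

lemma Orb.fix {u : ℕ} (ho : Orb t x y) (hf : Fix t u x) : Fix t u y := by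
  obtain ⟨i, rfl⟩ := ho
  obtain ⟨j, hj⟩ := hf
  rw [Prod.mk.injEq] at hj
  refine ⟨j, Prod.ext ?_ hj.2⟩
  change (x.1 ^ t ^ i) ^ u = (x.1 ^ t ^ i) ^ t ^ j
  rw [pow_right_comm, hj.1, pow_right_comm]

end Orb

/-- Numerical consequences of an isomorphism of rational group algebras. -/
structure Bridge (K : Type*) [Field K] (m n s t m' n' s' t' : ℕ) : Prop where
  par : Par m n s t
  par' : Par m' n' s' t'
  card_eq : m * n = m' * n'
  corr : ∀ x ∈ XS K m n s t, ∃ y ∈ XS K m' n' s' t', per t x.1 = per t' y.1 ∧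
    ∀ u, u.Coprime (m * n) → (Fix t u x ↔ Fix t' u y)
  corr' : ∀ y ∈ XS K m' n' s' t', ∃ x ∈ XS K m n s t, per t x.1 = per t' y.1 ∧
    ∀ u, u.Coprime (m * n) → (Fix t u x ↔ Fix t' u y)
  sum_eq : ∀ u, u.Coprime (m * n) → ∀ F : ℕ → ℚ,
    ∑ x ∈ (XS K m n s t).filter (Fix t u), F (per t x.1) =
      ∑ y ∈ (XS K m' n' s' t').filter (Fix t' u), F (per t' y.1)

lemma Bridge.symm {K : Type*} [Field K] {m n s t m' n' s' t' : ℕ}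
    (h : Bridge K m n s t m' n' s' t') : Bridge K m' n' s' t' m n s t where
  par := h.par'
  par' := h.par
  card_eq := h.card_eq.symm
  corr y hy := by
    obtain ⟨x, hx, e, hf⟩ := h.corr' y hy
    exact ⟨x, hx, e.symm, fun u hu => (hf u (h.card_eq ▸ hu)).symm⟩
  corr' x hx := by
    obtain ⟨y, hy, e, hf⟩ := h.corr x hx
    exact ⟨y, hy, e.symm, fun u hu => (hf u (h.card_eq ▸ hu)).symm⟩
  sum_eq u hu F := (h.sum_eq u (h.card_eq ▸ hu) F).symm

section Rel
variable {K : Type*} [Field K] [CharZero K] {G H : Type*} [Group G] [Group H]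

/-- Twist of a representation by a field automorphism. -/
def QRep.twist {k : ℕ} (σ : K ≃+* K) (ρ : QRep K G k) : QRep K G k :=
  (σ : K →+* K).mapMatrix.comp ρ

lemma QRep.twist_act {k : ℕ} (σ : K ≃+* K) (ρ : QRep K G k) (x : MonoidAlgebra ℚ G)
    (w : Fin (k + 1) → K) : (ρ.twist σ).act x (σ ∘ w) = σ ∘ ρ.act x w := by
  ext i
  exact ((σ : K →+* K).map_mulVec (ρ x) w i).symm

lemma QRep.twist_act_pow {k : ℕ} (σ : K ≃+* K) (ρ : QRep K G k) (x : MonoidAlgebra ℚ G)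
    (w : Fin (k + 1) → K) (j : ℕ) : ((ρ.twist σ).act x ^ j) (σ ∘ w) = σ ∘ (ρ.act x ^ j) w := by
  rw [← map_pow, ← map_pow, twist_act]

lemma QRep.IsIrr.twist {k : ℕ} (σ : K ≃+* K) {ρ : QRep K G k} (h : ρ.IsIrr) :
    (ρ.twist σ).IsIrr := by
  intro W hW
  let W' : Submodule K (Fin (k + 1) → K) :=
    { carrier := {w | σ ∘ w ∈ W}
      add_mem' := by
        intro v w hv hw
        have : σ ∘ (v + w) = σ ∘ v + σ ∘ w := by ext i; simp
        simp only [Set.mem_ofPred_eq] at *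
        rw [this]; exact W.add_mem hv hw
      zero_mem' := by
        have : σ ∘ (0 : Fin (k + 1) → K) = 0 := by ext i; simp
        simp only [Set.mem_ofPred_eq]
        rw [this]; exact W.zero_mem
      smul_mem' := by
        intro c w hw
        have : σ ∘ (c • w) = σ c • σ ∘ w := by ext i; simp
        simp only [Set.mem_ofPred_eq] at *
        rw [this]; exact W.smul_mem _ hw }
  have hinv : ∀ w : Fin (k + 1) → K, σ ∘ (σ.symm ∘ w) = w := by intro w; ext i; simp
  rcases h W' (fun x w hw => by
    change σ ∘ _ ∈ W
    rw [← QRep.twist_act]; exact hW x _ hw) with e | e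
  · left
    rw [eq_bot_iff]
    intro w hw
    have : σ.symm ∘ w ∈ W' := by change σ ∘ (σ.symm ∘ w) ∈ W; rwa [hinv]
    rw [e, Submodule.mem_bot] at this
    rw [Submodule.mem_bot, ← hinv w, this]
    ext i; simp
  · right
    rw [eq_top_iff]
    intro w _
    have : σ.symm ∘ w ∈ W' := by rw [e]; trivial
    have h2 : σ ∘ (σ.symm ∘ w) ∈ W := this
    rwa [hinv] at h2

lemma per_map {K : Type*} [Field K] (σ : K ≃+* K) (t : ℕ) (α : K) : per t (σ α) = per t α := by
  apply Nat.dvd_right_iff_eq.mp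
  intro k
  rw [per_dvd_iff, per_dvd_iff, ← map_pow, σ.injective.eq_iff]

lemma QRep.IsType.twist {k : ℕ} (σ : K ≃+* K) {ρ : QRep K G k} {a b : G} {t : ℕ} {x : K × K}
    (h : ρ.IsType a b t x) : (ρ.twist σ).IsType a b t (σ x.1, σ x.2) := by
  obtain ⟨v, hv, hA, hB⟩ := h
  have hs : ∀ c : K, σ ∘ (c • v) = σ c • σ ∘ v := by intro c; ext i; simp
  refine ⟨σ ∘ v, ?_, ?_, ?_⟩
  · intro e
    apply hv
    ext i
    have := congrFun e i
    simpa using this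
  · rw [QRep.twist_act, hA, hs]
  · rw [per_map, QRep.twist_act_pow, hB, hs]

/-- Pulling back along an isomorphism of group algebras. -/
def QRep.pull {k : ℕ} (φ : MonoidAlgebra ℚ G ≃ₐ[ℚ] MonoidAlgebra ℚ H) (ρ : QRep K H k) :
    QRep K G k := ρ.comp (φ : MonoidAlgebra ℚ G →+* MonoidAlgebra ℚ H)

lemma QRep.pull_act {k : ℕ} (φ : MonoidAlgebra ℚ G ≃ₐ[ℚ] MonoidAlgebra ℚ H) (ρ : QRep K H k) (x) :
    (ρ.pull φ).act x = ρ.act (φ x) := rfl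

lemma QRep.pull_pull {k : ℕ} (φ : MonoidAlgebra ℚ G ≃ₐ[ℚ] MonoidAlgebra ℚ H) (ρ : QRep K H k) :
    (ρ.pull φ).pull φ.symm = ρ := by
  exact RingHom.ext fun x => congrArg ρ (φ.apply_symm_apply x)

lemma QRep.IsIrr.pull {k : ℕ} (φ : MonoidAlgebra ℚ G ≃ₐ[ℚ] MonoidAlgebra ℚ H) {ρ : QRep K H k}
    (h : ρ.IsIrr) : (ρ.pull φ).IsIrr := by
  intro W hW
  apply h W
  intro x
  obtain ⟨y, rfl⟩ := φ.surjective x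
  exact hW y

lemma QRep.Eqv.pull {k l : ℕ} (φ : MonoidAlgebra ℚ G ≃ₐ[ℚ] MonoidAlgebra ℚ H) {ρ : QRep K H k}
    {ρ' : QRep K H l} (h : ρ.Eqv ρ') : (ρ.pull φ).Eqv (ρ'.pull φ) := by
  obtain ⟨P, hP⟩ := h
  exact ⟨P, fun x w => hP (φ x) w⟩

lemma QRep.pull_twist {k : ℕ} (φ : MonoidAlgebra ℚ G ≃ₐ[ℚ] MonoidAlgebra ℚ H) (σ : K ≃+* K)
    (ρ : QRep K H k) : (ρ.twist σ).pull φ = (ρ.pull φ).twist σ := rfl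

/-- `x` and `y` are types of one and the same irreducible representation. -/
def Rel (φ : MonoidAlgebra ℚ G ≃ₐ[ℚ] MonoidAlgebra ℚ H) (a b : G) (t : ℕ) (a' b' : H) (t' : ℕ)
    (x y : K × K) : Prop :=
  ∃ (k : ℕ) (ρ : QRep K H k), ρ.IsIrr ∧ (ρ.pull φ).IsType a b t x ∧ ρ.IsType a' b' t' y

variable {φ : MonoidAlgebra ℚ G ≃ₐ[ℚ] MonoidAlgebra ℚ H} {a b : G} {a' b' : H}
  {m n s t m' n' s' t' : ℕ} {x y : K × K}

lemma Rel.symm (h : Rel φ a b t a' b' t' x y) : Rel φ.symm a' b' t' a b t y x := by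
  obtain ⟨k, ρ, hi, hx, hy⟩ := h
  exact ⟨k, ρ.pull φ, hi.pull φ, by rwa [QRep.pull_pull], hx⟩

lemma rel_comm : Rel φ.symm a' b' t' a b t y x ↔ Rel φ a b t a' b' t' x y :=
  ⟨fun h => h.symm, fun h => h.symm⟩

variable [Finite G] [Finite H]

lemma Rel.orb (hG : Pres a b m n s t) (hH : Pres a' b' m' n' s' t') {x' y' : K × K}
    (h : Rel φ a b t a' b' t' x y) (h' : Rel φ a b t a' b' t' x' y') (ho : Orb t x x') :
    Orb t' y y' := by
  obtain ⟨k, ρ, hi, hx, hy⟩ := h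
  obtain ⟨l, τ, hi', hx', hy'⟩ := h'
  have hx1 := hx.of_orb hG (hi.pull φ) ho
  have he := (QRep.eqv_of_isType hG (hi'.pull φ) (hi.pull φ) hx' hx1).pull φ.symm
  rw [QRep.pull_pull, QRep.pull_pull] at he
  exact hy.orb hH hi (hy'.of_eqv he)

lemma Rel.of_orb (hH : Pres a' b' m' n' s' t') {y' : K × K}
    (h : Rel φ a b t a' b' t' x y) (ho : Orb t' y y') : Rel φ a b t a' b' t' x y' := by
  obtain ⟨k, ρ, hi, hx, hy⟩ := h
  exact ⟨k, ρ, hi, hx, hy.of_orb hH hi ho⟩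

lemma Rel.twist (σ : K ≃+* K) (h : Rel φ a b t a' b' t' x y) :
    Rel φ a b t a' b' t' (σ x.1, σ x.2) (σ y.1, σ y.2) := by
  obtain ⟨k, ρ, hi, hx, hy⟩ := h
  exact ⟨k, ρ.twist σ, hi.twist σ, hx.twist σ, hy.twist σ⟩

lemma Rel.per_eq (hG : Pres a b m n s t) (hH : Pres a' b' m' n' s' t')
    (h : Rel φ a b t a' b' t' x y) : per t x.1 = per t' y.1 := by
  obtain ⟨k, ρ, hi, hx, hy⟩ := h
  rw [hx.per_eq hG (hi.pull φ), hy.per_eq hH hi]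

lemma Rel.mem (hG : Pres a b m n s t) (h : Rel φ a b t a' b' t' x y) : XMem m n s t x := by
  obtain ⟨k, ρ, hi, hx, hy⟩ := h
  exact hx.mem hG

lemma Rel.fix (hG : Pres a b m n s t) (hH : Pres a' b' m' n' s' t')
    (h : Rel φ a b t a' b' t' x y) (hN : m * n = m' * n') {σ : K ≃+* K} {u : ℕ}
    (hσ : ∀ z : K, z ^ (m * n) = 1 → σ z = z ^ u) (hf : Fix t u x) : Fix t' u y := by
  have hx := h.mem hG
  have hy := h.symm.mem hH
  have := h.twist σ
  rw [hσ _ hx.pow_fst, hσ _ (hx.pow_snd hG.toPar), hσ _ (hN ▸ hy.pow_fst),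
    hσ _ (hN ▸ hy.pow_snd hH.toPar)] at this
  exact h.orb hG hH this hf

variable [IsAlgClosed K]

lemma exists_rel (hG : Pres a b m n s t) (hH : Pres a' b' m' n' s' t') (hx : XMem m n s t x) :
    ∃ y, Rel φ a b t a' b' t' x y := by
  obtain ⟨k, ρ, hi, hx⟩ := QRep.exists_of_mem hG hx
  obtain ⟨y, hy⟩ := QRep.exists_isType hH (ρ.pull φ.symm)
  refine ⟨y, k, ρ.pull φ.symm, hi.pull _, ?_, hy⟩
  have := QRep.pull_pull φ.symm ρ
  rw [AlgEquiv.symm_symm] at this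
  rwa [this]

lemma sum_rel (hG : Pres a b m n s t) (hH : Pres a' b' m' n' s' t') (hN : m * n = m' * n')
    {σ : K ≃+* K} {u : ℕ} (hσ : ∀ z : K, z ^ (m * n) = 1 → σ z = z ^ u) (hx : XMem m n s t x)
    (hf : Fix t u x) (F : ℕ → ℚ) :
    ∑ y ∈ ((XS K m' n' s' t').filter (Fix t' u)).filter (Rel φ a b t a' b' t' x),
      F (per t' y.1) / per t' y.1 = F (per t x.1) := by
  obtain ⟨y₀, h₀⟩ := exists_rel (φ := φ) hG hH hx
  have hp := h₀.per_eq hG hH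
  have hy₀ := h₀.symm.mem hH
  have hset : ((XS K m' n' s' t').filter (Fix t' u)).filter (Rel φ a b t a' b' t' x) =
      (Finset.range (per t' y₀.1)).image fun i => (y₀.1 ^ t' ^ i, y₀.2) := by
    ext y
    simp only [Finset.mem_filter, Finset.mem_image, Finset.mem_range, mem_XS hH.toPar]
    constructor
    · rintro ⟨-, hy⟩
      obtain ⟨i, rfl⟩ := h₀.orb hG hH hy (Orb.refl _ _)
      refine ⟨i % per t' y₀.1, Nat.mod_lt _ (hy₀.per_pos hH.toPar), ?_⟩
      rw [(hH.toPar.pow_eq_iff hy₀.1).2 (Nat.mod_modEq _ _)]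
    · rintro ⟨i, -, rfl⟩
      have hr := h₀.of_orb hH (y' := (y₀.1 ^ t' ^ i, y₀.2)) ⟨i, rfl⟩
      exact ⟨⟨hr.symm.mem hH, hr.fix hG hH hN hσ hf⟩, hr⟩
  rw [hset, Finset.sum_image]
  · simp only [hH.toPar.per_pow hy₀.1, Finset.sum_const, Finset.card_range, nsmul_eq_mul]
    rw [mul_div_cancel₀]
    · rw [hp]
    · exact_mod_cast (hy₀.per_pos hH.toPar).ne'
  · intro i hi j hj e
    simp only [Finset.coe_range, Set.mem_Iio] at hi hj
    have := (hH.toPar.pow_eq_iff hy₀.1).1 (Prod.mk.inj e).1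
    rwa [Nat.ModEq, Nat.mod_eq_of_lt hi, Nat.mod_eq_of_lt hj] at this

theorem bridge_of_equiv
    (hgal : ∀ N u : ℕ, 0 < N → u.Coprime N → ∃ σ : K ≃+* K, ∀ z : K, z ^ N = 1 → σ z = z ^ u)
    (hG : Pres a b m n s t) (hH : Pres a' b' m' n' s' t') (hN : m * n = m' * n')
    (φ : MonoidAlgebra ℚ G ≃ₐ[ℚ] MonoidAlgebra ℚ H) : Bridge K m n s t m' n' s' t' := by
  have hpos : 0 < m * n := Nat.mul_pos hG.m_pos hG.n_pos
  have hfix : ∀ x y : K × K, Rel φ a b t a' b' t' x y → ∀ u, u.Coprime (m * n) →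
      (Fix t u x ↔ Fix t' u y) := by
    intro x y h u hu
    obtain ⟨σ, hσ⟩ := hgal _ _ hpos hu
    exact ⟨fun hf => h.fix hG hH hN hσ hf, fun hf => h.symm.fix hH hG hN.symm (hN ▸ hσ) hf⟩
  refine ⟨hG.toPar, hH.toPar, hN, ?_, ?_, ?_⟩
  · intro x hx
    obtain ⟨y, h⟩ := exists_rel (φ := φ) hG hH ((mem_XS hG.toPar).1 hx)
    exact ⟨y, (mem_XS hH.toPar).2 (h.symm.mem hH), h.per_eq hG hH, hfix x y h⟩
  · intro y hy
    obtain ⟨x, h⟩ := exists_rel (φ := φ.symm) hH hG ((mem_XS hH.toPar).1 hy)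
    have h := rel_comm.1 h
    exact ⟨x, (mem_XS hG.toPar).2 (h.mem hG), h.per_eq hG hH, hfix x y h⟩
  · intro u hu F
    obtain ⟨σ, hσ⟩ := hgal _ _ hpos hu
    have h1 : ∀ x ∈ (XS K m n s t).filter (Fix t u), F (per t x.1) =
        ∑ y ∈ (XS K m' n' s' t').filter (Fix t' u),
          if Rel φ a b t a' b' t' x y then F (per t' y.1) / per t' y.1 else 0 := by
      intro x hx
      rw [Finset.mem_filter, mem_XS hG.toPar] at hx
      rw [← Finset.sum_filter, sum_rel hG hH hN hσ hx.1 hx.2]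
    have h2 : ∀ y ∈ (XS K m' n' s' t').filter (Fix t' u), F (per t' y.1) =
        ∑ x ∈ (XS K m n s t).filter (Fix t u),
          if Rel φ.symm a' b' t' a b t y x then F (per t x.1) / per t x.1 else 0 := by
      intro y hy
      rw [Finset.mem_filter, mem_XS hH.toPar] at hy
      rw [← Finset.sum_filter, sum_rel hH hG hN.symm (hN ▸ hσ) hy.1 hy.2]
    rw [Finset.sum_congr rfl h1, Finset.sum_congr rfl h2, Finset.sum_comm]
    refine Finset.sum_congr rfl fun y _ => Finset.sum_congr rfl fun x _ => ?_
    rw [rel_comm]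
    split_ifs with h
    · rw [h.per_eq hG hH]
    · rfl

end Rel

end

section

lemma exists_galois_pow (N u : ℕ) (hN : 0 < N) (hu : u.Coprime N) :
    ∃ σ : AlgebraicClosure ℚ ≃+* AlgebraicClosure ℚ,
      ∀ z : AlgebraicClosure ℚ, z ^ N = 1 → σ z = z ^ u := by
  have : NeZero N := ⟨hN.ne'⟩
  have : NeZero (N : AlgebraicClosure ℚ) := ⟨by exact_mod_cast hN.ne'⟩
  have hn : @Normal ℚ (AlgebraicClosure ℚ) _ _ (AlgebraicClosure.instAlgebra ℚ) := by
    let : Algebra ℚ (AlgebraicClosure ℚ) := AlgebraicClosure.instAlgebra ℚ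
    exact IsAlgClosure.normal ℚ _
  have : Normal ℚ (AlgebraicClosure ℚ) := by
    convert hn
    exact Subsingleton.elim _ _
  obtain ⟨ζ, hζ⟩ := HasEnoughRootsOfUnity.exists_primitiveRoot (AlgebraicClosure ℚ) N
  have hζ' := hζ.pow_of_coprime u hu
  have hc : IsConjRoot ℚ (ζ ^ u) ζ := by
    rw [IsConjRoot, ← Polynomial.cyclotomic_eq_minpoly_rat hζ hN,
      ← Polynomial.cyclotomic_eq_minpoly_rat hζ' hN]
  obtain ⟨σ, hσ⟩ := isConjRoot_iff_exists_algEquiv.1 hc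
  refine ⟨σ.toRingEquiv, fun z hz => ?_⟩
  obtain ⟨i, -, rfl⟩ := hζ.eq_pow_of_pow_eq_one hz
  change σ (ζ ^ i) = _
  rw [map_pow, hσ, pow_right_comm]

end

section

section Roots
variable {K : Type*} [Field K] [CharZero K] [IsAlgClosed K]

lemma exists_primRoot (K : Type*) [Field K] [CharZero K] [IsAlgClosed K] {N : ℕ} (hN : 0 < N) :
    ∃ ζ : K, IsPrimitiveRoot ζ N := by
  have : NeZero N := ⟨hN.ne'⟩
  have : NeZero (N : K) := ⟨by exact_mod_cast hN.ne'⟩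
  exact HasEnoughRootsOfUnity.exists_primitiveRoot K N

lemma card_unityRoots {N : ℕ} (hN : 0 < N) : (Polynomial.nthRootsFinset N (1 : K)).card = N := by
  obtain ⟨ζ, hζ⟩ := exists_primRoot K hN
  exact hζ.card_nthRootsFinset

/-- The `e`-th roots of unity whose `j`-th power is `c`. -/
def rootsOf (j e : ℕ) (c : K) : Finset K :=
  (Polynomial.nthRootsFinset e (1 : K)).filter fun β => β ^ j = c

lemma mem_rootsOf {j e : ℕ} (he : 0 < e) {c β : K} :
    β ∈ rootsOf j e c ↔ β ^ e = 1 ∧ β ^ j = c := by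
  rw [rootsOf, Finset.mem_filter, Polynomial.mem_nthRootsFinset he]

lemma card_rootsOf_of_mem {j e : ℕ} (he : 0 < e) {c β : K} (h : β ∈ rootsOf j e c) :
    (rootsOf j e c).card = j.gcd e := by
  have hg : 0 < j.gcd e := Nat.gcd_pos_of_pos_right _ he
  obtain ⟨h1, h2⟩ := (mem_rootsOf he).1 h
  have hβ : β ≠ 0 := by
    rintro rfl
    rw [zero_pow he.ne'] at h1
    exact zero_ne_one h1
  rw [← card_unityRoots (K := K) hg]
  symm
  apply Finset.card_bij (fun γ _ => β * γ)
  · intro γ hγ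
    rw [Polynomial.mem_nthRootsFinset hg] at hγ
    have hj : γ ^ j = 1 := orderOf_dvd_iff_pow_eq_one.1
      ((orderOf_dvd_of_pow_eq_one hγ).trans (Nat.gcd_dvd_left _ _))
    have he' : γ ^ e = 1 := orderOf_dvd_iff_pow_eq_one.1
      ((orderOf_dvd_of_pow_eq_one hγ).trans (Nat.gcd_dvd_right _ _))
    rw [mem_rootsOf he, mul_pow, mul_pow, hj, he', h1, h2]
    simp
  · intro γ _ γ' _ e
    exact mul_left_cancel₀ hβ e
  · intro γ hγ
    obtain ⟨h3, h4⟩ := (mem_rootsOf he).1 hγ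
    refine ⟨β⁻¹ * γ, ?_, by field_simp⟩
    rw [Polynomial.mem_nthRootsFinset hg, ← orderOf_dvd_iff_pow_eq_one]
    apply Nat.dvd_gcd <;> rw [orderOf_dvd_iff_pow_eq_one, mul_pow, inv_pow]
    · rw [h2, h4, inv_mul_cancel₀]
      rw [← h2]; exact pow_ne_zero _ hβ
    · rw [h1, h3]; simp

lemma card_rootsOf_le {j e : ℕ} (he : 0 < e) (c : K) : (rootsOf j e c).card ≤ j.gcd e := by
  rcases (rootsOf j e c).eq_empty_or_nonempty with h | ⟨β, h⟩
  · rw [h]; simp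
  · exact (card_rootsOf_of_mem he h).le

lemma card_rootsOf {j e : ℕ} (he : 0 < e) {c : K} (hc : c ^ (e / j.gcd e) = 1) :
    (rootsOf j e c).card = j.gcd e := by
  have hg : 0 < j.gcd e := Nat.gcd_pos_of_pos_right _ he
  obtain ⟨γ, hγ⟩ := IsAlgClosed.exists_pow_nat_eq c hg
  have hco := Nat.coprime_div_gcd_div_gcd hg
  have he1 : 0 < e / j.gcd e := Nat.div_pos (Nat.le_of_dvd he (Nat.gcd_dvd_right _ _)) hg
  obtain ⟨k, -, hk⟩ := Nat.exists_mul_mod_eq_of_coprime 1 hco he1.ne'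
  apply card_rootsOf_of_mem he (β := γ ^ k)
  rw [mem_rootsOf he]
  constructor
  · have : k * e = j.gcd e * (e / j.gcd e) * k := by
      rw [Nat.mul_div_cancel' (Nat.gcd_dvd_right _ _), mul_comm]
    rw [← pow_mul, this, pow_mul, pow_mul, hγ, hc, one_pow]
  · have : k * j = j.gcd e * (j / j.gcd e * k) := by
      rw [← mul_assoc, Nat.mul_div_cancel' (Nat.gcd_dvd_left _ _), mul_comm]
    rw [← pow_mul, this, pow_mul, hγ, pow_eq_of_modEq hc hk, pow_one]

end Roots

section Sums
variable {K : Type*} [Field K] [CharZero K] [IsAlgClosed K] {m n s t : ℕ}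

lemma sum_filter_XS (h : Par m n s t) {P e : ℕ} (hP : P ∣ m) (he : e ∣ m * n) (F : ℕ → ℚ) :
    ∑ x ∈ (XS K m n s t).filter (fun x => x.1 ^ P = 1 ∧ x.2 ^ e = 1), F (per t x.1) =
      ∑ α ∈ Polynomial.nthRootsFinset P (1 : K),
        ((rootsOf (n / per t α) e (α ^ s)).card : ℚ) * F (per t α) := by
  have hN : 0 < m * n := Nat.mul_pos h.m_pos h.n_pos
  have hP0 : 0 < P := Nat.pos_of_dvd_of_pos hP h.m_pos
  have he0 : 0 < e := Nat.pos_of_dvd_of_pos he hN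
  have hset : (XS K m n s t).filter (fun x => x.1 ^ P = 1 ∧ x.2 ^ e = 1) =
      (Polynomial.nthRootsFinset P (1 : K) ×ˢ Polynomial.nthRootsFinset e (1 : K)).filter
        (fun x => x.2 ^ (n / per t x.1) = x.1 ^ s) := by
    ext x
    simp only [Finset.mem_filter, mem_XS h, Finset.mem_product, Polynomial.mem_nthRootsFinset hP0,
      Polynomial.mem_nthRootsFinset he0, XMem]
    constructor
    · rintro ⟨⟨-, h1⟩, h2, h3⟩; exact ⟨⟨h2, h3⟩, h1⟩
    · rintro ⟨⟨h2, h3⟩, h1⟩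
      refine ⟨⟨?_, h1⟩, h2, h3⟩
      exact orderOf_dvd_iff_pow_eq_one.1 ((orderOf_dvd_of_pow_eq_one h2).trans hP)
  rw [hset, Finset.sum_filter, Finset.sum_product]
  refine Finset.sum_congr rfl fun α _ => ?_
  rw [← Finset.sum_filter]
  simp only
  rw [Finset.sum_const, nsmul_eq_mul]
  rfl

end Sums

end

section

/-- The `p`-local invariants of the parameters `m, n, s, t`: exponents of `p` in `m`, `n`,
`gcd m (t - 1)`, `gcd m s` and in the order of `t` modulo the `p'`-part of `m`. -/
structure PPar (p m n s t μ m' ν n' r σ δ : ℕ) : Prop where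
  prime : p.Prime
  hm : m = p ^ μ * m'
  pm : ¬ p ∣ m'
  hn : n = p ^ ν * n'
  pn : ¬ p ∣ n'
  r_le : r ≤ μ
  r_mod : t ≡ 1 [MOD p ^ r]
  r_max : r < μ → ¬ t ≡ 1 [MOD p ^ (r + 1)]
  σ_le : σ ≤ μ
  σ_dvd : p ^ σ ∣ s
  σ_max : σ < μ → ¬ p ^ (σ + 1) ∣ s
  δ_le : δ ≤ ν
  δ_q : ∃ q, ¬ p ∣ q ∧ t ^ (p ^ δ * q) ≡ 1 [MOD m']
  δ_min : ∀ k, t ^ k ≡ 1 [MOD m'] → p ^ δ ∣ k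

lemma fact_ppow_mul {p μ m' : ℕ} (hp : p.Prime) (h : ¬ p ∣ m') :
    (p ^ μ * m').factorization p = μ := by
  have h0 : m' ≠ 0 := by rintro rfl; exact h (dvd_zero _)
  rw [Nat.factorization_mul (pow_ne_zero _ hp.ne_zero) h0, Finsupp.add_apply,
    hp.factorization_pow, Nat.factorization_eq_zero_of_not_dvd h]
  simp

lemma ppow_mul_inj {p μ m' ν n' : ℕ} (hp : p.Prime) (h : ¬ p ∣ m') (h' : ¬ p ∣ n')
    (e : p ^ μ * m' = p ^ ν * n') : μ = ν ∧ m' = n' := by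
  have h1 : μ = ν := by
    have e1 : (p ^ μ * m').factorization p = (p ^ ν * n').factorization p := by rw [e]
    rwa [fact_ppow_mul hp h, fact_ppow_mul hp h'] at e1
  subst h1
  exact ⟨rfl, Nat.eq_of_mul_eq_mul_left (pow_pos hp.pos _) e⟩

lemma ppow_dvd_of_dvd_mul {p k l N : ℕ} (hp : p.Prime) (hN : ¬ p ∣ N) (h : p ^ k ∣ p ^ l * N) :
    k ≤ l := by
  have h1 : p ^ k ∣ p ^ l :=
    Nat.Coprime.dvd_of_dvd_mul_right (((hp.coprime_iff_not_dvd).2 hN).pow_left k) h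
  exact (Nat.pow_dvd_pow_iff_le_right hp.one_lt).1 h1

lemma coprime_one_add {p j l N : ℕ} (hj : 1 ≤ j) :
    (1 + p ^ j * N).Coprime (p ^ l * N) := by
  obtain ⟨i, rfl⟩ := Nat.exists_eq_add_of_le hj
  apply Nat.Coprime.mul_right
  · apply Nat.Coprime.pow_right
    rw [show 1 + p ^ (1 + i) * N = 1 + p * (p ^ i * N) by ring]
    simp
  · simp

lemma modEq_pow_one {t M k : ℕ} (h : t ≡ 1 [MOD M]) : t ^ k ≡ 1 [MOD M] := by
  simpa using h.pow k

lemma Fix.snd {K : Type*} [Field K] {t e : ℕ} {x : K × K} (hx : x.2 ≠ 0) (h : Fix t (1 + e) x) :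
    x.2 ^ e = 1 := by
  obtain ⟨i, hi⟩ := h
  have := (Prod.mk.inj hi).2
  rw [pow_add, pow_one] at this
  exact mul_left_cancel₀ hx (by rw [this, mul_one])

lemma Fix.of_pow {K : Type*} [Field K] {t e : ℕ} {x : K × K} (h1 : x.1 ^ e = 1)
    (h2 : x.2 ^ e = 1) : Fix t (1 + e) x :=
  ⟨0, by simp [pow_add, h1, h2]⟩

lemma modEq_orderOf_of_pow_eq {K : Type*} [Field K] {γ : K} (hγ : γ ≠ 0) {i j : ℕ}
    (h : γ ^ i = γ ^ j) : i ≡ j [MOD orderOf γ] := by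
  have e : (Units.mk0 γ hγ) ^ i = (Units.mk0 γ hγ) ^ j := Units.ext (by simpa using h)
  have := pow_eq_pow_iff_modEq.1 e
  rwa [← orderOf_units, Units.val_mk0] at this

lemma per_eq_one_iff {K : Type*} [Field K] {t : ℕ} {α : K} : per t α = 1 ↔ α ^ t = α := by
  rw [← Nat.dvd_one, per_dvd_iff, pow_one]

/-- If `e` has exponent `α ^ k = 1`, powers with `k ∣ i` are trivial. -/
lemma pow_eq_one_of_dvd {K : Type*} [Monoid K] {α : K} {k i : ℕ} (h : α ^ k = 1) (hk : k ∣ i) :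
    α ^ i = 1 := by
  obtain ⟨j, rfl⟩ := hk
  rw [pow_mul, h, one_pow]

namespace PPar
variable {p m n s t μ m' ν n' r σ δ : ℕ}

lemma pN (h : PPar p m n s t μ m' ν n' r σ δ) : ¬ p ∣ m' * n' :=
  fun e => (h.prime.dvd_mul.1 e).elim h.pm h.pn

lemma card (h : PPar p m n s t μ m' ν n' r σ δ) : m * n = p ^ (μ + ν) * (m' * n') := by
  rw [h.hm, h.hn]; ring

lemma m'_pos (h : PPar p m n s t μ m' ν n' r σ δ) : 0 < m' :=
  Nat.pos_of_ne_zero fun e => h.pm (e ▸ dvd_zero _)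

lemma n'_pos (h : PPar p m n s t μ m' ν n' r σ δ) : 0 < n' :=
  Nat.pos_of_ne_zero fun e => h.pn (e ▸ dvd_zero _)

lemma fact_gcd (h : PPar p m n s t μ m' ν n' r σ δ) (ht : 1 ≤ t) :
    (m.gcd (t - 1)).factorization p = r := by
  have hm0 : m ≠ 0 := by
    rw [h.hm]; exact (Nat.mul_pos (pow_pos h.prime.pos _) h.m'_pos).ne'
  have hg0 : m.gcd (t - 1) ≠ 0 := (Nat.gcd_pos_of_pos_left _ (Nat.pos_of_ne_zero hm0)).ne'
  apply le_antisymm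
  · by_contra! hc
    have h1 : p ^ (r + 1) ∣ m.gcd (t - 1) := (h.prime.pow_dvd_iff_le_factorization hg0).2 hc
    have h2 : p ^ (r + 1) ∣ p ^ μ * m' := h.hm ▸ h1.trans (Nat.gcd_dvd_left _ _)
    exact h.r_max (ppow_dvd_of_dvd_mul h.prime h.pm h2)
      ((Nat.modEq_iff_dvd' ht).2 (h1.trans (Nat.gcd_dvd_right _ _))).symm
  · rw [← h.prime.pow_dvd_iff_le_factorization hg0]
    apply Nat.dvd_gcd
    · rw [h.hm]; exact (pow_dvd_pow p h.r_le).mul_right _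
    · exact (Nat.modEq_iff_dvd' ht).1 h.r_mod.symm

/-- For a fixed point `α` of `x ↦ x ^ t` with `α ^ m = 1`, the order of `α` divides `p ^ r * m'`. -/
lemma pow_of_fixed {K : Type*} [Field K] (h : PPar p m n s t μ m' ν n' r σ δ) {α : K}
    (hα : α ^ m = 1) (ht : α ^ t = α) : α ^ (p ^ r * m') = 1 := by
  have hα0 : α ≠ 0 := by
    rintro rfl
    rw [zero_pow] at hα
    · exact zero_ne_one hα
    · rw [h.hm]; exact (Nat.mul_pos (pow_pos h.prime.pos _) h.m'_pos).ne'
  set γ := α ^ m' with hγ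
  have h1 : γ ^ p ^ μ = 1 := by rw [hγ, ← pow_mul, mul_comm, ← h.hm, hα]
  have h2 : γ ^ t = γ := by rw [hγ, pow_right_comm, ht]
  obtain ⟨l, hl, hol⟩ := (Nat.dvd_prime_pow h.prime).1 (orderOf_dvd_of_pow_eq_one h1)
  have h3 : t ≡ 1 [MOD p ^ l] := by
    rw [← hol]
    exact modEq_orderOf_of_pow_eq (pow_ne_zero _ hα0) (by rw [pow_one]; exact h2)
  have hlr : l ≤ r := by
    by_contra! hc
    exact h.r_max (by omega) (h3.of_dvd (pow_dvd_pow p hc))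
  rw [mul_comm, pow_mul, ← hγ]
  exact orderOf_dvd_iff_pow_eq_one.1 (hol ▸ pow_dvd_pow p hlr)

end PPar

section Deg1
variable {K : Type*} [Field K] [CharZero K] [IsAlgClosed K] {m n s t m₁ n₁ s₁ t₁ : ℕ}

lemma Par.sum_deg1 (h : Par m n s t) (ht : 1 ≤ t) :
    ∑ x ∈ (XS K m n s t).filter (Fix t 1), (if per t x.1 = 1 then (1 : ℚ) else 0) =
      m.gcd (t - 1) * n := by
  have hN : 0 < m * n := Nat.mul_pos h.m_pos h.n_pos
  have hg : 0 < m.gcd (t - 1) := Nat.gcd_pos_of_pos_left _ h.m_pos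
  have h0 : (XS K m n s t).filter (Fix t 1) = XS K m n s t := by
    apply Finset.filter_true_of_mem
    intro x _
    exact ⟨0, by simp⟩
  have hfix : ∀ x ∈ XS K m n s t, per t x.1 = 1 ↔ x.1 ^ m.gcd (t - 1) = 1 ∧ x.2 ^ (m * n) = 1 := by
    intro x hx
    have hx := (mem_XS h).1 hx
    have hx0 := hx.ne_fst h
    rw [per_eq_one_iff]
    constructor
    · intro e
      refine ⟨?_, hx.pow_snd h⟩
      have h1 : x.1 ^ (t - 1) = 1 := by
        apply mul_left_cancel₀ hx0
        rw [← pow_succ', Nat.sub_add_cancel ht, e, mul_one]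
      exact orderOf_dvd_iff_pow_eq_one.1 (Nat.dvd_gcd (orderOf_dvd_of_pow_eq_one hx.1)
        (orderOf_dvd_of_pow_eq_one h1))
    · rintro ⟨e, -⟩
      have h1 := pow_eq_one_of_dvd e (Nat.gcd_dvd_right m (t - 1))
      conv_lhs => rw [← Nat.sub_add_cancel ht, pow_succ, h1, one_mul]
  rw [h0, ← Finset.sum_filter, Finset.filter_congr hfix,
    sum_filter_XS h (Nat.gcd_dvd_left _ _) dvd_rfl (fun _ => 1)]
  have hterm : ∀ α ∈ Polynomial.nthRootsFinset (m.gcd (t - 1)) (1 : K),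
      ((rootsOf (n / per t α) (m * n) (α ^ s)).card : ℚ) * 1 = n := by
    intro α hα
    rw [Polynomial.mem_nthRootsFinset hg] at hα
    have h1 : per t α = 1 := by
      rw [per_eq_one_iff]
      have h1 := pow_eq_one_of_dvd hα (Nat.gcd_dvd_right m (t - 1))
      conv_lhs => rw [← Nat.sub_add_cancel ht, pow_succ, h1, one_mul]
    have h2 : n.gcd (m * n) = n := Nat.gcd_eq_left (dvd_mul_left _ _)
    rw [h1, Nat.div_one, card_rootsOf hN, h2, mul_one]
    rw [h2, Nat.mul_div_cancel _ h.n_pos, pow_right_comm,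
      pow_eq_one_of_dvd hα (Nat.gcd_dvd_left m _), one_pow]
  rw [Finset.sum_congr rfl hterm, Finset.sum_const, card_unityRoots hg, nsmul_eq_mul]

lemma Bridge.gcd_mul (B : Bridge K m n s t m₁ n₁ s₁ t₁) (ht : 1 ≤ t) (ht₁ : 1 ≤ t₁) :
    m.gcd (t - 1) * n = m₁.gcd (t₁ - 1) * n₁ := by
  have := B.sum_eq 1 (Nat.coprime_one_left _) (fun o => if o = 1 then 1 else 0)
  rw [B.par.sum_deg1 ht, B.par'.sum_deg1 ht₁] at this
  exact_mod_cast this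

variable {p μ m' ν n' r σ δ μ₁ m₁' ν₁ n₁' r₁ σ₁ δ₁ : ℕ}

lemma Bridge.exps (B : Bridge K m n s t m₁ n₁ s₁ t₁)
    (h : PPar p m n s t μ m' ν n' r σ δ) (h₁ : PPar p m₁ n₁ s₁ t₁ μ₁ m₁' ν₁ n₁' r₁ σ₁ δ₁) :
    μ + ν = μ₁ + ν₁ ∧ m' * n' = m₁' * n₁' := by
  apply ppow_mul_inj h.prime h.pN h₁.pN
  rw [← h.card, ← h₁.card, B.card_eq]

lemma Bridge.exps_r (B : Bridge K m n s t m₁ n₁ s₁ t₁) (ht : 1 ≤ t) (ht₁ : 1 ≤ t₁)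
    (h : PPar p m n s t μ m' ν n' r σ δ) (h₁ : PPar p m₁ n₁ s₁ t₁ μ₁ m₁' ν₁ n₁' r₁ σ₁ δ₁) :
    r + ν = r₁ + ν₁ := by
  have e : (m.gcd (t - 1) * n).factorization p = (m₁.gcd (t₁ - 1) * n₁).factorization p := by
    rw [B.gcd_mul ht ht₁]
  rw [Nat.factorization_mul, Nat.factorization_mul, Finsupp.add_apply, Finsupp.add_apply,
    h.fact_gcd ht, h₁.fact_gcd ht₁, h.hn, h₁.hn, fact_ppow_mul h.prime h.pn,
    fact_ppow_mul h.prime h₁.pn] at e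
  · exact e
  · exact (Nat.gcd_pos_of_pos_left _ B.par'.m_pos).ne'
  · exact B.par'.n_pos.ne'
  · exact (Nat.gcd_pos_of_pos_left _ B.par.m_pos).ne'
  · exact B.par.n_pos.ne'

/-- Transfer of invariance of linear characters under `z ↦ z ^ (1 + p ^ (r + ν - k) * N')`. -/
lemma Bridge.deg1_pow (B : Bridge K m n s t m₁ n₁ s₁ t₁)
    (h : PPar p m n s t μ m' ν n' r σ δ)
    {k : ℕ} (hkr : k ≤ r) (hkν : k ≤ ν) (hkσ : k ≤ σ) (h1 : 1 ≤ r + ν - k)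
    {y : K × K} (hy : y ∈ XS K m₁ n₁ s₁ t₁) (hy1 : per t₁ y.1 = 1) :
    y.2 ^ (p ^ (r + ν - k) * (m' * n')) = 1 := by
  obtain ⟨x, hx, hp, hf⟩ := B.corr' y hy
  have hx := (mem_XS B.par).1 hx
  have hy := (mem_XS B.par').1 hy
  have hp1 : per t x.1 = 1 := hp.trans hy1
  have hxm := h.pow_of_fixed hx.1 (per_eq_one_iff.1 hp1)
  have hcop : (1 + p ^ (r + ν - k) * (m' * n')).Coprime (m * n) := by
    rw [h.card]; exact coprime_one_add h1
  apply Fix.snd (hy.ne_snd B.par')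
  apply (hf _ hcop).1
  apply Fix.of_pow
  · apply pow_eq_one_of_dvd hxm
    rw [← mul_assoc]
    exact (mul_dvd_mul_right (pow_dvd_pow p (by omega)) m').mul_right _
  · have e1 : p ^ (r + ν - k) * (m' * n') = n * (p ^ (r - k) * m') := by
      rw [h.hn, show r + ν - k = ν + (r - k) by omega, pow_add]; ring
    have e2 := hx.2
    rw [hp1, Nat.div_one] at e2
    rw [e1, pow_mul, e2, ← pow_mul]
    apply pow_eq_one_of_dvd hxm
    obtain ⟨c, hc⟩ := (pow_dvd_pow p hkσ).trans h.σ_dvd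
    refine ⟨c, ?_⟩
    rw [hc, show r = k + (r - k) by omega, pow_add]
    simp only [Nat.add_sub_cancel_left]; ring

lemma Bridge.nu_le (B : Bridge K m n s t m₁ n₁ s₁ t₁)
    (h : PPar p m n s t μ m' ν n' r σ δ) (h₁ : PPar p m₁ n₁ s₁ t₁ μ₁ m₁' ν₁ n₁' r₁ σ₁ δ₁)
    {k : ℕ} (hkr : k ≤ r) (hkν : k ≤ ν) (hkσ : k ≤ σ) (h1 : 1 ≤ r + ν - k) :
    ν₁ ≤ r + ν - k := by
  obtain ⟨β, hβ⟩ := exists_primRoot K (pow_pos h.prime.pos ν₁)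
  have hper : per t₁ (1 : K) = 1 := by rw [per_eq_one_iff, one_pow]
  have hmem : ((1, β) : K × K) ∈ XS K m₁ n₁ s₁ t₁ := by
    rw [mem_XS B.par']
    refine ⟨one_pow _, ?_⟩
    change β ^ (n₁ / per t₁ (1 : K)) = 1 ^ s₁
    rw [hper, Nat.div_one, h₁.hn, pow_mul, hβ.pow_eq_one, one_pow, one_pow]
  have := B.deg1_pow h hkr hkν hkσ h1 hmem hper
  exact ppow_dvd_of_dvd_mul h.prime h.pN (hβ.dvd_of_pow_eq_one _ this)

/-- Divisibility of `s₁` by `p ^ k`. -/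
lemma Bridge.k_le_sigma (B : Bridge K m n s t m₁ n₁ s₁ t₁)
    (h : PPar p m n s t μ m' ν n' r σ δ) (h₁ : PPar p m₁ n₁ s₁ t₁ μ₁ m₁' ν₁ n₁' r₁ σ₁ δ₁)
    {k : ℕ} (hkr : k ≤ r) (hkν : k ≤ ν) (hkσ : k ≤ σ) (h1 : 1 ≤ r + ν - k)
    (he : r + ν = r₁ + ν₁) (hkr₁ : k ≤ r₁) : p ^ k ∣ s₁ := by
  obtain ⟨α, hα⟩ := exists_primRoot K (pow_pos h.prime.pos r₁)
  obtain ⟨β, hβ⟩ := IsAlgClosed.exists_pow_nat_eq (α ^ s₁) B.par'.n_pos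
  have hper : per t₁ α = 1 := by
    rw [per_eq_one_iff, pow_eq_of_modEq hα.pow_eq_one h₁.r_mod, pow_one]
  have hmem : ((α, β) : K × K) ∈ XS K m₁ n₁ s₁ t₁ := by
    rw [mem_XS B.par']
    refine ⟨?_, ?_⟩
    · apply pow_eq_one_of_dvd hα.pow_eq_one
      rw [h₁.hm]; exact (pow_dvd_pow p h₁.r_le).mul_right _
    · change β ^ (n₁ / per t₁ α) = α ^ s₁
      rw [hper, Nat.div_one, hβ]
  have e := B.deg1_pow h hkr hkν hkσ h1 hmem hper
  have e1 : p ^ (r + ν - k) * (m' * n') = n₁ * (p ^ (r₁ - k) * m₁') := by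
    rw [(B.exps h h₁).2, h₁.hn, show r + ν - k = ν₁ + (r₁ - k) by omega, pow_add]; ring
  rw [e1, pow_mul] at e
  change (β ^ n₁) ^ _ = 1 at e
  rw [hβ, ← pow_mul] at e
  have e2 := hα.dvd_of_pow_eq_one _ e
  rw [show r₁ = (r₁ - k) + k by omega, pow_add,
    show s₁ * (p ^ (r₁ - k + k - k) * m₁') = p ^ (r₁ - k) * (s₁ * m₁') by
      simp only [Nat.add_sub_cancel]; ring] at e2
  have e3 := Nat.dvd_of_mul_dvd_mul_left (pow_pos h.prime.pos _) e2
  exact Nat.Coprime.dvd_of_dvd_mul_right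
    (((h.prime.coprime_iff_not_dvd).2 h₁.pm).pow_left k) e3

end Deg1

end

section

lemma exists_crt {p E N : ℕ} (hp : p.Prime) (hN : ¬ p ∣ N) (a b : ℕ) :
    ∃ u, u ≡ a [MOD p ^ E] ∧ u ≡ b [MOD N] := by
  have hc : (p ^ E).Coprime N := ((hp.coprime_iff_not_dvd).2 hN).pow_left E
  obtain ⟨u, h1, h2⟩ := Nat.chineseRemainder hc a b
  exact ⟨u, h1, h2⟩

lemma exists_crt_unit {p E N : ℕ} (hp : p.Prime) (hN : ¬ p ∣ N) {a : ℕ} (ha : a.Coprime (p ^ E)) :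
    ∃ u, u ≡ a [MOD p ^ E] ∧ u ≡ 1 [MOD N] ∧ u.Coprime (p ^ E * N) := by
  obtain ⟨u, h1, h2⟩ := exists_crt (E := E) hp hN a 1
  refine ⟨u, h1, h2, Nat.Coprime.mul_right ?_ ?_⟩
  · rw [Nat.Coprime, h1.gcd_eq]; exact ha
  · rw [Nat.Coprime, h2.gcd_eq]; exact Nat.gcd_one_left _

lemma modEq_mul_of_modEq {p E N a b : ℕ} (hp : p.Prime) (hN : ¬ p ∣ N)
    (h1 : a ≡ b [MOD p ^ E]) (h2 : a ≡ b [MOD N]) : a ≡ b [MOD p ^ E * N] :=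
  (Nat.modEq_and_modEq_iff_modEq_mul (((hp.coprime_iff_not_dvd).2 hN).pow_left E)).1 ⟨h1, h2⟩

/-- An exponent acting as `-1` on `p`-elements and trivially on `p'`-elements. -/
lemma exists_neg_one {p E N : ℕ} (hp : p.Prime) (hN : ¬ p ∣ N) :
    ∃ u, p ^ E ∣ u + 1 ∧ u ≡ 1 [MOD N] ∧ u.Coprime (p ^ E * N) := by
  have hpos : 1 ≤ p ^ E := pow_pos hp.pos E
  obtain ⟨u, h1, h2, h3⟩ := exists_crt_unit (E := E) (a := p ^ E - 1) hp hN (by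
    have := Nat.coprime_self_add_right (m := p ^ E - 1) (n := 1)
    rw [Nat.sub_add_cancel hpos] at this
    exact this.2 (Nat.coprime_one_right _))
  refine ⟨u, ?_, h2, h3⟩
  have := h1.add_right 1
  rw [Nat.sub_add_cancel hpos] at this
  exact (Nat.modEq_zero_iff_dvd).1 (this.trans (by simp [Nat.ModEq]))

namespace PPar
variable {p m n s t μ m' ν n' r σ δ : ℕ} {K : Type*} [Field K]

lemma m_pos (h : PPar p m n s t μ m' ν n' r σ δ) : 0 < m := by
  rw [h.hm]; exact Nat.mul_pos (pow_pos h.prime.pos _) h.m'_pos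

lemma order_pPart (h : PPar p m n s t μ m' ν n' r σ δ) {α : K} (hα : α ^ m = 1) :
    ∃ l ≤ μ, orderOf (α ^ m') = p ^ l := by
  have h1 : (α ^ m') ^ p ^ μ = 1 := by rw [← pow_mul, mul_comm, ← h.hm, hα]
  exact (Nat.dvd_prime_pow h.prime).1 (orderOf_dvd_of_pow_eq_one h1)

lemma t_modEq (h : PPar p m n s t μ m' ν n' r σ δ) {k : ℕ} (hk : k ≤ r) (i : ℕ) :
    t ^ i ≡ 1 [MOD p ^ k] :=
  modEq_pow_one (h.r_mod.of_dvd (pow_dvd_pow p hk))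

/-- On elements of order dividing `p ^ k * m'`, `k ≤ r`, the period has `p`-part at most `p ^ δ`. -/
lemma exists_per_dvd (h : PPar p m n s t μ m' ν n' r σ δ) {k : ℕ} (hk : k ≤ r) {α : K}
    (hα : α ^ (p ^ k * m') = 1) : ∃ q, ¬ p ∣ q ∧ per t α ∣ p ^ δ * q := by
  obtain ⟨q, hq, h1⟩ := h.δ_q
  refine ⟨q, hq, ?_⟩
  rw [per_dvd_iff, pow_eq_of_modEq hα (modEq_mul_of_modEq h.prime h.pm (h.t_modEq hk _) h1),
    pow_one]

lemma dvd_per (h : PPar p m n s t μ m' ν n' r σ δ) {α : K} (hα : IsPrimitiveRoot α m') :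
    p ^ δ ∣ per t α := by
  apply h.δ_min
  have hα0 : α ≠ 0 := hα.ne_zero h.m'_pos.ne'
  have := modEq_orderOf_of_pow_eq hα0 (i := t ^ per t α) (j := 1) (by rw [pow_pow_per, pow_one])
  rwa [← hα.eq_orderOf] at this

/-- Existence of a `p'`-element of the parametrising set over a primitive `m'`-th root. -/
lemma exists_pPrime (h : PPar p m n s t μ m' ν n' r σ δ) (hP : Par m n s t) [CharZero K]
    [IsAlgClosed K] : ∃ y ∈ XS K m n s t, IsPrimitiveRoot y.1 m' ∧ y.2 ^ (m' * n') = 1 := by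
  obtain ⟨α, hα⟩ := exists_primRoot K h.m'_pos
  have hαm : α ^ m = 1 := pow_eq_one_of_dvd hα.pow_eq_one ⟨_, h.hm.trans (mul_comm _ _)⟩
  have ho := hP.per_dvd hαm
  have hpos : 0 < n / per t α := Nat.div_pos (Nat.le_of_dvd hP.n_pos ho) (hP.per_pos hαm)
  obtain ⟨β, hβ⟩ := IsAlgClosed.exists_pow_nat_eq (α ^ s) hpos
  have hx : XMem m n s t ((α, β) : K × K) := ⟨hαm, hβ⟩
  obtain ⟨c, hc1, hc2⟩ := exists_crt (E := μ + ν) h.prime h.pN 0 1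
  refine ⟨(α, β ^ c), ?_, hα, ?_⟩
  · rw [mem_XS hP]
    refine ⟨hαm, ?_⟩
    change (β ^ c) ^ (n / per t α) = α ^ s
    rw [pow_right_comm, hβ, pow_right_comm,
      pow_eq_of_modEq hα.pow_eq_one (hc2.of_dvd (dvd_mul_right _ _)), pow_one]
  · change (β ^ c) ^ _ = 1
    rw [← pow_mul]
    apply pow_eq_one_of_dvd (hx.pow_snd hP)
    rw [h.card]
    exact mul_dvd_mul_right ((Nat.modEq_zero_iff_dvd).1 hc1) _

end PPar

variable {K : Type*} [Field K] [CharZero K] [IsAlgClosed K] {m n s t m₁ n₁ s₁ t₁ : ℕ}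
variable {p μ m' ν n' r σ δ μ₁ m₁' ν₁ n₁' r₁ σ₁ δ₁ : ℕ}

lemma Bridge.delta_le (B : Bridge K m n s t m₁ n₁ s₁ t₁)
    (h : PPar p m n s t μ m' ν n' r σ δ) (h₁ : PPar p m₁ n₁ s₁ t₁ μ₁ m₁' ν₁ n₁' r₁ σ₁ δ₁)
    (hr : 2 ≤ r) : δ₁ ≤ δ := by
  obtain ⟨y, hy, hprim, hy2⟩ := h₁.exists_pPrime (K := K) B.par'
  obtain ⟨u, hu1, hu2, hu3⟩ := exists_neg_one (E := μ + ν) h.prime h.pN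
  rw [← h.card] at hu3
  obtain ⟨x, hx, hper, hf⟩ := B.corr' y hy
  have hN := (B.exps h h₁).2
  have hfix : Fix t u x := by
    rw [hf u hu3]
    refine ⟨0, ?_⟩
    have e1 : y.1 ^ u = y.1 := by
      rw [pow_eq_of_modEq hprim.pow_eq_one (hu2.of_dvd (hN ▸ dvd_mul_right _ _)), pow_one]
    have e2 : y.2 ^ u = y.2 := by
      rw [pow_eq_of_modEq hy2 (hu2.of_dvd (hN ▸ dvd_rfl)), pow_one]
    rw [e1, e2]; simp
  have hx := (mem_XS B.par).1 hx
  obtain ⟨i, hi⟩ := hfix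
  have hi := (Prod.mk.inj hi).1
  obtain ⟨l, hl, hol⟩ := h.order_pPart hx.1
  have hl1 : l ≤ 1 := by
    by_contra! hc
    have e1 : (x.1 ^ m') ^ (u + 1) = 1 := by
      apply pow_eq_one_of_dvd (pow_orderOf_eq_one _)
      rw [hol]; exact (pow_dvd_pow p (by omega)).trans hu1
    have e2 : (x.1 ^ m') ^ (t ^ i + 1) = 1 := by
      rw [← e1, pow_succ, pow_succ, pow_right_comm, ← hi, pow_right_comm]
    have e3 : p ^ 2 ∣ t ^ i + 1 := by
      have := orderOf_dvd_of_pow_eq_one e2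
      rw [hol] at this
      exact (pow_dvd_pow p hc).trans this
    have e4 := ((h.t_modEq hr i).add_right 1)
    have e5 : p ^ 2 ∣ 2 :=
      (Nat.modEq_zero_iff_dvd).1 (e4.symm.trans ((Nat.modEq_zero_iff_dvd).2 e3))
    have := Nat.le_of_dvd (by norm_num) e5
    nlinarith [h.prime.two_le]
  have hx1 : x.1 ^ (p ^ 1 * m') = 1 := by
    rw [mul_comm, pow_mul]
    exact pow_eq_one_of_dvd (pow_orderOf_eq_one _) (hol ▸ pow_dvd_pow p hl1)
  obtain ⟨q, hq, hd⟩ := h.exists_per_dvd (by omega) hx1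
  exact ppow_dvd_of_dvd_mul h.prime hq ((hper ▸ h₁.dvd_per hprim).trans hd)

/-- Decomposition of a divisor of `p ^ ν * n'`. -/
lemma exists_dvd_decomp {p ν n' n o : ℕ} (hp : p.Prime) (hn' : ¬ p ∣ n') (hn : n = p ^ ν * n')
    (ho : o ∣ n) : ∃ v w o', v ≤ ν ∧ ¬ p ∣ o' ∧ ¬ p ∣ w ∧ o = p ^ v * o' ∧ o' * w = n' ∧
      n / o = p ^ (ν - v) * w ∧ ordCompl[p] o = o' := by
  subst hn
  obtain ⟨j, hj⟩ := ho
  have hn0 : n' ≠ 0 := by rintro rfl; exact hn' (dvd_zero _)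
  have h0 : o * j ≠ 0 := hj ▸ mul_ne_zero (pow_ne_zero _ hp.ne_zero) hn0
  have ho0 : o ≠ 0 := left_ne_zero_of_mul h0
  have hj0 : j ≠ 0 := right_ne_zero_of_mul h0
  have e1 := Nat.ordProj_mul_ordCompl_eq_self o p
  have e2 := Nat.ordProj_mul_ordCompl_eq_self j p
  have d1 := Nat.not_dvd_ordCompl hp ho0
  have d2 := Nat.not_dvd_ordCompl hp hj0
  have e3 : p ^ ν * n' = p ^ (o.factorization p + j.factorization p) *
      (ordCompl[p] o * ordCompl[p] j) := by
    rw [hj]; conv_lhs => rw [← e1, ← e2]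
    rw [pow_add]; ring
  obtain ⟨e4, e5⟩ := ppow_mul_inj hp hn' (fun e => (hp.dvd_mul.1 e).elim d1 d2) e3
  refine ⟨o.factorization p, ordCompl[p] j, ordCompl[p] o, by omega, d1, d2, e1.symm, e5.symm,
    ?_, rfl⟩
  rw [hj, Nat.mul_div_cancel_left _ (Nat.pos_of_ne_zero ho0), e4, Nat.add_sub_cancel_left, e2]

/-- Upper bound for the contribution of a fibre. -/
lemma gcd_mul_ordCompl_le {p ν n' n o N k d j : ℕ} (hp : p.Prime) (hn' : ¬ p ∣ n')
    (hN : ¬ p ∣ N) (hn : n = p ^ ν * n') (ho : o ∣ n) (hd : p ^ d ∣ o) (hj : k ≤ j ∨ ν - d ≤ j) :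
    (n / o).gcd (p ^ k * N) * ordCompl[p] o ≤ p ^ j * n' := by
  obtain ⟨v, w, o', hv, ho', hw, e1, e2, e3, e4⟩ := exists_dvd_decomp hp hn' hn ho
  have hdv : d ≤ v := ppow_dvd_of_dvd_mul hp ho' (e1 ▸ hd)
  have hn0 : 0 < n' := Nat.pos_of_ne_zero (by rintro rfl; exact hn' (dvd_zero _))
  rw [e4, ← e2, e3, mul_comm o' w, ← mul_assoc]
  apply Nat.mul_le_mul_right
  have hw0 : 0 < w := Nat.pos_of_ne_zero (by rintro rfl; exact hw (dvd_zero _))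
  apply Nat.le_of_dvd (Nat.mul_pos (pow_pos hp.pos _) hw0)
  rcases hj with hj | hj
  · apply (Nat.gcd_mul_right_dvd_mul_gcd _ _ _).trans
    apply mul_dvd_mul
    · exact (Nat.gcd_dvd_right _ _).trans (pow_dvd_pow p hj)
    · have : ((p ^ (ν - v) * w).gcd N).Coprime (p ^ (ν - v)) :=
        Nat.Coprime.coprime_dvd_left (Nat.gcd_dvd_right _ _)
          (((hp.coprime_iff_not_dvd).2 hN).pow_left _).symm
      exact this.dvd_of_dvd_mul_left (Nat.gcd_dvd_left _ _)
  · exact (Nat.gcd_dvd_left _ _).trans (mul_dvd_mul_right (pow_dvd_pow p (by omega)) _)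

/-- Counting fixed points of `z ↦ z ^ (1 + p ^ k * N')`, upper bound. -/
lemma PPar.sum_lt (h : PPar p m n s t μ m' ν n' r σ δ) (hP : Par m n s t) {k : ℕ}
    (hk : k < r) (hkδ : k = ν - δ + 1) :
    ∑ x ∈ (XS K m n s t).filter (Fix t (1 + p ^ k * (m' * n'))), ((ordCompl[p] (per t x.1) : ℕ) : ℚ)
      < (p ^ k * m' * (p ^ k * n') : ℕ) := by
  have hkν : k ≤ ν + 1 := by omega
  have hPm : p ^ k * m' ∣ m := by
    rw [h.hm]; exact mul_dvd_mul_right (pow_dvd_pow p (by have := h.r_le; omega)) _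
  have hP0 : 0 < p ^ k * m' := Nat.mul_pos (pow_pos h.prime.pos _) h.m'_pos
  have he : p ^ k * (m' * n') ∣ m * n := by
    rw [h.card]; exact mul_dvd_mul_right (pow_dvd_pow p (by have := h.r_le; omega)) _
  have he0 : 0 < p ^ k * (m' * n') :=
    Nat.mul_pos (pow_pos h.prime.pos _) (Nat.mul_pos h.m'_pos h.n'_pos)
  have hsub : (XS K m n s t).filter (Fix t (1 + p ^ k * (m' * n'))) ⊆
      (XS K m n s t).filter (fun x => x.1 ^ (p ^ k * m') = 1 ∧ x.2 ^ (p ^ k * (m' * n')) = 1) := by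
    intro x hx
    rw [Finset.mem_filter] at hx ⊢
    obtain ⟨hx, hf⟩ := hx
    refine ⟨hx, ?_⟩
    have hx := (mem_XS hP).1 hx
    refine ⟨?_, Fix.snd (hx.ne_snd hP) hf⟩
    obtain ⟨i, hi⟩ := hf
    have hi := (Prod.mk.inj hi).1
    obtain ⟨l, hl, hol⟩ := h.order_pPart hx.1
    have hlk : l ≤ k := by
      by_contra! hc
      have e1 : (x.1 ^ m') ^ (1 + p ^ k * (m' * n')) = (x.1 ^ m') ^ (t ^ i) := by
        rw [pow_right_comm, hi, pow_right_comm]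
      have e2 := modEq_orderOf_of_pow_eq (pow_ne_zero _ (hx.ne_fst hP)) e1
      rw [hol] at e2
      have e3 : 1 + p ^ k * (m' * n') ≡ 1 + 0 [MOD p ^ (k + 1)] :=
        (e2.of_dvd (pow_dvd_pow p hc)).trans (h.t_modEq hk i)
      have e4 := (Nat.modEq_zero_iff_dvd).1 (Nat.ModEq.add_left_cancel' 1 e3)
      have := ppow_dvd_of_dvd_mul h.prime h.pN e4
      omega
    rw [mul_comm, pow_mul]
    exact pow_eq_one_of_dvd (pow_orderOf_eq_one _) (hol ▸ pow_dvd_pow p hlk)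
  refine (Finset.sum_le_sum_of_subset_of_nonneg hsub (fun _ _ _ => by positivity)).trans_lt ?_
  rw [sum_filter_XS hP hPm he (fun o => ((ordCompl[p] o : ℕ) : ℚ))]
  have hmem : ∀ {α : K}, α ∈ Polynomial.nthRootsFinset (p ^ k * m') (1 : K) → α ^ m = 1 := by
    intro α hα
    rw [Polynomial.mem_nthRootsFinset hP0] at hα
    exact pow_eq_one_of_dvd hα hPm
  have hle : ∀ (α : K) (d j : ℕ), α ^ m = 1 → p ^ d ∣ per t α → (k ≤ j ∨ ν - d ≤ j) →
      ((rootsOf (n / per t α) (p ^ k * (m' * n')) (α ^ s)).card : ℚ) *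
        ((ordCompl[p] (per t α) : ℕ) : ℚ) ≤ (p ^ j * n' : ℕ) := by
    intro α d j hα hd hj
    rw [← Nat.cast_mul, Nat.cast_le]
    exact (Nat.mul_le_mul_right _ (card_rootsOf_le he0 _)).trans
      (gcd_mul_ordCompl_le h.prime h.pn h.pN h.hn (hP.per_dvd hα) hd hj)
  calc _ < ∑ α ∈ Polynomial.nthRootsFinset (p ^ k * m') (1 : K), ((p ^ k * n' : ℕ) : ℚ) := by
        apply Finset.sum_lt_sum
        · intro α hα
          exact hle α 0 k (hmem hα) (by simp) (Or.inl le_rfl)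
        · obtain ⟨α, hα⟩ := exists_primRoot K h.m'_pos
          have hα1 : α ^ (p ^ k * m') = 1 := pow_eq_one_of_dvd hα.pow_eq_one (dvd_mul_left _ _)
          refine ⟨α, (Polynomial.mem_nthRootsFinset hP0 _).2 hα1, ?_⟩
          refine (hle α δ (k - 1) (pow_eq_one_of_dvd hα1 hPm) (h.dvd_per hα)
            (Or.inr (by omega))).trans_lt ?_
          rw [Nat.cast_lt]
          exact Nat.mul_lt_mul_of_pos_right (Nat.pow_lt_pow_right h.prime.one_lt (by omega))
            h.n'_pos
    _ = _ := by
        rw [Finset.sum_const, card_unityRoots hP0, nsmul_eq_mul]; push_cast; ring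

/-- Counting fixed points of `z ↦ z ^ (1 + p ^ k * N')`, lower bound. -/
lemma PPar.le_sum (h : PPar p m n s t μ m' ν n' r σ δ) (hP : Par m n s t) {k : ℕ}
    (hk : k ≤ r) (hkδ : k + δ ≤ ν) (hks : p ^ k ∣ s) :
    ((p ^ k * m' * (p ^ k * n') : ℕ) : ℚ) ≤
    ∑ x ∈ (XS K m n s t).filter (Fix t (1 + p ^ k * (m' * n'))),
      ((ordCompl[p] (per t x.1) : ℕ) : ℚ) := by
  have hPm : p ^ k * m' ∣ m := by
    rw [h.hm]; exact mul_dvd_mul_right (pow_dvd_pow p (by have := h.r_le; omega)) _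
  have hP0 : 0 < p ^ k * m' := Nat.mul_pos (pow_pos h.prime.pos _) h.m'_pos
  have he : p ^ k * (m' * n') ∣ m * n := by
    rw [h.card]; exact mul_dvd_mul_right (pow_dvd_pow p (by have := h.r_le; omega)) _
  have he0 : 0 < p ^ k * (m' * n') :=
    Nat.mul_pos (pow_pos h.prime.pos _) (Nat.mul_pos h.m'_pos h.n'_pos)
  have hsub : (XS K m n s t).filter
      (fun x => x.1 ^ (p ^ k * m') = 1 ∧ x.2 ^ (p ^ k * (m' * n')) = 1) ⊆
      (XS K m n s t).filter (Fix t (1 + p ^ k * (m' * n'))) := by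
    intro x hx
    rw [Finset.mem_filter] at hx ⊢
    exact ⟨hx.1, Fix.of_pow (pow_eq_one_of_dvd hx.2.1 ⟨n', by ring⟩) hx.2.2⟩
  refine le_trans ?_ (Finset.sum_le_sum_of_subset_of_nonneg hsub (fun _ _ _ => by positivity))
  rw [sum_filter_XS hP hPm he (fun o => ((ordCompl[p] o : ℕ) : ℚ))]
  calc _ = ∑ α ∈ Polynomial.nthRootsFinset (p ^ k * m') (1 : K), ((p ^ k * n' : ℕ) : ℚ) := by
        rw [Finset.sum_const, card_unityRoots hP0, nsmul_eq_mul]; push_cast; ring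
    _ ≤ _ := by
        apply Finset.sum_le_sum
        intro α hα
        rw [Polynomial.mem_nthRootsFinset hP0] at hα
        have hαm := pow_eq_one_of_dvd hα hPm
        obtain ⟨v, w, o', hv, ho', hw, e1, e2, e3, e4⟩ :=
          exists_dvd_decomp h.prime h.pn h.hn (hP.per_dvd hαm)
        obtain ⟨q, hq, hd⟩ := h.exists_per_dvd hk hα
        have hvδ : v ≤ δ := by
          apply ppow_dvd_of_dvd_mul h.prime hq
          exact (e1 ▸ dvd_mul_right _ _ : p ^ v ∣ per t α).trans hd
        have hw0 : 0 < w := Nat.pos_of_ne_zero (by rintro rfl; exact hw (dvd_zero _))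
        have hg : (n / per t α).gcd (p ^ k * (m' * n')) = p ^ k * w := by
          rw [e3, show ν - v = k + (ν - v - k) by omega, pow_add, mul_assoc, Nat.gcd_mul_left]
          congr 1
          rw [← e2, show m' * (o' * w) = (m' * o') * w by ring, Nat.gcd_mul_right]
          have : (p ^ (ν - v - k)).Coprime (m' * o') := by
            apply Nat.Coprime.pow_left
            rw [h.prime.coprime_iff_not_dvd]
            exact fun e => (h.prime.dvd_mul.1 e).elim h.pm ho'
          rw [this, one_mul]
        have hcard := card_rootsOf (K := K) (j := n / per t α) (e := p ^ k * (m' * n')) he0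
          (c := α ^ s) (by
            rw [hg, ← pow_mul]
            apply pow_eq_one_of_dvd hα
            have : p ^ k * (m' * n') / (p ^ k * w) = m' * o' := by
              rw [← e2]
              apply Nat.div_eq_of_eq_mul_left (Nat.mul_pos (pow_pos h.prime.pos _) hw0)
              ring
            rw [this]
            exact mul_dvd_mul hks (dvd_mul_right _ _))
        rw [hcard, hg, e4, ← Nat.cast_mul, ← e2]
        apply le_of_eq; congr 1; ring

/-- Comparison of `p`-parts when both groups have a normal `p`-complement. -/
lemma Bridge.not_lt_of_minimal (B : Bridge K m n s t m₁ n₁ s₁ t₁) (ht : 1 ≤ t) (ht₁ : 1 ≤ t₁)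
    (h : PPar p m n s t μ m' ν n' r σ δ) (h₁ : PPar p m₁ n₁ s₁ t₁ μ₁ m₁' ν₁ n₁' r₁ σ₁ δ₁)
    (hpi : μ = 0 ∨ 1 ≤ r) (h1 : ¬ (σ < r ∧ σ + δ ≤ ν)) (h2 : δ = 0 → ¬ (ν < σ ∧ ν < r)) :
    ν₁ ≤ ν := by
  by_contra! hlt
  have hr := B.exps_r ht ht₁ h h₁
  obtain ⟨hE, hN⟩ := B.exps h h₁
  have hδ := h.δ_le
  by_cases hc : r ≤ ν ∧ r ≤ σ
  · have hν : 1 ≤ ν := by omega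
    have := B.nu_le h h₁ le_rfl hc.1 hc.2 (by omega)
    omega
  · have hδ1 : 1 ≤ δ := by
      by_contra! h0
      have := h2 (by omega)
      omega
    obtain ⟨k, hk⟩ : ∃ k, k = ν - δ + 1 := ⟨_, rfl⟩
    have hkν : k ≤ ν := by omega
    have hkr : k < r := by omega
    have hkσ : k ≤ σ := by omega
    have hν₁ := B.nu_le h h₁ hkr.le hkν hkσ (by omega)
    have hkr₁ : k ≤ r₁ := by omega
    have hs₁ := B.k_le_sigma h h₁ hkr.le hkν hkσ (by omega) hr hkr₁
    have hδδ := B.delta_le h h₁ (by omega)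
    have l1 := h.sum_lt (K := K) B.par hkr hk
    have l2 := h₁.le_sum (K := K) B.par' hkr₁ (by omega) hs₁
    have e := B.sum_eq (1 + p ^ k * (m' * n')) (by rw [h.card]; exact coprime_one_add (by omega))
      (fun o => ((ordCompl[p] o : ℕ) : ℚ))
    rw [← hN] at l2
    have l3 := l2.trans (e.symm.le.trans l1.le)
    have l4 := lt_of_le_of_lt (l2.trans e.symm.le) l1
    rw [Nat.cast_lt] at l4
    have e5 : p ^ k * m' * (p ^ k * n') = p ^ k * p ^ k * (m' * n') := by ring
    have e6 : p ^ k * m₁' * (p ^ k * n₁') = p ^ k * p ^ k * (m₁' * n₁') := by ring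
    rw [e5, e6, hN] at l4
    exact lt_irrefl _ l4

end

section

lemma modEq_one_of_pow {M t i j : ℕ} (hi : t ^ i ≡ 1 [MOD M]) (hj : t ^ j ≡ 1 [MOD M]) :
    t ^ i.gcd j ≡ 1 [MOD M] := by
  rw [← ZMod.natCast_eq_natCast_iff] at *
  push_cast at *
  exact pow_gcd_eq_one.2 ⟨hi, hj⟩

lemma pow_prime_pow_modEq {p t : ℕ} (h : t ≡ 1 [MOD p]) (j : ℕ) :
    t ^ p ^ j ≡ 1 [MOD p ^ (j + 1)] := by
  have h1 : ((p : ℕ) : ℤ) ∣ (t : ℤ) - 1 := by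
    have := (Nat.modEq_iff_dvd.1 h.symm); simpa using this
  have h2 := dvd_sub_pow_of_dvd_sub h1 j
  apply Nat.ModEq.symm
  rw [Nat.modEq_iff_dvd]
  push_cast
  simpa using h2

/-- Every prime has local invariants. -/
lemma Par.exists_pPar {m n s t : ℕ} (h : Par m n s t) {p : ℕ} (hp : p.Prime) :
    ∃ m' n' r σ δ, PPar p m n s t (m.factorization p) m' (n.factorization p) n' r σ δ := by
  have hm := Nat.ordProj_mul_ordCompl_eq_self m p
  have hn := Nat.ordProj_mul_ordCompl_eq_self n p
  set μ := m.factorization p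
  set ν := n.factorization p
  have hm' := Nat.not_dvd_ordCompl hp h.m_pos.ne'
  have hn' := Nat.not_dvd_ordCompl hp h.n_pos.ne'
  set m' := ordCompl[p] m
  set n' := ordCompl[p] n
  have hcop : t.Coprime m' := h.cop.coprime_dvd_right ((Dvd.intro_left _ hm).mul_right n)
  have hm'0 : m' ≠ 0 := by rintro e; exact hm' (e ▸ dvd_zero _)
  have : NeZero m' := ⟨hm'0⟩
  set T := orderOf (ZMod.unitOfCoprime t hcop)
  have hT : ∀ k, t ^ k ≡ 1 [MOD m'] ↔ T ∣ k := by
    intro k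
    rw [orderOf_dvd_iff_pow_eq_one, ← Units.val_inj, ← ZMod.natCast_eq_natCast_iff]
    push_cast
    simp
  have hT0 : T ≠ 0 := (orderOf_pos _).ne'
  have hTn : T ∣ n := (hT n).1 (h.t_pow.of_dvd (Dvd.intro_left _ hm))
  refine ⟨m', n', Nat.findGreatest (fun r => t ≡ 1 [MOD p ^ r]) μ,
    Nat.findGreatest (fun r => p ^ r ∣ s) μ, T.factorization p, ?_⟩
  refine
  { prime := hp
    hm := hm.symm
    pm := hm'
    hn := hn.symm
    pn := hn'
    r_le := Nat.findGreatest_le _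
    r_mod := Nat.findGreatest_spec (P := fun r => t ≡ 1 [MOD p ^ r]) (Nat.zero_le μ)
      (by simpa using Nat.modEq_one)
    r_max := fun hlt =>
      Nat.findGreatest_is_greatest (P := fun r => t ≡ 1 [MOD p ^ r]) (Nat.lt_succ_self _) hlt
    σ_le := Nat.findGreatest_le _
    σ_dvd := Nat.findGreatest_spec (P := fun r => p ^ r ∣ s) (Nat.zero_le μ) (by simp)
    σ_max := fun hlt =>
      Nat.findGreatest_is_greatest (P := fun r => p ^ r ∣ s) (Nat.lt_succ_self _) hlt
    δ_le := (Nat.factorization_le_iff_dvd hT0 h.n_pos.ne').2 hTn p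
    δ_q := ⟨ordCompl[p] T, Nat.not_dvd_ordCompl hp hT0, ?_⟩
    δ_min := fun k hk => (Nat.ordProj_dvd T p).trans ((hT k).1 hk) }
  rw [Nat.ordProj_mul_ordCompl_eq_self]
  exact (hT _).2 dvd_rfl

variable {p m n s t μ m' ν n' r σ δ : ℕ} {K : Type*} [Field K] [CharZero K] [IsAlgClosed K]
  {m₁ n₁ s₁ t₁ μ₁ m₁' ν₁ n₁' r₁ σ₁ δ₁ : ℕ}

lemma PPar.le_add (h : PPar p m n s t μ m' ν n' r σ δ) (hP : Par m n s t) (ht : 1 ≤ t) :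
    μ ≤ σ + r := by
  by_contra! hc
  have hs : ¬ p ^ (σ + 1) ∣ s := h.σ_max (by omega)
  have ht1 : ¬ p ^ (r + 1) ∣ t - 1 := fun e =>
    h.r_max (by omega) ((Nat.modEq_iff_dvd' ht).2 e).symm
  have hs0 : s ≠ 0 := by rintro rfl; exact hs (dvd_zero _)
  have ht0 : t - 1 ≠ 0 := by intro e; exact ht1 (e ▸ dvd_zero _)
  have h1 : m ∣ s * (t - 1) := by
    rw [Nat.mul_sub, mul_one]
    exact (Nat.modEq_iff_dvd' (Nat.le_mul_of_pos_right s ht)).1 hP.s_mul.symm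
  have h2 : p ^ μ ∣ s * (t - 1) := (Dvd.intro _ h.hm.symm).trans h1
  rw [h.prime.pow_dvd_iff_le_factorization (mul_ne_zero hs0 ht0),
    Nat.factorization_mul hs0 ht0, Finsupp.add_apply] at h2
  rw [h.prime.pow_dvd_iff_le_factorization hs0] at hs
  rw [h.prime.pow_dvd_iff_le_factorization ht0] at ht1
  omega

lemma PPar.nu_pos (h : PPar p m n s t μ m' ν n' r σ δ) (hP : Par m n s t) (hr : 1 ≤ r)
    (hμ : r < μ) : 1 ≤ ν := by
  by_contra! hc
  have hν : ν = 0 := by omega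
  apply h.r_max hμ
  have h1 : t ^ n ≡ 1 [MOD p ^ μ] := hP.t_pow.of_dvd (Dvd.intro _ h.hm.symm)
  have h2 : t ^ p ^ μ ≡ 1 [MOD p ^ μ] := by
    have h0 : t ≡ 1 [MOD p] := by simpa using h.r_mod.of_dvd (pow_dvd_pow p hr)
    exact (pow_prime_pow_modEq h0 μ).of_dvd (pow_dvd_pow p (by omega))
  have h3 := modEq_one_of_pow h1 h2
  have h4 : n.gcd (p ^ μ) = 1 := by
    apply Nat.Coprime.pow_right
    rw [Nat.coprime_comm, h.prime.coprime_iff_not_dvd, h.hn, hν, pow_zero, one_mul]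
    exact h.pn
  rw [h4, pow_one] at h3
  exact h3.of_dvd (pow_dvd_pow p hμ)

lemma Bridge.not_mixed (B : Bridge K m n s t m₁ n₁ s₁ t₁) (ht : 1 ≤ t) (ht₁ : 1 ≤ t₁)
    (h : PPar p m n s t μ m' ν n' r σ δ) (h₁ : PPar p m₁ n₁ s₁ t₁ μ₁ m₁' ν₁ n₁' r₁ σ₁ δ₁)
    (hpi : μ = 0 ∨ 1 ≤ r) : μ₁ = 0 ∨ 1 ≤ r₁ := by
  by_contra! hc
  have hr := B.exps_r ht ht₁ h h₁
  obtain ⟨hE, hN⟩ := B.exps h h₁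
  have h1 := h.nu_pos B.par (by omega) (by omega)
  have h2 := h.le_add B.par ht
  have := B.nu_le h h₁ (k := 1) (by omega) (by omega) (by omega) (by omega)
  omega

/-- Numerical consequences of minimality of `m`. -/
def MinCond (m n s t : ℕ) : Prop :=
  ∀ p μ m' ν n' r σ δ, PPar p m n s t μ m' ν n' r σ δ → (μ = 0 ∨ 1 ≤ r) →
    ¬ (σ < r ∧ σ + δ ≤ ν) ∧ (δ = 0 → ¬ (ν < σ ∧ ν < r))

lemma Bridge.n_eq (B : Bridge K m n s t m₁ n₁ s₁ t₁) (ht : 1 ≤ t) (ht₁ : 1 ≤ t₁)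
    (h : MinCond m n s t) (h₁ : MinCond m₁ n₁ s₁ t₁) : n = n₁ := by
  apply Nat.eq_of_factorization_eq B.par.n_pos.ne' B.par'.n_pos.ne'
  intro p
  by_cases hp : p.Prime
  · obtain ⟨m', n', r, σ, δ, hP⟩ := B.par.exists_pPar hp
    obtain ⟨m₁', n₁', r₁, σ₁, δ₁, hP₁⟩ := B.par'.exists_pPar hp
    have hr := B.exps_r ht ht₁ hP hP₁
    by_cases hpi : m.factorization p = 0 ∨ 1 ≤ r
    · have hpi₁ := B.not_mixed ht ht₁ hP hP₁ hpi
      obtain ⟨a, b⟩ := h _ _ _ _ _ _ _ _ hP hpi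
      obtain ⟨a₁, b₁⟩ := h₁ _ _ _ _ _ _ _ _ hP₁ hpi₁
      exact le_antisymm (B.symm.not_lt_of_minimal ht₁ ht hP₁ hP hpi₁ a₁ b₁)
        (B.not_lt_of_minimal ht ht₁ hP hP₁ hpi a b)
    · have hpi₁ := mt (B.symm.not_mixed ht₁ ht hP₁ hP) hpi
      omega
  · simp [Nat.factorization_eq_zero_of_not_prime _ hp]

lemma Bridge.m_eq (B : Bridge K m n s t m₁ n₁ s₁ t₁) (ht : 1 ≤ t) (ht₁ : 1 ≤ t₁)
    (h : MinCond m n s t) (h₁ : MinCond m₁ n₁ s₁ t₁) : m = m₁ := by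
  have e := B.card_eq
  rw [B.n_eq ht ht₁ h h₁] at e
  exact Nat.eq_of_mul_eq_mul_right B.par'.n_pos e

end

section

lemma geom_sum_mul_eq (v i j : ℕ) :
    ∑ k ∈ Finset.range (i * j), v ^ k =
      (∑ k ∈ Finset.range i, v ^ k) * ∑ k ∈ Finset.range j, (v ^ i) ^ k := by
  induction j with
  | zero => simp
  | succ j ih =>
    rw [Nat.mul_succ, Finset.sum_range_add, ih, Finset.sum_range_succ _ j, mul_add]
    congr 1
    rw [← pow_mul, Finset.sum_mul]
    exact Finset.sum_congr rfl fun k _ => by rw [pow_add, mul_comm]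

lemma geom_sum_modEq {v M : ℕ} (hv : v ≡ 1 [MOD M]) (j : ℕ) :
    ∑ k ∈ Finset.range j, v ^ k ≡ j [MOD M] := by
  induction j with
  | zero => rfl
  | succ j ih => rw [Finset.sum_range_succ]; exact ih.add (modEq_pow_one hv)

lemma prime_pow_dvd_geom_sum {q v : ℕ} (hv : v ≡ 1 [MOD q]) (b : ℕ) :
    q ^ b ∣ ∑ k ∈ Finset.range (q ^ b), v ^ k := by
  induction b with
  | zero => simp
  | succ b ih =>
    rw [pow_succ, geom_sum_mul_eq]
    apply mul_dvd_mul ih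
    have := geom_sum_modEq (modEq_pow_one (k := q ^ b) hv) q
    exact (Nat.modEq_zero_iff_dvd).1 (this.trans (by simp [Nat.ModEq]))

lemma prime_pow_dvd_geom_sum_of_dvd {q v b M : ℕ} (hv : v ≡ 1 [MOD q]) (h : q ^ b ∣ M) :
    q ^ b ∣ ∑ k ∈ Finset.range M, v ^ k := by
  obtain ⟨c, rfl⟩ := h
  rw [geom_sum_mul_eq]
  exact (prime_pow_dvd_geom_sum hv b).mul_right _

/-- If `m ∣ s (t - 1)` and `g ∣ M` divides `t ^ M - 1`, then `m g ∣ s (t ^ M - 1)`. -/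
lemma mul_dvd_mul_pow_sub_one {m s t g M : ℕ} (ht : 1 ≤ t) (h : m ∣ s * (t - 1))
    (hg : g ∣ t ^ M - 1) (hM : g ∣ M) : m * g ∣ s * (t ^ M - 1) := by
  rw [Nat.dvd_iff_prime_pow_dvd_dvd]
  intro q k hq hk
  obtain ⟨x, y, hx, hy, hxy⟩ := exists_dvd_and_dvd_of_dvd_mul hk
  rw [hxy]
  obtain ⟨a, -, rfl⟩ := (Nat.dvd_prime_pow hq).1 (Dvd.intro _ hxy.symm)
  obtain ⟨b, -, rfl⟩ := (Nat.dvd_prime_pow hq).1 (Dvd.intro_left _ hxy.symm)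
  by_cases hqt : q ∣ t - 1
  · have e : t ^ M - 1 = (t - 1) * ∑ k ∈ Finset.range M, t ^ k := by
      zify [ht, Nat.one_le_pow _ _ ht]
      rw [mul_geom_sum]
    rw [e, ← mul_assoc]
    exact mul_dvd_mul (hx.trans h) (prime_pow_dvd_geom_sum_of_dvd
      ((Nat.modEq_iff_dvd' ht).2 hqt).symm (hy.trans hM))
  · apply mul_dvd_mul _ (hy.trans hg)
    exact Nat.Coprime.dvd_of_dvd_mul_right (((hq.coprime_iff_not_dvd).2 hqt).pow_left a)
      (hx.trans h)

lemma pow_eq_or_of_sq {x M : ℕ} (h : x ^ 2 ≡ 1 [MOD M]) (j : ℕ) :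
    x ^ j ≡ 1 [MOD M] ∨ x ^ j ≡ x [MOD M] := by
  obtain ⟨k, rfl | rfl⟩ := j.even_or_odd'
  · left; rw [pow_mul]; exact modEq_pow_one h
  · right
    rw [pow_succ, pow_mul]
    simpa using (modEq_pow_one (k := k) h).mul_right x

lemma sq_modEq_one_of_dvd {x M : ℕ} (h : M ∣ x + 1) : x ^ 2 ≡ 1 [MOD M] := by
  rw [← ZMod.natCast_eq_natCast_iff]
  rw [← ZMod.natCast_eq_zero_iff] at h
  push_cast at *
  linear_combination ((x : ZMod M) - 1) * h

lemma sq_modEq_one_of_half {x i : ℕ} (hi : 1 ≤ i) (h : 2 ^ i ∣ x + 1) :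
    x ^ 2 ≡ 1 [MOD 2 ^ (i + 1)] := by
  obtain ⟨c, hc⟩ := h
  have h2 : 2 ∣ x + 1 := ⟨2 ^ (i - 1) * c, by
    rw [hc]; obtain ⟨j, rfl⟩ := Nat.exists_eq_add_of_le hi
    simp only [Nat.add_sub_cancel_left]; rw [pow_add]; ring⟩
  have hx : 1 ≤ x := by omega
  obtain ⟨y, rfl⟩ := Nat.exists_eq_add_of_le hx
  obtain ⟨z, hz⟩ : 2 ∣ y := by omega
  subst hz
  have : (1 + 2 * z) ^ 2 = 1 + 2 ^ (i + 1) * (c * z) := by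
    rw [pow_succ 2 i]
    calc (1 + 2 * z) ^ 2 = 1 + 2 * z * (1 + 2 * z + 1) := by ring
      _ = _ := by rw [hc]; ring
  rw [this]
  simp [Nat.ModEq]

variable {K : Type*} [Field K] [CharZero K] [IsAlgClosed K] {m n s t μ m' ν n' r σ δ s₁ t₁ r₁ σ₁ δ₁ : ℕ}

lemma PPar.snd_pow (h : PPar 2 m n s t μ m' ν n' r σ δ) (hP : Par m n s t) {y : K × K}
    (hy : XMem m n s t y) {u : ℕ} (hu : 4 ∣ u + 1) (hf : Fix t u y) :
    y.2 ^ (2 * (m' * n')) = 1 := by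
  obtain ⟨i, hi⟩ := hf
  have hi : y.2 ^ u = y.2 := (Prod.mk.inj hi).2
  have h1 : (y.2 ^ (m' * n')) ^ 2 ^ (μ + ν) = 1 := by
    rw [← pow_mul, mul_comm, ← h.card, hy.pow_snd hP]
  obtain ⟨l, hl, hol⟩ := (Nat.dvd_prime_pow Nat.prime_two).1 (orderOf_dvd_of_pow_eq_one h1)
  have h2 : (y.2 ^ (m' * n')) ^ u = (y.2 ^ (m' * n')) ^ 1 := by rw [pow_right_comm, hi, pow_one]
  have h3 := modEq_orderOf_of_pow_eq (pow_ne_zero _ (hy.ne_snd hP)) h2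
  have hl1 : l ≤ 1 := by
    by_contra! hc
    rw [hol] at h3
    have h4 : u ≡ 1 [MOD 4] := h3.of_dvd (pow_dvd_pow 2 hc)
    have h4 : u % 4 = 1 % 4 := h4
    omega
  rw [mul_comm, pow_mul]
  exact pow_eq_one_of_dvd (pow_orderOf_eq_one _) (hol ▸ pow_dvd_pow 2 hl1)

/-- Criterion for invariance under `z ↦ z ^ (1 + 2 ^ i * N')`. -/
lemma PPar.fix_of (h : PPar 2 m n s t μ m' ν n' r σ δ) (hP : Par m n s t) {y : K × K}
    (hy : XMem m n s t y) {u i : ℕ} (hi : 1 ≤ i) (hu : 4 ∣ u + 1) (hf : Fix t u y)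
    (hno : ∀ j, ¬ u ≡ t ^ j [MOD 2 ^ (i + 1)]) :
    Fix t (1 + 2 ^ i * (m' * n')) y := by
  have h2 := h.snd_pow hP hy hu hf
  obtain ⟨l, hl, hol⟩ := h.order_pPart hy.1
  have hli : l ≤ i := by
    by_contra! hc
    obtain ⟨j, hj⟩ := hf
    have hj := (Prod.mk.inj hj).1
    have e1 : (y.1 ^ m') ^ u = (y.1 ^ m') ^ (t ^ j) := by rw [pow_right_comm, hj, pow_right_comm]
    have e2 := modEq_orderOf_of_pow_eq (pow_ne_zero _ (hy.ne_fst hP)) e1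
    rw [hol] at e2
    exact hno j (e2.of_dvd (pow_dvd_pow 2 hc))
  apply Fix.of_pow
  · rw [mul_left_comm, pow_mul]
    apply pow_eq_one_of_dvd (pow_orderOf_eq_one _)
    exact hol ▸ (pow_dvd_pow 2 hli).mul_right _
  · exact pow_eq_one_of_dvd h2 (mul_dvd_mul_right (dvd_pow_self 2 (by omega)) _)

lemma not_dvd_two_pow_mul {i N : ℕ} (hN : ¬ 2 ∣ N) : ¬ 1 + 2 ^ i * N ≡ 1 [MOD 2 ^ (i + 1)] := by
  intro e
  have e4 := (Nat.modEq_zero_iff_dvd).1 (Nat.ModEq.add_left_cancel' 1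
    (show 1 + 2 ^ i * N ≡ 1 + 0 [MOD 2 ^ (i + 1)] from e))
  have := ppow_dvd_of_dvd_mul Nat.prime_two hN e4
  omega

/-- An element not fixed by `z ↦ z ^ (1 + 2 ^ i * N')`. -/
lemma not_fix {i N : ℕ} (hi : 2 ≤ i) (hN : ¬ 2 ∣ N) (ht : 4 ∣ t + 1)
    (hsq : t ^ 2 ≡ 1 [MOD 2 ^ (i + 1)]) {x : K × K} {o : ℕ} (hx : IsPrimitiveRoot x.1 o)
    (hx0 : x.1 ≠ 0) (ho : 2 ^ (i + 1) ∣ o) : ¬ Fix t (1 + 2 ^ i * N) x := by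
  rintro ⟨j, hj⟩
  have hj := (Prod.mk.inj hj).1
  have e := modEq_orderOf_of_pow_eq hx0 hj
  rw [← hx.eq_orderOf] at e
  have e := e.of_dvd ho
  rcases pow_eq_or_of_sq hsq j with h | h
  · exact not_dvd_two_pow_mul hN (e.trans h)
  · have e1 : 1 + 2 ^ i * N ≡ t [MOD 2 ^ 2] := (e.trans h).of_dvd (pow_dvd_pow 2 (by omega))
    have e2 : (2 ^ i * N) % 4 = 0 := by
      apply Nat.mod_eq_zero_of_dvd
      exact (pow_dvd_pow 2 hi).mul_right N
    have e1 : (1 + 2 ^ i * N) % 4 = t % 4 := e1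
    omega

lemma Bridge.not_fixed_neg (B : Bridge K m n s t m n s₁ t₁) (h : PPar 2 m n s t μ m' ν n' r σ δ)
    (h₁ : PPar 2 m n s₁ t₁ μ m' ν n' r₁ σ₁ δ₁) {i : ℕ} (hi : 2 ≤ i) (hiμ : i + 1 ≤ μ)
    (ht : 2 ^ (i + 1) ∣ t + 1) (ht₁ : 2 ^ i ∣ t₁ + 1) (ht₁' : ¬ 2 ^ (i + 1) ∣ t₁ + 1)
    (hs : 2 ^ i ∣ s) (hc : 2 ^ (i + 1) ∣ s ∨ ¬ 2 ∣ n / 2) : False := by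
  obtain ⟨α, hα⟩ := exists_primRoot K (pow_pos two_pos (i + 1))
  have hα0 : α ≠ 0 := hα.ne_zero (pow_pos two_pos _).ne'
  have hαm : α ^ m = 1 := pow_eq_one_of_dvd hα.pow_eq_one
    ((pow_dvd_pow 2 hiμ).trans ⟨m', h.hm⟩)
  have h8 : 2 ^ 3 ∣ 2 ^ (i + 1) := pow_dvd_pow 2 (by omega)
  have ht4 : 4 ∣ t + 1 := (show 4 ∣ 2 ^ 3 by norm_num).trans (h8.trans ht)
  have hsq := sq_modEq_one_of_dvd ht
  have hper : per t α = 2 := by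
    have h2 : per t α ∣ 2 := by
      rw [per_dvd_iff, pow_eq_of_modEq hα.pow_eq_one hsq, pow_one]
    rcases (Nat.dvd_prime Nat.prime_two).1 h2 with h1 | h1
    · rw [per_eq_one_iff] at h1
      have := modEq_orderOf_of_pow_eq hα0 (i := t) (j := 1) (by rw [h1, pow_one])
      rw [← hα.eq_orderOf] at this
      have : t % 8 = 1 % 8 := this.of_dvd h8
      omega
    · exact h1
  have hn2 : 2 ∣ n := hper ▸ B.par.per_dvd hαm
  have hsq1 : (α ^ s) ^ 2 = 1 := by
    rw [← pow_mul]
    exact pow_eq_one_of_dvd hα.pow_eq_one (by rw [pow_succ]; exact mul_dvd_mul_right hs 2)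
  have hx : XMem m n s t ((α, α ^ s) : K × K) := by
    refine ⟨hαm, ?_⟩
    change (α ^ s) ^ (n / per t α) = α ^ s
    rw [hper]
    rcases hc with hc | hc
    · rw [pow_eq_one_of_dvd hα.pow_eq_one hc, one_pow]
    · have h2 : n / 2 ≡ 1 [MOD 2] := by
        have : n / 2 % 2 = 1 := by omega
        exact this
      rw [pow_eq_of_modEq hsq1 h2, pow_one]
  obtain ⟨u, hu1, hu2, hu3⟩ := exists_neg_one (E := μ + ν) Nat.prime_two h.pN
  rw [← h.card] at hu3
  have huM : 2 ^ (i + 1) ∣ u + 1 := (pow_dvd_pow 2 (by omega)).trans hu1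
  have hu4 : 4 ∣ u + 1 := (show 4 ∣ 2 ^ 3 by norm_num).trans (h8.trans huM)
  have hfx : Fix t u ((α, α ^ s) : K × K) := by
    refine ⟨1, Prod.ext ?_ ?_⟩
    · change α ^ u = α ^ t ^ 1
      rw [pow_one]
      apply pow_eq_of_modEq hα.pow_eq_one
      apply Nat.ModEq.add_right_cancel' 1
      exact ((Nat.modEq_zero_iff_dvd).2 huM).trans ((Nat.modEq_zero_iff_dvd).2 ht).symm
    · change (α ^ s) ^ u = α ^ s
      have h2 : u ≡ 1 [MOD 2] := by
        have : u % 2 = 1 := by omega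
        exact this
      rw [pow_eq_of_modEq hsq1 h2, pow_one]
  obtain ⟨y, hy, -, hf⟩ := B.corr _ ((mem_XS B.par).2 hx)
  have hy := (mem_XS B.par').1 hy
  have hfy := (hf u hu3).1 hfx
  have hsq₁ := sq_modEq_one_of_half (by omega) ht₁
  have hfy2 := h₁.fix_of B.par' hy (i := i) (by omega) hu4 hfy (by
    intro j e
    have e0 := (Nat.modEq_zero_iff_dvd).2 huM
    rcases pow_eq_or_of_sq hsq₁ j with h | h
    · have e1 := ((e.trans h).add_right 1).symm.trans e0
      have := Nat.le_of_dvd (by norm_num) (h8.trans ((Nat.modEq_zero_iff_dvd).1 e1))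
      omega
    · exact ht₁' ((Nat.modEq_zero_iff_dvd).1 (((e.trans h).add_right 1).symm.trans e0)))
  refine not_fix (N := m' * n') hi h.pN ht4 hsq hα hα0 dvd_rfl ((hf _ ?_).2 hfy2)
  rw [h.card]; exact coprime_one_add (by omega)

lemma Bridge.not_fixed_half (B : Bridge K m n s t m n s₁ t₁) (h₁1 : 1 ≤ t₁)
    (h : PPar 2 m n s t μ m' ν n' r σ δ)
    (h₁ : PPar 2 m n s₁ t₁ μ m' ν n' r₁ σ₁ δ₁) {i : ℕ} (hi : 2 ≤ i) (hiμ : i + 1 = μ)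
    (ht : 2 ^ (i + 1) ∣ t + 1) (ht₁ : 2 ^ i ∣ t₁ + 1) (ht₁' : ¬ 2 ^ (i + 1) ∣ t₁ + 1)
    (hν : 2 ≤ ν) (hδ : δ = ν) : False := by
  have hsq := sq_modEq_one_of_dvd ht
  have hsq₁ := sq_modEq_one_of_half (by omega) ht₁
  have ht₁4 : 4 ∣ t₁ + 1 := (pow_dvd_pow 2 hi).trans ht₁
  have ht4 : 4 ∣ t + 1 := (pow_dvd_pow 2 (by omega : 2 ≤ i + 1)).trans ht
  -- the order of `t₁` modulo `m'` has the full `2`-part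
  have hδ₁ : ν ≤ δ₁ := by
    obtain ⟨x, hx, hprim, -⟩ := h.exists_pPrime (K := K) B.par
    obtain ⟨y, hy, hper, -⟩ := B.corr x hx
    have hy := (mem_XS B.par').1 hy
    obtain ⟨q, hq, hqt⟩ := h₁.δ_q
    have hd : 2 ^ ν ∣ per t₁ y.1 := by rw [← hper, ← hδ]; exact h.dvd_per hprim
    have h2 : ∀ k, 2 ∣ k → t₁ ^ k ≡ 1 [MOD m'] → per t₁ y.1 ∣ k := by
      rintro _ ⟨k, rfl⟩ hk
      rw [per_dvd_iff]
      have := modEq_mul_of_modEq Nat.prime_two h.pm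
        (show t₁ ^ (2 * k) ≡ 1 [MOD 2 ^ μ] by
          rw [← hiμ, pow_mul]; exact modEq_pow_one hsq₁) hk
      rw [← h.hm] at this
      rw [pow_eq_of_modEq hy.1 this, pow_one]
    rcases Nat.eq_zero_or_pos δ₁ with h0 | h0
    · have h3 := h2 (2 * q) (dvd_mul_right _ _) (by
        rw [h0, pow_zero, one_mul] at hqt
        rw [mul_comm, pow_mul]; exact modEq_pow_one hqt)
      have := ppow_dvd_of_dvd_mul Nat.prime_two hq ((pow_one 2).symm ▸ hd.trans h3)
      omega
    · have h3 := h2 _ ((dvd_pow_self 2 h0.ne').mul_right q) hqt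
      exact ppow_dvd_of_dvd_mul Nat.prime_two hq (hd.trans h3)
  obtain ⟨α, hα⟩ := exists_primRoot K B.par.m_pos
  have hα0 : α ≠ 0 := hα.ne_zero B.par.m_pos.ne'
  have hpd := B.par'.per_dvd hα.pow_eq_one
  have hodd : ¬ 2 ∣ n / per t₁ α := by
    have h2 : 2 ^ ν ∣ per t₁ α := by
      apply (pow_dvd_pow 2 hδ₁).trans
      apply h₁.δ_min
      have := modEq_orderOf_of_pow_eq hα0 (i := t₁ ^ per t₁ α) (j := 1)
        (by rw [pow_pow_per, pow_one])
      rw [← hα.eq_orderOf] at this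
      exact this.of_dvd (Dvd.intro_left _ h.hm.symm)
    intro h3
    have h4 : 2 ^ (ν + 1) ∣ 2 ^ ν * n' := by
      rw [← h.hn, ← Nat.mul_div_cancel' hpd, pow_succ]
      exact mul_dvd_mul h2 h3
    have := ppow_dvd_of_dvd_mul Nat.prime_two h.pn h4
    omega
  obtain ⟨k, hk⟩ : ∃ k, k = n / per t₁ α := ⟨_, rfl⟩
  have hkn : k ∣ n' := by
    have h1 : k ∣ 2 ^ ν * n' := h.hn ▸ hk ▸ Nat.div_dvd_of_dvd hpd
    rw [← hk] at hodd
    exact (((Nat.prime_two.coprime_iff_not_dvd).2 hodd).symm.pow_right ν).dvd_of_dvd_mul_left h1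
  obtain ⟨u, hu⟩ : ∃ u, u = t₁ ^ (m' * n') := ⟨_, rfl⟩
  have hut : u ≡ t₁ [MOD 2 ^ (i + 1)] := by
    obtain ⟨c, hc⟩ : ∃ c, m' * n' = 2 * c + 1 := by
      have := h.pN
      exact ⟨m' * n' / 2, by omega⟩
    rw [hu, hc, pow_succ t₁, pow_mul]
    simpa using (modEq_pow_one (k := c) hsq₁).mul_right t₁
  have hu4 : 4 ∣ u + 1 := by
    have : u % 4 = t₁ % 4 := hut.of_dvd (pow_dvd_pow 2 (by omega : 2 ≤ i + 1))
    omega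
  have hu0 : 0 < u - 1 := by omega
  have hmul : m ∣ s₁ * (t₁ - 1) := by
    rw [Nat.mul_sub, mul_one]
    exact (Nat.modEq_iff_dvd' (Nat.le_mul_of_pos_right s₁ h₁1)).1 B.par'.s_mul.symm
  have hdiv : α ^ (s₁ * ((u - 1) / k.gcd (u - 1))) = 1 := by
    apply pow_eq_one_of_dvd hα.pow_eq_one
    have hg := Nat.gcd_dvd_right k (u - 1)
    have h1 : m * k.gcd (u - 1) ∣ s₁ * (u - 1) := by
      rw [hu]
      apply mul_dvd_mul_pow_sub_one h₁1 hmul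
      · rw [← hu]; exact hg
      · exact ((Nat.gcd_dvd_left k _).trans hkn).mul_left m'
    have hg0 : 0 < k.gcd (u - 1) := Nat.gcd_pos_of_pos_right _ hu0
    rw [← Nat.mul_div_assoc _ hg]
    exact (Nat.dvd_div_iff_mul_dvd (hg.mul_left s₁)).2 (by rwa [mul_comm])
  have hcard := card_rootsOf (K := K) (j := k) hu0 (c := α ^ s₁) (by rw [← pow_mul]; exact hdiv)
  obtain ⟨β, hβ⟩ : (rootsOf k (u - 1) (α ^ s₁)).Nonempty := by
    rw [← Finset.card_pos, hcard]; exact Nat.gcd_pos_of_pos_right _ hu0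
  obtain ⟨hβ1, hβ2⟩ := (mem_rootsOf hu0).1 hβ
  have hx : XMem m n s₁ t₁ ((α, β) : K × K) := ⟨hα.pow_eq_one, by
    change β ^ (n / per t₁ α) = α ^ s₁
    rw [← hk, hβ2]⟩
  have hfx : Fix t₁ u ((α, β) : K × K) := by
    refine ⟨m' * n', Prod.ext ?_ ?_⟩
    · change α ^ u = α ^ t₁ ^ (m' * n')
      rw [hu]
    · change β ^ u = β
      rw [show u = (u - 1) + 1 by omega, pow_succ, hβ1, one_mul]
  have hucop : u.Coprime (m * n) := by rw [hu]; exact B.par'.cop.pow_left _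
  obtain ⟨y, hy, -, hf⟩ := B.corr' _ ((mem_XS B.par').2 hx)
  have hy := (mem_XS B.par).1 hy
  have hfy := (hf u hucop).2 hfx
  have hfy2 := h.fix_of B.par hy (i := i) (by omega) hu4 hfy (by
    intro j e
    have e := hut.symm.trans e
    rcases pow_eq_or_of_sq hsq j with h | h
    · have : t₁ % 4 = 1 % 4 := (e.trans h).of_dvd (pow_dvd_pow 2 (by omega : 2 ≤ i + 1))
      omega
    · exact ht₁' ((Nat.modEq_zero_iff_dvd).1
        (((e.trans h).add_right 1).trans ((Nat.modEq_zero_iff_dvd).2 ht))))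
  refine not_fix (N := m' * n') hi h.pN ht₁4 hsq₁ hα hα0 ?_ ((hf _ ?_).1 hfy2)
  · rw [hiμ]; exact Dvd.intro _ h.hm.symm
  · rw [h.card]; exact coprime_one_add (by omega)

lemma Bridge.neg_one_mod (B : Bridge K m n s t m n s₁ t₁) (ht1 : 1 ≤ t) (h₁1 : 1 ≤ t₁)
    (h : PPar 2 m n s t μ m' ν n' r σ δ)
    (h₁ : PPar 2 m n s₁ t₁ μ m' ν n' r₁ σ₁ δ₁)
    (hmin : 3 ≤ μ → 2 ≤ ν → 2 ^ μ ∣ t + 1 → ¬ 2 ^ μ ∣ s → δ = ν)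
    {j : ℕ} (hj : j ≤ μ) (ht : 2 ^ j ∣ t + 1) (ht₁ : 2 ≤ j → 4 ∣ t₁ + 1) :
    2 ≤ j → 2 ^ j ∣ t₁ + 1 := by
  intro hj2
  by_contra hc
  obtain ⟨i, hi⟩ : ∃ i, i = Nat.findGreatest (fun i => 2 ^ i ∣ t₁ + 1) j := ⟨_, rfl⟩
  have hi2 : 2 ≤ i := hi ▸ Nat.le_findGreatest hj2 (ht₁ hj2)
  have hspec : 2 ^ i ∣ t₁ + 1 := hi ▸ Nat.findGreatest_spec (P := fun i => 2 ^ i ∣ t₁ + 1) hj2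
    (ht₁ hj2)
  have hij : i ≤ j := hi ▸ Nat.findGreatest_le _
  have hij : i < j := lt_of_le_of_ne hij (by rintro rfl; exact hc hspec)
  have hnot : ¬ 2 ^ (i + 1) ∣ t₁ + 1 :=
    Nat.findGreatest_is_greatest (P := fun i => 2 ^ i ∣ t₁ + 1) (by omega) hij
  have hti : 2 ^ (i + 1) ∣ t + 1 := (pow_dvd_pow 2 hij).trans ht
  have ht4 : 4 ∣ t + 1 := (pow_dvd_pow 2 (by omega : 2 ≤ i + 1)).trans hti
  have hs : 2 ^ (μ - 1) ∣ s := by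
    have hmul : m ∣ s * (t - 1) := by
      rw [Nat.mul_sub, mul_one]
      exact (Nat.modEq_iff_dvd' (Nat.le_mul_of_pos_right s ht1)).1 B.par.s_mul.symm
    obtain ⟨c, hc⟩ : ∃ c, t - 1 = 2 * c := ⟨(t - 1) / 2, by omega⟩
    have hc2 : ¬ 2 ∣ c := by omega
    have h1 : 2 ^ (μ - 1) * 2 ∣ s * c * 2 := by
      rw [← pow_succ, show μ - 1 + 1 = μ by omega, mul_assoc, mul_comm c 2, ← hc]
      exact (Dvd.intro _ h.hm.symm).trans hmul
    exact Nat.Coprime.dvd_of_dvd_mul_right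
      (((Nat.prime_two.coprime_iff_not_dvd).2 hc2).pow_left _)
      (Nat.dvd_of_mul_dvd_mul_right two_pos h1)
  by_cases ha : 2 ^ (i + 1) ∣ s ∨ ¬ 2 ∣ n / 2
  · exact B.not_fixed_neg h h₁ hi2 (by omega) hti hspec hnot
      ((pow_dvd_pow 2 (by omega)).trans hs) ha
  · push Not at ha
    obtain ⟨hns, hn2⟩ := ha
    have hiμ : i + 1 = μ := by
      by_contra hne
      exact hns ((pow_dvd_pow 2 (by omega)).trans hs)
    have hn : 2 ∣ n := by
      by_contra hodd
      have h1 : t ^ n ≡ 1 [MOD 4] := B.par.t_pow.of_dvd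
        ((pow_dvd_pow 2 (by omega : 2 ≤ μ)).trans (Dvd.intro _ h.hm.symm))
      obtain ⟨c, hc⟩ : ∃ c, n = 2 * c + 1 := ⟨n / 2, by omega⟩
      have h2 : t ^ n ≡ t [MOD 4] := by
        rw [hc, pow_succ, pow_mul]
        simpa using (modEq_pow_one (k := c) (sq_modEq_one_of_dvd ht4)).mul_right t
      have : t % 4 = 1 % 4 := h2.symm.trans h1
      omega
    have hν : 2 ≤ ν := by
      have h4 : 2 ^ 2 ∣ 2 ^ ν * n' := by rw [← h.hn]; omega
      exact ppow_dvd_of_dvd_mul Nat.prime_two h.pn h4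
    exact B.not_fixed_half h₁1 h h₁ hi2 hiμ hti hspec hnot hν
      (hmin (by omega) hν (hiμ ▸ hti) (hiμ ▸ hns))

end

section

/-- Divisors `r` of `m` such that `t` is trivial modulo `r_{2'}` and `±1` modulo `r_2`. -/
def rSet (m t : ℕ) : Set ℕ :=
  {r | r ∣ m ∧ t ≡ 1 [MOD ordCompl[2] r] ∧
    (t ≡ 1 [MOD ordProj[2] r] ∨ ordProj[2] r ∣ t + 1)}

lemma one_mem_rSet (m t : ℕ) : 1 ∈ rSet m t :=
  ⟨one_dvd _, by simp [Nat.modEq_one], by simp⟩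

lemma rSet_bddAbove {m t : ℕ} (hm : 0 < m) : BddAbove (rSet m t) :=
  ⟨m, fun _ hr => Nat.le_of_dvd hm hr.1⟩

lemma modEq_one_iff_dvd {k t : ℕ} (ht : 1 ≤ t) : t ≡ 1 [MOD k] ↔ k ∣ t - 1 :=
  ⟨fun h => (Nat.modEq_iff_dvd' ht).1 h.symm, fun h => ((Nat.modEq_iff_dvd' ht).2 h).symm⟩

/-- The condition on the prime `2` forced by minimality of `r`. -/
def MinCond2 (m n s t : ℕ) : Prop := ∀ μ m' ν n' r σ δ, PPar 2 m n s t μ m' ν n' r σ δ →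
  3 ≤ μ → 2 ≤ ν → 2 ^ μ ∣ t + 1 → ¬ 2 ^ μ ∣ s → δ = ν

variable {K : Type*} [Field K] [CharZero K] [IsAlgClosed K] {m n s t s₁ t₁ : ℕ}

lemma Bridge.rSet_subset (B : Bridge K m n s t m n s₁ t₁) (ht1 : 1 ≤ t) (h₁1 : 1 ≤ t₁)
    (hmin : MinCond2 m n s t) : rSet m t ⊆ rSet m t₁ := by
  have hg : m.gcd (t - 1) = m.gcd (t₁ - 1) :=
    Nat.eq_of_mul_eq_mul_right B.par.n_pos (B.gcd_mul ht1 h₁1)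
  have hiff : ∀ k, k ∣ m → (t ≡ 1 [MOD k] ↔ t₁ ≡ 1 [MOD k]) := by
    intro k hk
    rw [modEq_one_iff_dvd ht1, modEq_one_iff_dvd h₁1]
    constructor
    · intro h; exact (hg ▸ Nat.dvd_gcd hk h).trans (Nat.gcd_dvd_right _ _)
    · intro h; exact (hg.symm ▸ Nat.dvd_gcd hk h).trans (Nat.gcd_dvd_right _ _)
  rintro r ⟨hr, hc, hp⟩
  refine ⟨hr, (hiff _ ((Nat.ordCompl_dvd r 2).trans hr)).1 hc, ?_⟩
  have hpm := (Nat.ordProj_dvd r 2).trans hr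
  rcases hp with hp | hp
  · exact Or.inl ((hiff _ hpm).1 hp)
  right
  obtain ⟨m', n', r0, σ, δ, h⟩ := B.par.exists_pPar Nat.prime_two
  obtain ⟨m₁', n₁', r₁, σ₁, δ₁, h₁⟩ := B.par'.exists_pPar Nat.prime_two
  obtain rfl : m' = m₁' := Nat.eq_of_mul_eq_mul_left (pow_pos two_pos _) (h.hm.symm.trans h₁.hm)
  obtain rfl : n' = n₁' := Nat.eq_of_mul_eq_mul_left (pow_pos two_pos _) (h.hn.symm.trans h₁.hn)
  obtain ⟨j, hj⟩ : ∃ j, j = r.factorization 2 := ⟨_, rfl⟩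
  rw [← hj] at hp hpm ⊢
  have hjμ : j ≤ m.factorization 2 := ppow_dvd_of_dvd_mul Nat.prime_two h.pm (h.hm ▸ hpm)
  have h4 : 2 ≤ j → 4 ∣ t₁ + 1 := by
    intro hj2
    have h4j : 4 ∣ 2 ^ j := pow_dvd_pow 2 hj2
    have hn4 : ¬ t₁ ≡ 1 [MOD 4] := by
      intro hc
      have : t % 4 = 1 % 4 := (hiff 4 (h4j.trans hpm)).2 hc
      have := h4j.trans hp
      omega
    have hodd : ¬ 2 ∣ t₁ := by
      intro h2
      have := Nat.dvd_gcd h2 (((show 2 ∣ 4 by norm_num).trans (h4j.trans hpm)).mul_right n)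
      rw [B.par'.cop] at this
      omega
    have : ¬ t₁ % 4 = 1 % 4 := hn4
    omega
  rcases Nat.lt_or_ge j 2 with hj2 | hj2
  · interval_cases j
    · simp
    · have hodd : ¬ 2 ∣ t₁ := by
        intro h2
        have := Nat.dvd_gcd h2 ((show 2 ∣ m by simpa using hpm).mul_right n)
        rw [B.par'.cop] at this
        omega
      rw [pow_one]; omega
  · exact B.neg_one_mod ht1 h₁1 h h₁ (hmin _ _ _ _ _ _ _ h) hjμ hp h4 hj2

/-! ### Groups with a normal cyclic subgroup -/

section Group
variable {G : Type*} [Group G] [Finite G] {a b : G} {t : ℕ}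

lemma mem_zpowers_iff_nat {x g : G} : x ∈ Subgroup.zpowers g ↔ ∃ i : ℕ, g ^ i = x := by
  rw [← mem_powers_iff_mem_zpowers]; exact Submonoid.mem_powers_iff _ _

lemma normal_zpowers_of_gen (nf : ∀ g : G, ∃ j i : ℕ, g = b ^ j * a ^ i) {g : G}
    (ha : a⁻¹ * g * a ∈ Subgroup.zpowers g) (hb : b⁻¹ * g * b ∈ Subgroup.zpowers g) :
    (Subgroup.zpowers g).Normal := by
  have key : ∀ c : G, c⁻¹ * g * c ∈ Subgroup.zpowers g → ∀ x ∈ Subgroup.zpowers g,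
      c⁻¹ * x * c ∈ Subgroup.zpowers g := by
    intro c hc x hx
    obtain ⟨i, rfl⟩ := mem_zpowers_iff_nat.1 hx
    have : c⁻¹ * g ^ i * c = (c⁻¹ * g * c) ^ i := by
      have := conj_pow (i := i) (a := c⁻¹) (b := g)
      rw [inv_inv] at this; exact this.symm
    rw [this]; exact pow_mem hc i
  have keyp : ∀ c : G, c⁻¹ * g * c ∈ Subgroup.zpowers g → ∀ (i : ℕ), ∀ x ∈ Subgroup.zpowers g,
      (c ^ i)⁻¹ * x * c ^ i ∈ Subgroup.zpowers g := by
    intro c hc i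
    induction i with
    | zero => intro x hx; simpa using hx
    | succ i ih =>
      intro x hx
      have := key c hc _ (ih x hx)
      rw [pow_succ]; simpa [mul_assoc] using this
  refine ⟨fun x hx h => ?_⟩
  obtain ⟨j, i, e⟩ := nf h⁻¹
  have : h * x * h⁻¹ = (a ^ i)⁻¹ * ((b ^ j)⁻¹ * x * b ^ j) * a ^ i := by
    rw [show h = (h⁻¹)⁻¹ by simp, e]; group
  rw [this]
  exact keyp a ha i _ (keyp b hb j x hx)

lemma exists_fact {c b : G} (hn : (Subgroup.zpowers c).Normal)
    (h : Subgroup.zpowers c ⊔ Subgroup.zpowers b = ⊤) :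
    ∃ f : MetacyclicFact G, f.A = Subgroup.zpowers c := by
  refine ⟨⟨Subgroup.zpowers c, Subgroup.zpowers b, hn, inferInstance, inferInstance, ?_⟩, rfl⟩
  intro g
  have hg : g ∈ Subgroup.zpowers c ⊔ Subgroup.zpowers b := h ▸ Subgroup.mem_top g
  obtain ⟨y, hy, z, hz, e⟩ := Subgroup.mem_sup_of_normal_left.1 hg
  exact ⟨y, hy, z, hz, e.symm⟩

lemma normal_form_of_sup (conj : a * b = b * a ^ t) (hn : (Subgroup.zpowers a).Normal)
    (h : Subgroup.zpowers a ⊔ Subgroup.zpowers b = ⊤) (g : G) : ∃ j i : ℕ, g = b ^ j * a ^ i := by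
  have hg : g ∈ Subgroup.zpowers a ⊔ Subgroup.zpowers b := h ▸ Subgroup.mem_top g
  obtain ⟨y, hy, z, hz, e⟩ := Subgroup.mem_sup_of_normal_left.1 hg
  obtain ⟨i, rfl⟩ := mem_zpowers_iff_nat.1 hy
  obtain ⟨j, rfl⟩ := mem_zpowers_iff_nat.1 hz
  exact ⟨j, i * t ^ j, by rw [← e, pow_mul_pow_comm_of_rel conj]⟩

lemma orderOf_pow_of_conj (conj : a * b = b * a ^ t) : orderOf (a ^ t) = orderOf a := by
  have : a ^ t = MulAut.conj b⁻¹ a := by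
    rw [MulAut.conj_apply, inv_inv, mul_assoc, conj]; group
  rw [this]; exact orderOf_injective (MulAut.conj b⁻¹).toMonoidHom (MulAut.conj b⁻¹).injective a

lemma coprime_of_conj (conj : a * b = b * a ^ t) : t.Coprime (orderOf a) := by
  have h := orderOf_pow_of_conj conj
  rw [orderOf_pow] at h
  have h0 := orderOf_pos a
  rcases Nat.div_eq_self.1 h with h | h
  · omega
  · exact (Nat.coprime_comm.1 h)

lemma conj_pow_eq (conj : a * b = b * a ^ t) (j i k : ℕ) :
    (b ^ j * a ^ i)⁻¹ * a ^ k * (b ^ j * a ^ i) = a ^ (k * t ^ j) := by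
  have h := pow_mul_pow_comm_of_rel conj k j
  rw [mul_inv_rev, mul_assoc, mul_assoc, ← mul_assoc (a ^ k), h]
  have : a ^ (k * t ^ j) * a ^ i = a ^ i * a ^ (k * t ^ j) := by rw [← pow_add, ← pow_add, add_comm]
  rw [mul_assoc (b ^ j), this]; group

lemma rOfA_eq (conj : a * b = b * a ^ t) (nf : ∀ g : G, ∃ j i : ℕ, g = b ^ j * a ^ i) :
    rOfA (Subgroup.zpowers a) = sSup (rSet (orderOf a) t) := by
  have hcard : Nat.card (Subgroup.zpowers a) = orderOf a := Nat.card_zpowers a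
  rw [rOfA]
  obtain ⟨T, hT⟩ : ∃ T, T = TG (Subgroup.zpowers a) := ⟨_, rfl⟩
  have h1 : ∀ u ∈ T, ∃ j : ℕ, ((t ^ j : ℕ) : ZMod (Nat.card (Subgroup.zpowers a))) = u := by
    have hcop : t.Coprime (Nat.card (Subgroup.zpowers a)) := hcard ▸ coprime_of_conj conj
    have hle : T ≤ Subgroup.zpowers (ZMod.unitOfCoprime t hcop) := by
      rw [hT, TG, TGmod, Subgroup.closure_le]
      rintro u ⟨g, k, hk, hg⟩
      obtain ⟨j, i, rfl⟩ := nf g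
      have := hg a (Subgroup.mem_zpowers a)
      have h2 := conj_pow_eq conj j i 1
      rw [pow_one, this, one_mul, pow_eq_pow_iff_modEq, ← hcard,
        ← ZMod.natCast_eq_natCast_iff, hk] at h2
      refine mem_zpowers_iff_nat.2 ⟨j, Units.ext ?_⟩
      rw [h2]; simp
    have : Finite (ZMod (Nat.card (Subgroup.zpowers a)))ˣ := by
      have : NeZero (Nat.card (Subgroup.zpowers a)) := ⟨Nat.card_pos.ne'⟩
      infer_instance
    intro u hu
    obtain ⟨j, hj⟩ := mem_zpowers_iff_nat.1 (hle hu)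
    exact ⟨j, by rw [← hj]; simp⟩
  have h2 : ∃ u ∈ T, (t : ZMod (Nat.card (Subgroup.zpowers a))) = (u : ZMod _) := by
    have hcop : t.Coprime (Nat.card (Subgroup.zpowers a)) := hcard ▸ coprime_of_conj conj
    refine ⟨ZMod.unitOfCoprime t hcop, ?_, by simp⟩
    rw [hT, TG, TGmod]
    apply Subgroup.subset_closure
    refine ⟨b, t, by simp, fun x hx => ?_⟩
    obtain ⟨k, rfl⟩ := mem_zpowers_iff_nat.1 hx
    have := conj_pow_eq conj 1 0 k
    simpa [pow_mul] using this
  rw [← hT]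
  congr 1
  ext r
  constructor
  · rintro ⟨hr, ha, hb⟩
    obtain ⟨u, hu, hut⟩ := h2
    refine ⟨hcard ▸ hr, ?_, ?_⟩
    · have := ha u hu t hut
      rw [← Nat.cast_one, ZMod.natCast_eq_natCast_iff] at this
      exact this
    · refine (hb u hu t hut).imp ?_ ?_
      · intro h; rwa [← Nat.cast_one, ZMod.natCast_eq_natCast_iff] at h
      · intro h
        rw [← ZMod.natCast_eq_zero_iff]; push_cast; rw [h]; ring
  · rintro ⟨hr, ha, hb⟩
    have hr' : r ∣ Nat.card (Subgroup.zpowers a) := hcard.symm ▸ hr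
    refine ⟨hr', ?_, ?_⟩
    · intro u hu k hk
      obtain ⟨j, hj⟩ := h1 u hu
      rw [← hj, ZMod.natCast_eq_natCast_iff] at hk
      rw [← Nat.cast_one, ZMod.natCast_eq_natCast_iff]
      exact (hk.of_dvd ((Nat.ordCompl_dvd r 2).trans hr')).trans (modEq_pow_one ha)
    · intro u hu k hk
      obtain ⟨j, hj⟩ := h1 u hu
      rw [← hj, ZMod.natCast_eq_natCast_iff] at hk
      have hk := hk.of_dvd ((Nat.ordProj_dvd r 2).trans hr')
      rw [← ZMod.natCast_eq_natCast_iff] at hk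
      rw [hk]
      rcases hb with hb | hb
      · left
        rw [← Nat.cast_one, ZMod.natCast_eq_natCast_iff]
        exact modEq_pow_one hb
      · rw [← ZMod.natCast_eq_zero_iff] at hb
        push_cast at hb ⊢
        rw [eq_neg_of_add_eq_zero_left hb]
        exact neg_one_pow_eq_or _ j

end Group

end

section

section Group
variable {G : Type*} [Group G] [Finite G] {a b : G} {m n s t : ℕ}

lemma Pres.of_rel (ord : orderOf a = m) (conj : a * b = b * a ^ t) (pow_n : b ^ n = a ^ s)
    (card : Nat.card G = m * n) (dvd_of_mem : ∀ k i : ℕ, b ^ k = a ^ i → n ∣ k)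
    (nf : ∀ g : G, ∃ j i : ℕ, g = b ^ j * a ^ i) (cop : t.Coprime (m * n)) :
    Pres a b m n s t := by
  have hpos : 0 < m * n := card ▸ Nat.card_pos
  refine ⟨⟨Nat.pos_of_mul_pos_right hpos, Nat.pos_of_mul_pos_left hpos, ?_, ?_, cop⟩, ord, conj, pow_n,
    card, dvd_of_mem, nf⟩
  · rw [← ord, ← pow_eq_pow_iff_modEq]
    have := pow_mul_pow_comm_of_rel conj s 1
    rw [← pow_n, (Commute.pow_pow_self b n 1).eq, mul_left_cancel_iff, pow_one, pow_n] at this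
    exact this.symm
  · rw [← ord, ← pow_eq_pow_iff_modEq]
    have := pow_mul_pow_comm_of_rel conj 1 n
    rw [pow_n, (Commute.pow_pow_self a 1 s).eq, mul_left_cancel_iff, one_mul] at this
    exact this.symm

lemma mul_pow_of_rel {A B : G} {v : ℕ} (h : A * B = B * A ^ v) (y j : ℕ) :
    (B * A ^ y) ^ j = B ^ j * A ^ (y * ∑ i ∈ Finset.range j, v ^ i) := by
  induction j with
  | zero => simp
  | succ j ih =>
    have h2 := pow_mul_pow_comm_of_rel h (y * ∑ i ∈ Finset.range j, v ^ i) 1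
    rw [pow_one, pow_one] at h2
    have e : (y * ∑ i ∈ Finset.range j, v ^ i) * v + y =
        y * ∑ i ∈ Finset.range (j + 1), v ^ i := by rw [geom_sum_succ]; ring
    rw [pow_succ, ih, mul_assoc, ← mul_assoc _ B, h2, mul_assoc B, ← pow_add, ← mul_assoc,
      ← pow_succ, e]

lemma Pres.twist (h : Pres a b m n s t) (e : ℕ) :
    Pres a (b * a ^ e) m n (s + e * ∑ i ∈ Finset.range n, t ^ i) t := by
  have hp := mul_pow_of_rel h.conj e
  have mem : ∀ (x y : G) (i j : ℕ), x * a ^ i = y * a ^ j → ∃ k, x = y * a ^ k := by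
    intro x y i j e
    have : y⁻¹ * x ∈ Subgroup.zpowers a := by
      have : y⁻¹ * x = a ^ j * (a ^ i)⁻¹ := by
        rw [inv_mul_eq_iff_eq_mul, ← mul_assoc, ← e]; group
      rw [this]
      exact mul_mem (pow_mem (Subgroup.mem_zpowers a) _)
        (inv_mem (pow_mem (Subgroup.mem_zpowers a) _))
    obtain ⟨k, hk⟩ := mem_zpowers_iff_nat.1 this
    exact ⟨k, by rw [hk]; group⟩
  refine Pres.of_rel h.ord ?_ ?_ h.card ?_ ?_ h.cop
  · rw [← mul_assoc, h.conj, mul_assoc, mul_assoc, ← pow_add, ← pow_add, add_comm]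
  · rw [hp, h.pow_n, pow_add]
  · intro k i hk
    rw [hp, ← one_mul (a ^ i)] at hk
    obtain ⟨l, hl⟩ := mem _ _ _ _ hk
    exact h.dvd_of_mem k l (by rw [hl, one_mul])
  · intro g
    obtain ⟨j, i, rfl⟩ := h.normal_form g
    obtain ⟨k, hk⟩ := mem (b ^ j * a ^ i) ((b * a ^ e) ^ j)
      (e * ∑ i ∈ Finset.range j, t ^ i) i (by
        rw [hp, mul_assoc, mul_assoc, ← pow_add, ← pow_add, add_comm])
    exact ⟨j, k, hk⟩

lemma exists_pres (f : MetacyclicFact G) : ∃ (a b : G) (s t : ℕ), 1 ≤ t ∧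
    Pres a b (Nat.card f.A) f.A.index s t ∧ f.A = Subgroup.zpowers a := by
  have hN := f.normalA
  obtain ⟨a, ha⟩ := (Subgroup.isCyclic_iff_exists_zpowers_eq_top f.A).1 f.cyclicA
  obtain ⟨b, hb⟩ := (Subgroup.isCyclic_iff_exists_zpowers_eq_top f.B).1 f.cyclicB
  have hm : orderOf a = Nat.card f.A := by rw [← ha, Nat.card_zpowers]
  have hsup : Subgroup.zpowers a ⊔ Subgroup.zpowers b = ⊤ := by
    rw [ha, hb, eq_top_iff]
    rintro g -
    obtain ⟨x, hx, y, hy, rfl⟩ := f.mul_cover g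
    exact Subgroup.mul_mem_sup hx hy
  have hmem : b⁻¹ * a * b ∈ Subgroup.zpowers a := by
    rw [ha]
    have := hN.conj_mem a (ha ▸ Subgroup.mem_zpowers a) b⁻¹
    rwa [inv_inv] at this
  obtain ⟨k, hk⟩ := mem_zpowers_iff_nat.1 hmem
  have hk' : a * b = b * a ^ k := by rw [hk]; group
  have hkc : k.Coprime (Nat.card f.A) := hm ▸ coprime_of_conj hk'
  obtain ⟨N, hNdef⟩ : ∃ N, N = Nat.card f.A * f.A.index := ⟨_, rfl⟩
  have hcard : Nat.card G = Nat.card f.A * f.A.index := (Subgroup.card_mul_index f.A).symm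
  have hN0 : 0 < N := by rw [hNdef, ← hcard]; exact Nat.card_pos
  have : NeZero N := ⟨hN0.ne'⟩
  obtain ⟨u, hu⟩ := ZMod.unitsMap_surjective (hNdef ▸ Dvd.intro _ rfl : Nat.card f.A ∣ N)
    (ZMod.unitOfCoprime k hkc)
  obtain ⟨t, ht⟩ : ∃ t, t = (u : ZMod N).val + N := ⟨_, rfl⟩
  have htk : t ≡ k [MOD Nat.card f.A] := by
    rw [← ZMod.natCast_eq_natCast_iff]
    have h1 := congrArg Units.val hu
    rw [ZMod.unitsMap_val, ZMod.coe_unitOfCoprime] at h1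
    rw [← h1, ht, Nat.cast_add, ZMod.natCast_val,
      (ZMod.natCast_eq_zero_iff _ _).2 (hNdef ▸ Dvd.intro _ rfl : Nat.card f.A ∣ N), add_zero]
  have conj : a * b = b * a ^ t := by
    rw [hk', pow_eq_of_modEq (hm ▸ pow_orderOf_eq_one a) htk]
  have hn : b ^ f.A.index ∈ Subgroup.zpowers a := by
    rw [ha]; exact Subgroup.pow_index_mem f.A b
  obtain ⟨s, hs⟩ := mem_zpowers_iff_nat.1 hn
  have nf := normal_form_of_sup conj (ha ▸ hN) hsup
  refine ⟨a, b, s, t, by omega, Pres.of_rel hm conj hs.symm hcard ?_ nf ?_, ha.symm⟩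
  · intro k i hki
    have h1 : (QuotientGroup.mk b : G ⧸ f.A) ^ k = 1 := by
      rw [← QuotientGroup.mk_pow, QuotientGroup.eq_one_iff, hki, ← ha]
      exact pow_mem (Subgroup.mem_zpowers a) i
    have h2 : orderOf (QuotientGroup.mk b : G ⧸ f.A) = Nat.card (G ⧸ f.A) := by
      apply orderOf_eq_card_of_forall_mem_zpowers
      intro x
      obtain ⟨g, rfl⟩ := QuotientGroup.mk_surjective x
      obtain ⟨j, i, rfl⟩ := nf g
      refine mem_zpowers_iff_nat.2 ⟨j, ?_⟩
      have : (QuotientGroup.mk (a ^ i) : G ⧸ f.A) = 1 := by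
        rw [QuotientGroup.eq_one_iff, ← ha]
        exact pow_mem (Subgroup.mem_zpowers a) i
      rw [QuotientGroup.mk_mul, this, mul_one, QuotientGroup.mk_pow]
    rw [Subgroup.index_eq_card, ← h2]
    exact orderOf_dvd_of_pow_eq_one h1
  · rw [← hNdef, ht, Nat.coprime_add_self_left]
    exact ZMod.val_coe_unit_coprime u

end Group

end

section

lemma exists_inv_mod {p E y : ℕ} (hp : p.Prime) (hy : ¬ p ∣ y) : ∃ x, y * x ≡ 1 [MOD p ^ E] := by
  obtain ⟨x, -, hx⟩ := Nat.exists_mul_mod_eq_of_coprime 1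
    (((hp.coprime_iff_not_dvd).2 hy).pow_left E).symm (pow_pos hp.pos E).ne'
  exact ⟨x, hx⟩

section Group
variable {G : Type*} [Group G] [Finite G] {a b c : G} {p m n s t μ m' ν n' r σ δ : ℕ}

lemma PPar.pow_modEq (P : PPar p m n s t μ m' ν n' r σ δ) (h : Par m n s t) :
    t ^ (p ^ δ * n') ≡ 1 [MOD m'] := by
  obtain ⟨q, hq, hqt⟩ := P.δ_q
  have h1 : t ^ n ≡ 1 [MOD m'] := h.t_pow.of_dvd (Dvd.intro_left _ P.hm.symm)
  have h2 := modEq_one_of_pow h1 hqt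
  have h3 : n.gcd (p ^ δ * q) ∣ p ^ δ * n' := by
    rw [P.hn, ← Nat.sub_add_cancel P.δ_le, pow_add, mul_comm (p ^ (ν - δ)), mul_assoc,
      Nat.gcd_mul_left,
      Nat.Coprime.gcd_mul_left_cancel _ (((P.prime.coprime_iff_not_dvd).2 hq).pow_left _)]
    exact mul_dvd_mul_left _ (Nat.gcd_dvd_left _ _)
  obtain ⟨k, hk⟩ := h3
  rw [hk, pow_mul]
  exact modEq_pow_one h2

/-- Replacing the `p`-part of the cyclic normal subgroup. -/
lemma Pres.change (h : Pres a b m n s t) (ht : 1 ≤ t) (hp : p.Prime) (pm : ¬ p ∣ m')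
    (hm : m = p ^ μ * m') {X y q E τ k : ℕ} (hc : c = b ^ X * a ^ (m' * y))
    (hv : t ^ X ≡ 1 [MOD m' * q]) (hq : a ^ (m' * q) = c ^ k) (hcE : c ^ p ^ E = 1)
    (hy : ¬ p ∣ y) (hb : c * b = b * c ^ τ) :
    (Subgroup.zpowers (c * a ^ p ^ μ)).Normal ∧
    Subgroup.zpowers (c * a ^ p ^ μ) ⊔ Subgroup.zpowers b = ⊤ ∧
    orderOf (c * a ^ p ^ μ) ∣ p ^ E * m' ∧
    ∀ x, x ≡ τ [MOD p ^ E] → x ≡ t [MOD m'] →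
      (c * a ^ p ^ μ) * b = b * (c * a ^ p ^ μ) ^ x := by
  obtain ⟨a2, ha2⟩ : ∃ a2, a2 = a ^ p ^ μ := ⟨_, rfl⟩
  rw [← ha2]
  have ham : a ^ m = 1 := h.ord ▸ pow_orderOf_eq_one a
  have ha2m : a2 ^ m' = 1 := by rw [ha2, ← pow_mul, ← hm, ham]
  have hcomm : Commute c a2 := by
    have h1 : Commute (a ^ (m' * y)) a2 := by rw [ha2]; exact Commute.pow_pow_self a _ _
    have h2 : Commute (b ^ X) a2 := by
      have h3 := pow_mul_pow_comm_of_rel h.conj (p ^ μ) X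
      rw [pow_mul, ← ha2, pow_eq_of_modEq ha2m (hv.of_dvd (dvd_mul_right _ _)), pow_one] at h3
      exact h3.symm
    rw [hc]; exact h2.mul_left h1
  obtain ⟨g, hg⟩ : ∃ g, g = c * a2 := ⟨_, rfl⟩
  rw [← hg]
  have hpow : ∀ x, g ^ x = c ^ x * a2 ^ x := fun x => by rw [hg, hcomm.mul_pow]
  have hmemc : c ∈ Subgroup.zpowers g := by
    obtain ⟨u, hu1, hu2⟩ := exists_crt (E := E) hp pm 1 0
    refine mem_zpowers_iff_nat.2 ⟨u, ?_⟩
    rw [hpow, pow_eq_of_modEq hcE hu1, pow_eq_of_modEq ha2m hu2, pow_one, pow_zero, mul_one]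
  have hmema : a2 ∈ Subgroup.zpowers g := by
    obtain ⟨u, hu1, hu2⟩ := exists_crt (E := E) hp pm 0 1
    refine mem_zpowers_iff_nat.2 ⟨u, ?_⟩
    rw [hpow, pow_eq_of_modEq hcE hu1, pow_eq_of_modEq ha2m hu2, pow_one, pow_zero, one_mul]
  have hab : a2 * b = b * a2 ^ t := by
    have := pow_mul_pow_comm_of_rel h.conj (p ^ μ) 1
    rwa [pow_one, pow_one, pow_mul, ← ha2] at this
  have hgb : ∀ x, x ≡ τ [MOD p ^ E] → x ≡ t [MOD m'] → g * b = b * g ^ x := by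
    intro x hx1 hx2
    rw [hpow, pow_eq_of_modEq hcE hx1, pow_eq_of_modEq ha2m hx2, hg, mul_assoc, hab, ← mul_assoc,
      hb, mul_assoc]
  refine ⟨normal_zpowers_of_gen h.normal_form ?_ ?_, ?_, ?_, hgb⟩
  · obtain ⟨e, he⟩ := (modEq_one_iff_dvd (Nat.one_le_pow _ _ ht)).1 hv
    have hv1 : t ^ X = 1 + m' * q * e := by
      have := Nat.one_le_pow X t ht
      omega
    have h3 := pow_mul_pow_comm_of_rel h.conj 1 X
    rw [one_mul, pow_one, hv1] at h3
    have hgw : g = b ^ X * a ^ (m' * y + p ^ μ) := by rw [hg, hc, ha2, pow_add, mul_assoc]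
    have h5 : a * g = g * a * (c ^ k) ^ e := by
      rw [← hq, ← pow_mul, hgw, ← mul_assoc, h3, mul_assoc, mul_assoc (b ^ X), mul_assoc,
        ← pow_add, ← pow_succ, mul_assoc (b ^ X), ← pow_add]
      exact congrArg (fun x => b ^ X * a ^ x) (by ring)
    have h6 : a⁻¹ * g * a = g * ((c ^ k) ^ e)⁻¹ := by
      rw [mul_assoc, inv_mul_eq_iff_eq_mul, ← mul_assoc, h5, mul_inv_cancel_right]
    rw [h6]
    exact mul_mem (Subgroup.mem_zpowers g) (inv_mem (pow_mem (pow_mem hmemc _) _))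
  · obtain ⟨x, hx1, hx2⟩ := exists_crt (E := E) hp pm τ t
    rw [mul_assoc, hgb x hx1 hx2, inv_mul_cancel_left]
    exact pow_mem (Subgroup.mem_zpowers g) _
  · obtain ⟨S, hS⟩ : ∃ S, S = Subgroup.zpowers g ⊔ Subgroup.zpowers b := ⟨_, rfl⟩
    rw [← hS]
    have hgS : Subgroup.zpowers g ≤ S := hS ▸ le_sup_left
    have hbS : b ∈ S := (hS ▸ le_sup_right : Subgroup.zpowers b ≤ S) (Subgroup.mem_zpowers b)
    have h1 : a ^ (m' * y) ∈ S := by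
      have : a ^ (m' * y) = (b ^ X)⁻¹ * c := by rw [hc]; group
      rw [this]
      exact mul_mem (inv_mem (pow_mem hbS _)) (hgS hmemc)
    have h2 : a ^ p ^ μ ∈ S := ha2 ▸ hgS hmema
    have hcop : (m' * y).Coprime (p ^ μ) :=
      (((hp.coprime_iff_not_dvd).2 (hp.not_dvd_mul pm hy)).pow_left μ).symm
    obtain ⟨u, v, huv⟩ := Nat.isCoprime_iff_coprime.2 hcop
    have haS : a ∈ S := by
      have : a = (a ^ (m' * y)) ^ u * (a ^ p ^ μ) ^ v := by
        rw [← zpow_natCast, ← zpow_natCast, ← zpow_mul, ← zpow_mul, ← zpow_add,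
          mul_comm _ u, mul_comm _ v, huv, zpow_one]
      rw [this]
      exact mul_mem (zpow_mem h1 _) (zpow_mem h2 _)
    rw [eq_top_iff]
    rintro x -
    obtain ⟨j, i, rfl⟩ := h.normal_form x
    exact mul_mem (pow_mem hbS _) (pow_mem haS _)
  · apply orderOf_dvd_of_pow_eq_one
    rw [hpow, pow_mul, hcE, one_pow, one_mul, mul_comm, pow_mul, ha2m, one_pow]

/-- If `σ < r` and `σ + δ ≤ ν`, the cyclic normal subgroup can be made smaller. -/
lemma PPar.exists_smaller (P : PPar p m n s t μ m' ν n' r σ δ) (h : Pres a b m n s t) (ht : 1 ≤ t)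
    (hσr : σ < r) (hν : σ + δ ≤ ν) : ∃ f : MetacyclicFact G, Nat.card f.A < m := by
  have hp := P.prime
  have hrμ := P.r_le
  have ham : a ^ m = 1 := h.ord ▸ pow_orderOf_eq_one a
  obtain ⟨a1, ha1⟩ : ∃ a1, a1 = a ^ m' := ⟨_, rfl⟩
  have ha1m : a1 ^ p ^ μ = 1 := by rw [ha1, ← pow_mul, mul_comm, ← P.hm, ham]
  obtain ⟨z, hz⟩ := P.σ_dvd
  have hpz : ¬ p ∣ z := by
    rintro ⟨w, rfl⟩
    exact P.σ_max (by omega) ⟨w, by rw [hz, pow_succ, mul_assoc]⟩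
  obtain ⟨X, hX⟩ : ∃ X, X = m' * (p ^ (ν - σ) * n') := ⟨_, rfl⟩
  have hvm : t ^ X ≡ 1 [MOD m'] := by
    have : ∃ w, X = p ^ δ * n' * w := ⟨m' * p ^ (ν - σ - δ), by
      rw [hX, show ν - σ = δ + (ν - σ - δ) by omega, pow_add,
        show δ + (ν - σ - δ) - δ = ν - σ - δ by omega]; ring⟩
    obtain ⟨w, hw⟩ := this
    rw [hw, pow_mul]
    exact modEq_pow_one (P.pow_modEq h.toPar)
  have hvp : t ^ X ≡ 1 [MOD p ^ r] := P.t_modEq le_rfl X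
  have hv : t ^ X ≡ 1 [MOD m' * p ^ r] := by
    rw [mul_comm]; exact modEq_mul_of_modEq hp P.pm hvp hvm
  obtain ⟨w, hw⟩ : ∃ w, ∑ i ∈ Finset.range (p ^ (r - 1)), (t ^ X) ^ i = p ^ (r - 1) * w := by
    have h1 := (geom_sum_modEq hvp (p ^ (r - 1))).of_dvd (pow_dvd_pow p (by omega : r - 1 ≤ r))
    exact (Nat.modEq_zero_iff_dvd).1 (h1.trans (by simp [Nat.ModEq]))
  have hwp : w ≡ 1 [MOD p] := by
    have h1 := geom_sum_modEq hvp (p ^ (r - 1))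
    rw [hw, show r = (r - 1) + 1 by omega, pow_succ] at h1
    simp only [Nat.add_sub_cancel] at h1
    exact Nat.ModEq.mul_left_cancel' (pow_pos hp.pos _).ne' (by rwa [mul_one])
  have hpw : ¬ p ∣ w := by
    intro hd
    have := hwp.symm.trans ((Nat.modEq_zero_iff_dvd).2 hd)
    exact hp.one_lt.ne' (Nat.dvd_one.1 ((Nat.modEq_zero_iff_dvd).1 this))
  obtain ⟨y, hy⟩ : ∃ y, z + w * y ≡ p [MOD p ^ μ] := by
    obtain ⟨x, hx⟩ := exists_inv_mod (E := μ) hp hpw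
    obtain ⟨z', hz'⟩ : ∃ z', z + z' ≡ p [MOD p ^ μ] := by
      refine ⟨p + (p ^ μ * z - z), ?_⟩
      have : z ≤ p ^ μ * z := Nat.le_mul_of_pos_left z (pow_pos hp.pos μ)
      rw [show z + (p + (p ^ μ * z - z)) = p + p ^ μ * z by omega]
      simp [Nat.ModEq]
    refine ⟨x * z', Nat.ModEq.trans (Nat.ModEq.add_left z ?_) hz'⟩
    rw [← mul_assoc]
    simpa using hx.mul_right z'
  have hpy : ¬ p ∣ y := by
    intro hd
    have h1 : z + w * y ≡ 0 [MOD p] := (hy.of_dvd (dvd_pow_self p (by omega))).trans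
      ((Nat.modEq_zero_iff_dvd).2 dvd_rfl)
    exact hpz ((Nat.dvd_add_left (hd.mul_left w)).1 ((Nat.modEq_zero_iff_dvd).1 h1))
  obtain ⟨c, hc⟩ : ∃ c, c = b ^ X * a ^ (m' * y) := ⟨_, rfl⟩
  have hc1 : c = b ^ X * a1 ^ y := by rw [hc, pow_mul, ha1]
  have hgs : (b ^ X) ^ p ^ σ = a1 ^ s := by
    have e : X * p ^ σ = n * m' := by
      have : p ^ ν = p ^ (ν - σ) * p ^ σ := by rw [← pow_add]; congr 1; omega
      rw [hX, P.hn, this]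
      ring
    rw [← pow_mul, e, pow_mul, h.pow_n, ← pow_mul, mul_comm, pow_mul, ← ha1]
  have hcL : c ^ p ^ (r - 1) = a1 ^ p ^ r := by
    have hrel := pow_mul_pow_comm_of_rel h.conj m' X
    rw [pow_mul, ← ha1] at hrel
    have e : (b ^ X) ^ p ^ (r - 1) = a1 ^ (p ^ (r - 1) * z) := by
      rw [show r - 1 = σ + (r - 1 - σ) by omega, pow_add, pow_mul, hgs, ← pow_mul, hz]
      exact congrArg (a1 ^ ·) (by ring)
    rw [hc1, mul_pow_of_rel hrel, hw, e, ← pow_add,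
      show p ^ (r - 1) * z + y * (p ^ (r - 1) * w) = (z + w * y) * p ^ (r - 1) by ring, pow_mul,
      pow_eq_of_modEq ha1m hy, ← pow_mul, ← pow_succ', show r - 1 + 1 = r by omega]
  have hcE : c ^ p ^ (μ - 1) = 1 := by
    rw [show μ - 1 = (r - 1) + (μ - r) by omega, pow_add, pow_mul, hcL, ← pow_mul, ← pow_add,
      show r + (μ - r) = μ by omega, ha1m]
  obtain ⟨f, hf⟩ := (modEq_one_iff_dvd ht).1 P.r_mod
  have hb : c * b = b * c ^ (1 + p ^ (r - 1) * (y * f)) := by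
    have h1 := pow_mul_pow_comm_of_rel h.conj (m' * y) 1
    rw [pow_one, pow_one, show t = 1 + p ^ r * f by omega, mul_add, mul_one, pow_add,
      show m' * y * (p ^ r * f) = m' * (p ^ r * (y * f)) by ring, pow_mul _ m' (_ * _),
      pow_mul _ m' y, ← ha1] at h1
    rw [pow_add, pow_mul, hcL, pow_one, ← pow_mul]
    calc c * b = b ^ X * (a1 ^ y * b) := by rw [hc1, mul_assoc]
      _ = b ^ X * b * (a1 ^ y * a1 ^ (p ^ r * (y * f))) := by rw [h1, mul_assoc]
      _ = _ := by rw [← pow_succ, pow_succ', hc1]; simp only [mul_assoc]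
  obtain ⟨h1, h2, h3, -⟩ := h.change ht hp P.pm P.hm hc hv
    (by rw [pow_mul, ← ha1]; exact hcL.symm) hcE hpy hb
  obtain ⟨F, hF⟩ := exists_fact h1 h2
  refine ⟨F, ?_⟩
  rw [hF, Nat.card_zpowers]
  refine (Nat.le_of_dvd (Nat.mul_pos (pow_pos hp.pos _) P.m'_pos) h3).trans_lt ?_
  rw [P.hm]
  exact Nat.mul_lt_mul_of_pos_right (Nat.pow_lt_pow_right hp.one_lt (by omega)) P.m'_pos

end Group

end

section

section Group
variable {G : Type*} [Group G] [Finite G] {a b c : G} {p m n s t μ m' ν n' r σ δ : ℕ}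

/-- After replacing `b`, the exponent `s` has `p`-adic valuation exactly `ν`. -/
lemma PPar.twist (P : PPar p m n s t μ m' ν n' r σ 0) (hσ : ν < σ) (hr : ν < r) :
    PPar p m n (s + m' * ∑ i ∈ Finset.range n, t ^ i) t μ m' ν n' r ν 0 := by
  have h1 := geom_sum_modEq P.r_mod n
  have h2 : p ^ (ν + 1) ∣ s := (pow_dvd_pow p hσ).trans P.σ_dvd
  have hrμ := P.r_le
  refine { P with σ_le := by omega, σ_dvd := ?_, σ_max := ?_ }
  · refine dvd_add ((pow_dvd_pow p hσ.le).trans P.σ_dvd) (Dvd.dvd.mul_left ?_ _)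
    exact (h1.dvd_iff (pow_dvd_pow p hr.le)).2 (Dvd.intro _ P.hn.symm)
  · intro _ h3
    have h4 := (Nat.dvd_add_right h2).1 h3
    have h5 := (((P.prime.coprime_iff_not_dvd).2 P.pm).pow_left _).dvd_of_dvd_mul_left h4
    have h6 := (h1.dvd_iff (pow_dvd_pow p hr)).1 h5
    rw [P.hn] at h6
    have := ppow_dvd_of_dvd_mul P.prime P.pn h6
    omega

lemma Pres.minCond (h : Pres a b m n s t) (ht : 1 ≤ t)
    (hmin : ∀ f : MetacyclicFact G, m ≤ Nat.card f.A) : MinCond m n s t := by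
  intro p μ m' ν n' r σ δ P _
  constructor
  · rintro ⟨h1, h2⟩
    obtain ⟨f, hf⟩ := P.exists_smaller h ht h1 h2
    exact absurd (hmin f) (by omega)
  · rintro rfl ⟨h1, h2⟩
    obtain ⟨f, hf⟩ := (P.twist h1 h2).exists_smaller (h.twist m') ht h2 le_rfl
    exact absurd (hmin f) (by omega)

lemma PPar.half_dvd (P : PPar 2 m n s t μ m' ν n' r σ δ) (h : Par m n s t) (ht1 : 1 ≤ t)
    (hμ : 2 ≤ μ) (ht : 2 ^ μ ∣ t + 1) : 2 ^ (μ - 1) ∣ s := by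
  have ht4 : 4 ∣ t + 1 := (pow_dvd_pow 2 hμ).trans ht
  have hmul : m ∣ s * (t - 1) := by
    rw [Nat.mul_sub, mul_one]
    exact (Nat.modEq_iff_dvd' (Nat.le_mul_of_pos_right s ht1)).1 h.s_mul.symm
  obtain ⟨c, hc⟩ : ∃ c, t - 1 = 2 * c := ⟨(t - 1) / 2, by omega⟩
  have hc2 : ¬ 2 ∣ c := by omega
  have h1 : 2 ^ (μ - 1) * 2 ∣ s * c * 2 := by
    rw [← pow_succ, show μ - 1 + 1 = μ by omega, mul_assoc, mul_comm c 2, ← hc]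
    exact (Dvd.intro _ P.hm.symm).trans hmul
  exact Nat.Coprime.dvd_of_dvd_mul_right
    (((Nat.prime_two.coprime_iff_not_dvd).2 hc2).pow_left _)
    (Nat.dvd_of_mul_dvd_mul_right two_pos h1)

/-- Passing from the action `-1` to the action `2 ^ (μ - 1) - 1` lowers `r`. -/
lemma sSup_rSet_lt {x : ℕ} (hm : m = 2 ^ μ * m') (pm : ¬ 2 ∣ m') (hμ : 3 ≤ μ)
    (ht : 2 ^ μ ∣ t + 1) (hx2 : x ≡ 2 ^ (μ - 1) - 1 [MOD 2 ^ μ]) (hxm : x ≡ t [MOD m']) :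
    sSup (rSet m x) < sSup (rSet m t) := by
  have hm0 : 0 < m := by
    rw [hm]; exact Nat.mul_pos (pow_pos two_pos _) (Nat.pos_of_ne_zero (by rintro rfl; simp at pm))
  obtain ⟨R, hR⟩ : ∃ R, R = sSup (rSet m x) := ⟨_, rfl⟩
  obtain ⟨hRm, ho, hp⟩ : R ∈ rSet m x :=
    hR ▸ Nat.sSup_mem ⟨1, one_mem_rSet m x⟩ (rSet_bddAbove hm0)
  rw [← hR]
  have hR0 : 0 < R := Nat.pos_of_dvd_of_pos hRm hm0
  obtain ⟨j, hj⟩ : ∃ j, j = R.factorization 2 := ⟨_, rfl⟩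
  obtain ⟨o, hoR⟩ : ∃ o, o = ordCompl[2] R := ⟨_, rfl⟩
  have hRe : R = 2 ^ j * o := by rw [hj, hoR, Nat.ordProj_mul_ordCompl_eq_self]
  have ho2 : ¬ 2 ∣ o := hoR ▸ Nat.not_dvd_ordCompl Nat.prime_two hR0.ne'
  rw [← hoR] at ho
  rw [← hj] at hp
  have hjμ : j ≤ μ := ppow_dvd_of_dvd_mul Nat.prime_two pm
    (hm ▸ (Dvd.intro _ hRe.symm).trans hRm)
  have hom : o ∣ m' := by
    have h1 : o ∣ 2 ^ μ * m' := hm ▸ (Dvd.intro_left _ hRe.symm).trans hRm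
    exact (((Nat.prime_two.coprime_iff_not_dvd).2 ho2).symm.pow_right μ).dvd_of_dvd_mul_left h1
  have h4 : 4 ∣ 2 ^ (μ - 1) := pow_dvd_pow 2 (by omega : 2 ≤ μ - 1)
  have hlt : 2 ^ (μ - 1) < 2 ^ μ := Nat.pow_lt_pow_right (by norm_num) (by omega)
  have hpos : 0 < 2 ^ (μ - 1) := by positivity
  have hjlt : j < μ := by
    refine lt_of_le_of_ne hjμ ?_
    rintro rfl
    rcases hp with hp | hp
    · have : 2 ^ (j - 1) - 1 ≡ 1 [MOD 4] :=
        (hx2.symm.trans hp).of_dvd (pow_dvd_pow 2 (by omega : 2 ≤ j))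
      have : (2 ^ (j - 1) - 1) % 4 = 1 % 4 := this
      omega
    · have h5 := ((hx2.add_right 1).dvd_iff dvd_rfl).1 hp
      rw [Nat.sub_add_cancel hpos] at h5
      exact absurd (Nat.le_of_dvd hpos h5) (by omega)
  have hmem : 2 * R ∈ rSet m t := by
    have e : 2 * R = 2 ^ (j + 1) * o := by rw [hRe, pow_succ]; ring
    have hf : (2 * R).factorization 2 = j + 1 := by
      rw [e]; exact fact_ppow_mul Nat.prime_two ho2
    refine ⟨?_, ?_, Or.inr ?_⟩
    · rw [e, hm]; exact mul_dvd_mul (pow_dvd_pow 2 hjlt) hom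
    · rw [hf, e, Nat.mul_div_cancel_left _ (by positivity)]
      exact (hxm.of_dvd hom).symm.trans ho
    · rw [hf]; exact (pow_dvd_pow 2 hjlt).trans ht
  have := le_csSup (rSet_bddAbove hm0) hmem
  omega

lemma Pres.minCond2 (h : Pres a b m n s t) (ht : 1 ≤ t)
    (hmin : ∀ f : MetacyclicFact G, m ≤ Nat.card f.A)
    (hmin' : ∀ f : MetacyclicFact G, Nat.card f.A = m → sSup (rSet m t) ≤ rOfA f.A) :
    MinCond2 m n s t := by
  intro μ m' ν n' r σ δ P hμ hν htμ hs
  by_contra hδ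
  have hδ : δ ≤ ν - 1 := by have := P.δ_le; omega
  obtain ⟨z, hz⟩ := P.half_dvd h.toPar ht (by omega) htμ
  have hz2 : ¬ 2 ∣ z := by
    rintro ⟨w, rfl⟩
    apply hs
    rw [hz, ← mul_assoc, ← pow_succ, show μ - 1 + 1 = μ by omega]
    exact dvd_mul_right _ _
  have ham : a ^ m = 1 := h.ord ▸ pow_orderOf_eq_one a
  obtain ⟨a1, ha1⟩ : ∃ a1, a1 = a ^ m' := ⟨_, rfl⟩
  have ha1m : a1 ^ 2 ^ μ = 1 := by rw [ha1, ← pow_mul, mul_comm, ← P.hm, ham]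
  obtain ⟨X, hX⟩ : ∃ X, X = m' * (2 ^ (ν - 1) * n') := ⟨_, rfl⟩
  have hsq := sq_modEq_one_of_dvd htμ
  have hv2 : t ^ X ≡ 1 [MOD 2 ^ μ] := by
    have : X = 2 * (m' * (2 ^ (ν - 2) * n')) := by
      rw [hX, show ν - 1 = ν - 2 + 1 by omega, pow_succ]; ring
    rw [this, pow_mul]
    exact modEq_pow_one hsq
  have hvm : t ^ X ≡ 1 [MOD m'] := by
    have : X = 2 ^ δ * n' * (m' * 2 ^ (ν - 1 - δ)) := by
      rw [hX, show ν - 1 = δ + (ν - 1 - δ) by omega, pow_add,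
        show δ + (ν - 1 - δ) - δ = ν - 1 - δ by omega]; ring
    rw [this, pow_mul]
    exact modEq_pow_one (P.pow_modEq h.toPar)
  have hv : t ^ X ≡ 1 [MOD m' * 2 ^ μ] := by
    rw [mul_comm]; exact modEq_mul_of_modEq Nat.prime_two P.pm hv2 hvm
  obtain ⟨c, hc⟩ : ∃ c, c = b ^ X * a ^ (m' * 1) := ⟨_, rfl⟩
  have hc1 : c = b ^ X * a1 ^ 1 := by rw [hc, pow_mul, ha1]
  have hgs : (b ^ X) ^ 2 = a1 ^ s := by
    have e : X * 2 = n * m' := by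
      have : 2 ^ ν = 2 ^ (ν - 1) * 2 := by rw [← pow_succ]; congr 1; omega
      rw [hX, P.hn, this]
      ring
    rw [← pow_mul, e, pow_mul, h.pow_n, ← pow_mul, mul_comm, pow_mul, ← ha1]
  have hc2 : c ^ 2 = a1 ^ (s + 2) := by
    have hrel := pow_mul_pow_comm_of_rel h.conj m' X
    rw [pow_mul, ← ha1] at hrel
    rw [hc1, mul_pow_of_rel hrel, hgs, ← pow_add]
    apply pow_eq_of_modEq ha1m
    apply Nat.ModEq.add_left
    rw [one_mul]
    exact geom_sum_modEq hv2 2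
  obtain ⟨k, rfl⟩ := Nat.exists_eq_add_of_le hμ
  rw [show 3 + k - 1 = k + 2 by omega] at hz
  have hcE : c ^ 2 ^ (3 + k) = 1 := by
    rw [show 3 + k = (k + 2) + 1 by omega, pow_succ', pow_mul, hc2, ← pow_mul]
    apply pow_eq_one_of_dvd ha1m
    rw [hz, show 3 + k = (k + 2) + 1 by omega, pow_succ, mul_comm]
    apply mul_dvd_mul_right
    exact ⟨2 ^ (k + 1) * z + 1, by rw [pow_succ]; ring⟩
  obtain ⟨w, hw⟩ : ∃ w, 2 ^ (k + 1) = w + 1 :=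
    ⟨2 ^ (k + 1) - 1, by have : 0 < 2 ^ (k + 1) := by positivity
                         omega⟩
  have hw2 : ¬ 2 ∣ w := by
    have : 2 ∣ 2 ^ (k + 1) := dvd_pow_self 2 (by omega)
    omega
  have hτ : (s + 2) * w ≡ t - 1 [MOD 2 ^ (3 + k)] := by
    apply Nat.ModEq.add_right_cancel' 2
    rw [show t - 1 + 2 = t + 1 by omega]
    refine Nat.ModEq.trans ?_ ((Nat.modEq_zero_iff_dvd).2 htμ).symm
    rw [Nat.modEq_zero_iff_dvd]
    have e : (s + 2) * w + 2 = 2 ^ (k + 2) * (z * w + 1) := by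
      calc (s + 2) * w + 2 = s * w + (w + 1) * 2 := by ring
        _ = _ := by rw [← hw, hz]; ring
    rw [e, show 3 + k = (k + 2) + 1 by omega, pow_succ]
    apply mul_dvd_mul_left
    have := Nat.prime_two.not_dvd_mul hz2 hw2
    omega
  have hb : c * b = b * c ^ (1 + 2 * w) := by
    have h1 := pow_mul_pow_comm_of_rel h.conj m' 1
    rw [pow_one, pow_one, pow_mul, ← ha1] at h1
    rw [pow_add, pow_mul, hc2, pow_one, ← pow_mul, pow_eq_of_modEq ha1m hτ]
    calc c * b = b ^ X * (a1 * b) := by rw [hc1, pow_one, mul_assoc]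
      _ = b ^ X * b * (a1 ^ 1 * a1 ^ (t - 1)) := by
        rw [h1, ← pow_add, show 1 + (t - 1) = t by omega, mul_assoc]
      _ = _ := by rw [← pow_succ, pow_succ', hc1]; simp only [mul_assoc]
  obtain ⟨h1, h2, h3, h4⟩ := h.change ht Nat.prime_two P.pm P.hm (k := 0) hc hv
    (by rw [mul_comm, ← P.hm, ham, pow_zero]) hcE (by norm_num) hb
  rw [← P.hm] at h3
  obtain ⟨F, hF⟩ := exists_fact h1 h2
  have hFm : orderOf (c * a ^ 2 ^ (3 + k)) = m := by
    apply le_antisymm (Nat.le_of_dvd P.m_pos h3)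
    have := hmin F
    rwa [hF, Nat.card_zpowers] at this
  obtain ⟨x, hx1, hx2⟩ := exists_crt (E := 3 + k) Nat.prime_two P.pm (1 + 2 * w) t
  have hconj := h4 x hx1 hx2
  have hr := hmin' F (by rw [hF, Nat.card_zpowers, hFm])
  rw [hF, rOfA_eq hconj (normal_form_of_sup hconj h1 h2), hFm] at hr
  have e : 1 + 2 * w = 2 ^ (3 + k - 1) - 1 := by
    rw [show 3 + k - 1 = (k + 1) + 1 by omega, pow_succ, hw]; omega
  exact absurd (sSup_rSet_lt P.hm P.pm hμ htμ (e ▸ hx1) hx2) (by omega)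

end Group

lemma IsMinimalFact.exists_pres {G : Type*} [Group G] [Finite G] {f : MetacyclicFact G}
    (hf : IsMinimalFact f) : ∃ (a b : G) (s t : ℕ), 1 ≤ t ∧
      Pres a b (Nat.card f.A) f.A.index s t ∧ rOfA f.A = sSup (rSet (Nat.card f.A) t) ∧
      MinCond (Nat.card f.A) f.A.index s t ∧ MinCond2 (Nat.card f.A) f.A.index s t := by
  obtain ⟨a, b, s, t, ht, h, hA⟩ := ArXiv230800432.exists_pres f
  have hr : rOfA f.A = sSup (rSet (Nat.card f.A) t) := by
    rw [← h.ord, ← rOfA_eq h.conj h.normal_form, hA]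
  have hmin : ∀ f' : MetacyclicFact G, Nat.card f.A ≤ Nat.card f'.A := by
    intro f'
    rcases hf f' with h | ⟨h, -⟩
    · exact h.le
    · exact h.le
  refine ⟨a, b, s, t, ht, h, hr, h.minCond ht hmin, h.minCond2 ht hmin ?_⟩
  intro f' he
  rw [← hr]
  rcases hf f' with h | ⟨-, h | ⟨h, -⟩⟩
  · exact absurd he h.ne'
  · exact h.le
  · exact h.le

end

/-- If `ℚG ≅ ℚH` for finite metacyclic `G, H`, then `m^G = m^H`, `n^G = n^H` and
`r^G = r^H`. -/
theorem m_n_r_eq_of_qalgebra_iso {G H : Type*} [Group G] [Group H] [Finite G] [Finite H]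
    (fG : MetacyclicFact G) (hfG : IsMinimalFact fG)
    (fH : MetacyclicFact H) (hfH : IsMinimalFact fH)
    (h : Nonempty (MonoidAlgebra ℚ G ≃ₐ[ℚ] MonoidAlgebra ℚ H)) :
    mOf fG = mOf fH ∧ nOf fG = nOf fH ∧ rOf fG = rOf fH := by
  obtain ⟨φ⟩ := h
  obtain ⟨a, b, s, t, ht, hP, hr, hc, hc2⟩ := hfG.exists_pres
  obtain ⟨a₁, b₁, s₁, t₁, ht₁, hP₁, hr₁, hc₁, hc2₁⟩ := hfH.exists_pres
  have hcard : Nat.card G = Nat.card H := by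
    rw [← Module.finrank_eq_nat_card_basis (Module.Basis.ofRepr
        (MonoidAlgebra.coeffLinearEquiv (S := ℚ) (M := G) ℚ)),
      ← Module.finrank_eq_nat_card_basis (Module.Basis.ofRepr
        (MonoidAlgebra.coeffLinearEquiv (S := ℚ) (M := H) ℚ))]
    exact φ.toLinearEquiv.finrank_eq
  have B : Bridge (AlgebraicClosure ℚ) (Nat.card fG.A) fG.A.index s t
      (Nat.card fH.A) fH.A.index s₁ t₁ :=
    bridge_of_equiv exists_galois_pow hP hP₁ (by rw [← hP.card, ← hP₁.card, hcard]) φ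
  unfold mOf nOf rOf
  rw [hr, hr₁]
  have hm := B.m_eq ht ht₁ hc hc₁
  have hn := B.n_eq ht ht₁ hc hc₁
  refine ⟨hm, hn, ?_⟩
  rw [← hm, ← hn] at B hc2₁
  rw [← hm]
  exact congrArg sSup (Set.Subset.antisymm (B.rSet_subset ht ht₁ hc2)
    (B.symm.rSet_subset ht₁ ht hc2₁))

end ArXiv230800432
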